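/- Assume that if α ≥ 1/2 there is additionally a constant c_* > 0 with W(x,y) ≥ c_*((x/y)^α + (y/x)^α) for all x,y > 0. Then there exists ε_* > 0 such that for every ε ∈ (0, ε_*) any two normalised self-similar profiles for K_ε coincide almost everywhere on (0,∞); i.e. for sufficiently small ε there is at most one normalised self-similar profile. -/

import Mathlib

open MeasureTheory Real Set Filter

noncomputable def weight (a b x : ℝ) : ℝ := if x ≤ 1 then x ^ a else x ^ b

noncomputable def Xnorm (a b : ℝ) (g : ℝ → ℝ) : ℝ :=
  ∫ x in Ioi (0:ℝ), |g x| * weight a b x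

def MemX (a b : ℝ) (g : ℝ → ℝ) : Prop :=
  IntegrableOn (fun x => g x * weight a b x) (Ioi 0)

noncomputable def Kern (ε : ℝ) (W : ℝ → ℝ → ℝ) (x y : ℝ) : ℝ := 2 + ε * W x y

def GoodW (α : ℝ) (W : ℝ → ℝ → ℝ) : Prop :=
  ContinuousOn (fun p : ℝ × ℝ => W p.1 p.2) (Ioi 0 ×ˢ Ioi 0) ∧
  (∀ x y : ℝ, 0 < x → 0 < y → W x y = W y x) ∧
  (∀ l x y : ℝ, 0 < l → 0 < x → 0 < y → W (l * x) (l * y) = W x y) ∧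
  (∀ x y : ℝ, 0 < x → 0 < y → 0 ≤ W x y ∧ W x y ≤ (x / y) ^ α + (y / x) ^ α)

def IsProfile (K : ℝ → ℝ → ℝ) (φ : ℝ → ℝ) : Prop :=
  LocallyIntegrableOn φ (Ioi 0) ∧
  (∀ᵐ x ∂(volume.restrict (Ioi (0:ℝ))), 0 ≤ φ x) ∧
  IntegrableOn (fun x => x * φ x) (Ioi 0) ∧
  (∀ᵐ x ∂(volume.restrict (Ioi (0:ℝ))),
    x ^ 2 * φ x = ∫ y in Ioo 0 x, ∫ z in Ioi (x - y), y * K y z * φ y * φ z)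

def IsNormalised (φ : ℝ → ℝ) : Prop := ∫ x in Ioi (0:ℝ), x * φ x = 1

section helpers
open scoped ENNReal NNReal Topology

section part1

structure PosF (φ : ℝ → ℝ) : Prop where
  meas : Measurable φ
  nonneg : ∀ x, 0 ≤ φ x
  zero : ∀ x, x ≤ 0 → φ x = 0

noncomputable def mom (s : ℝ) (φ : ℝ → ℝ) : ℝ≥0∞ := ∫⁻ x, ENNReal.ofReal (x ^ s * φ x)

structure GW (α : ℝ) (W : ℝ → ℝ → ℝ) : Prop where
  meas : Measurable (Function.uncurry W)
  nonneg : ∀ x y, 0 ≤ W x y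
  symm : ∀ x y, W x y = W y x
  ub : ∀ x y, 0 < x → 0 < y → W x y ≤ x ^ α * y ^ (-α) + x ^ (-α) * y ^ α

structure Prof (α ε : ℝ) (W : ℝ → ℝ → ℝ) (φ : ℝ → ℝ) : Prop where
  pos : PosF φ
  mass : mom 1 φ = 1
  eq : ∀ᵐ x, ENNReal.ofReal (x ^ 2 * φ x) = ∫⁻ y, ∫⁻ z,
    ENNReal.ofReal (y * Kern ε W y z * (φ y * φ z)) * (Ioo y (y + z)).indicator 1 x

lemma PosF.add {φ χ : ℝ → ℝ} (h : PosF φ) (k : PosF χ) : PosF (fun x => φ x + χ x) :=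
  ⟨h.meas.add k.meas, fun x => add_nonneg (h.nonneg x) (k.nonneg x),
    fun x hx => by rw [h.zero x hx, k.zero x hx, add_zero]⟩

lemma PosF.abs_sub {φ χ : ℝ → ℝ} (h : PosF φ) (k : PosF χ) : PosF (fun x => |φ x - χ x|) :=
  ⟨(continuous_abs.measurable.comp (h.meas.sub k.meas)), fun x => abs_nonneg _,
    fun x hx => by rw [h.zero x hx, k.zero x hx]; simp⟩

lemma PosF.rpow_mul_nonneg {φ : ℝ → ℝ} (h : PosF φ) (s x : ℝ) : 0 ≤ x ^ s * φ x := by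
  rcases le_or_gt x 0 with hx | hx
  · rw [h.zero x hx, mul_zero]
  · exact mul_nonneg (rpow_nonneg hx.le _) (h.nonneg x)

lemma PosF.meas_mom {φ : ℝ → ℝ} (h : PosF φ) (s : ℝ) :
    Measurable (fun x => ENNReal.ofReal (x ^ s * φ x)) := by
  have := h.meas
  fun_prop

lemma dbl_prod {φ χ : ℝ → ℝ} (hφ : PosF φ) (hχ : PosF χ) (s t : ℝ) :
    ∫⁻ y, ∫⁻ z, ENNReal.ofReal (y ^ s * φ y) * ENNReal.ofReal (z ^ t * χ z) =
      mom s φ * mom t χ := by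
  simp_rw [lintegral_const_mul _ (hχ.meas_mom t)]
  rw [lintegral_mul_const _ (hφ.meas_mom s)]
  rfl

lemma dbl_bound {φ χ : ℝ → ℝ} (hφ : PosF φ) (hχ : PosF χ) (G : ℝ → ℝ → ℝ)
    (c₁ s₁ t₁ c₂ s₂ t₂ : ℝ) (hc₁ : 0 ≤ c₁) (hc₂ : 0 ≤ c₂)
    (h : ∀ y z, 0 < y → 0 < z → G y z ≤ c₁ * (y ^ s₁ * z ^ t₁) + c₂ * (y ^ s₂ * z ^ t₂)) :
    ∫⁻ y, ∫⁻ z, ENNReal.ofReal (G y z * (φ y * χ z)) ≤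
      ENNReal.ofReal c₁ * (mom s₁ φ * mom t₁ χ) + ENNReal.ofReal c₂ * (mom s₂ φ * mom t₂ χ) := by
  have m1 : ∀ s t : ℝ, ∀ y, Measurable (fun z => ENNReal.ofReal (y ^ s * φ y) *
      ENNReal.ofReal (z ^ t * χ z)) := fun s t y => (hχ.meas_mom t).const_mul _
  have m2 : ∀ s t : ℝ, Measurable (fun y => ∫⁻ z, ENNReal.ofReal (y ^ s * φ y) *
      ENNReal.ofReal (z ^ t * χ z)) := fun s t => by
    simp_rw [lintegral_const_mul _ (hχ.meas_mom t)]
    exact (hφ.meas_mom s).mul_const _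
  rw [← dbl_prod hφ hχ, ← dbl_prod hφ hχ, ← lintegral_const_mul _ (m2 _ _),
    ← lintegral_const_mul _ (m2 _ _), ← lintegral_add_left ((m2 _ _).const_mul _)]
  refine lintegral_mono fun y => ?_
  dsimp only
  rw [← lintegral_const_mul _ (m1 _ _ _), ← lintegral_const_mul _ (m1 _ _ _),
    ← lintegral_add_left ((m1 _ _ _).const_mul _)]
  refine lintegral_mono fun z => ?_
  dsimp only
  rcases le_or_gt y 0 with hy | hy
  · simp [hφ.zero y hy]
  rcases le_or_gt z 0 with hz | hz
  · simp [hχ.zero z hz]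
  have a1 := hφ.rpow_mul_nonneg s₁ y
  have a2 := hφ.rpow_mul_nonneg s₂ y
  have b1 := hχ.rpow_mul_nonneg t₁ z
  have b2 := hχ.rpow_mul_nonneg t₂ z
  rw [← ENNReal.ofReal_mul a1, ← ENNReal.ofReal_mul a2, ← ENNReal.ofReal_mul hc₁,
    ← ENNReal.ofReal_mul hc₂, ← ENNReal.ofReal_add (by positivity) (by positivity)]
  apply ENNReal.ofReal_le_ofReal
  calc G y z * (φ y * χ z) ≤ (c₁ * (y ^ s₁ * z ^ t₁) + c₂ * (y ^ s₂ * z ^ t₂)) * (φ y * χ z) :=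
        mul_le_mul_of_nonneg_right (h y z hy hz) (mul_nonneg (hφ.nonneg y) (hχ.nonneg z))
    _ = _ := by ring

lemma mom_interp {φ : ℝ → ℝ} (hφ : PosF φ) {a s b : ℝ} (h1 : a ≤ s) (h2 : s ≤ b) :
    mom s φ ≤ mom a φ + mom b φ := by
  unfold mom
  rw [← lintegral_add_left (hφ.meas_mom a)]
  refine lintegral_mono fun x => ?_
  dsimp only
  rcases le_or_gt x 0 with hx | hx
  · simp [hφ.zero x hx]
  have ha := rpow_nonneg hx.le a
  have hb := rpow_nonneg hx.le b
  have hn := hφ.nonneg x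
  rw [← ENNReal.ofReal_add (by positivity) (by positivity)]
  apply ENNReal.ofReal_le_ofReal
  rw [← add_mul]
  apply mul_le_mul_of_nonneg_right _ hn
  rcases le_total x 1 with h | h
  · have := rpow_le_rpow_of_exponent_ge hx h h1
    linarith
  · have := rpow_le_rpow_of_exponent_le h h2
    linarith

lemma mom_add {φ χ : ℝ → ℝ} (hφ : PosF φ) (hχ : PosF χ) (s : ℝ) :
    mom s (fun x => φ x + χ x) = mom s φ + mom s χ := by
  unfold mom
  rw [← lintegral_add_left (hφ.meas_mom s)]
  refine lintegral_congr fun x => ?_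
  rw [← ENNReal.ofReal_add (hφ.rpow_mul_nonneg s x) (hχ.rpow_mul_nonneg s x)]
  ring_nf

lemma mom_abs_sub_le {φ χ : ℝ → ℝ} (hφ : PosF φ) (hχ : PosF χ) (s : ℝ) :
    mom s (fun x => |φ x - χ x|) ≤ mom s φ + mom s χ := by
  rw [← mom_add hφ hχ]
  refine lintegral_mono fun x => ?_
  apply ENNReal.ofReal_le_ofReal
  rcases le_or_gt x 0 with hx | hx
  · simp [hφ.zero x hx, hχ.zero x hx]
  · apply mul_le_mul_of_nonneg_left _ (rpow_nonneg hx.le _)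
    have := hφ.nonneg x
    have := hχ.nonneg x
    rw [abs_le]; constructor <;> linarith

lemma GW.meas' {α : ℝ} {W : ℝ → ℝ → ℝ} (h : GW α W) {f g : ℝ × ℝ → ℝ} (hf : Measurable f)
    (hg : Measurable g) : Measurable (fun p => W (f p) (g p)) :=
  h.meas.comp (hf.prodMk hg)

lemma kern_meas {α ε : ℝ} {W : ℝ → ℝ → ℝ} (h : GW α W) :
    Measurable (fun p : ℝ × ℝ => Kern ε W p.1 p.2) := by
  unfold Kern
  exact measurable_const.add ((h.meas' measurable_fst measurable_snd).const_mul ε)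

lemma flux_meas {α ε : ℝ} {W : ℝ → ℝ → ℝ} (h : GW α W) {φ χ : ℝ → ℝ} (hφ : Measurable φ)
    (hχ : Measurable χ) :
    Measurable (fun p : ℝ × ℝ => ENNReal.ofReal (p.1 * Kern ε W p.1 p.2 * (φ p.1 * χ p.2))) := by
  have := kern_meas (ε := ε) h
  fun_prop

lemma ioo_ind_meas : Measurable (fun p : ℝ × ℝ × ℝ =>
    (Ioo p.2.1 (p.2.1 + p.2.2)).indicator (1 : ℝ → ℝ≥0∞) p.1) := by
  have : (fun p : ℝ × ℝ × ℝ => (Ioo p.2.1 (p.2.1 + p.2.2)).indicator (1 : ℝ → ℝ≥0∞) p.1) =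
      {p : ℝ × ℝ × ℝ | p.2.1 < p.1 ∧ p.1 < p.2.1 + p.2.2}.indicator 1 := by
    ext p; simp [indicator]
  rw [this]
  have h1 : MeasurableSet {p : ℝ × ℝ × ℝ | p.2.1 < p.1} :=
    measurableSet_lt (by fun_prop) (by fun_prop)
  have h2 : MeasurableSet {p : ℝ × ℝ × ℝ | p.1 < p.2.1 + p.2.2} :=
    measurableSet_lt (by fun_prop) (by fun_prop)
  exact measurable_one.indicator (h1.inter h2)

/-- Tonelli for the flux. -/
lemma tonelli_flux {k : ℝ → ℝ → ℝ≥0∞} (hk : Measurable (fun p : ℝ × ℝ => k p.1 p.2))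
    {q : ℝ → ℝ≥0∞} (hq : Measurable q) :
    ∫⁻ x, q x * ∫⁻ y, ∫⁻ z, k y z * (Ioo y (y + z)).indicator 1 x =
      ∫⁻ y, ∫⁻ z, k y z * ∫⁻ x in Ioo y (y + z), q x := by
  have hm : Measurable (fun p : ℝ × ℝ × ℝ => k p.2.1 p.2.2 *
      (Ioo p.2.1 (p.2.1 + p.2.2)).indicator (1 : ℝ → ℝ≥0∞) p.1) :=
    (hk.comp (f := fun p : ℝ × ℝ × ℝ => (p.2.1, p.2.2)) (by fun_prop)).mul ioo_ind_meas
  have hm' : Measurable (fun p : ℝ × ℝ × ℝ => q p.1 * (k p.2.1 p.2.2 *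
      (Ioo p.2.1 (p.2.1 + p.2.2)).indicator (1 : ℝ → ℝ≥0∞) p.1)) :=
    (hq.comp measurable_fst).mul hm
  have hmx : ∀ x, Measurable (fun p : ℝ × ℝ => k p.1 p.2 *
      (Ioo p.1 (p.1 + p.2)).indicator (1 : ℝ → ℝ≥0∞) x) := fun x =>
    hm.comp (f := fun p : ℝ × ℝ => (x, p.1, p.2)) (by fun_prop)
  calc ∫⁻ x, q x * ∫⁻ y, ∫⁻ z, k y z * (Ioo y (y + z)).indicator 1 x
      = ∫⁻ x, ∫⁻ y, ∫⁻ z, q x * (k y z * (Ioo y (y + z)).indicator 1 x) := by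
        refine lintegral_congr fun x => ?_
        rw [← lintegral_const_mul _ (hmx x).lintegral_prod_right']
        refine lintegral_congr fun y => ?_
        rw [← lintegral_const_mul]
        exact (hmx x).comp (f := fun z : ℝ => (y, z)) (by fun_prop)
    _ = ∫⁻ y, ∫⁻ x, ∫⁻ z, q x * (k y z * (Ioo y (y + z)).indicator 1 x) := by
        rw [lintegral_lintegral_swap]
        exact ((hm'.comp (f := fun p : (ℝ × ℝ) × ℝ => (p.1.1, p.1.2, p.2))
          (by fun_prop)).lintegral_prod_right').aemeasurable
    _ = ∫⁻ y, ∫⁻ z, ∫⁻ x, q x * (k y z * (Ioo y (y + z)).indicator 1 x) := by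
        refine lintegral_congr fun y => ?_
        rw [lintegral_lintegral_swap]
        exact (hm'.comp (f := fun p : ℝ × ℝ => (p.1, y, p.2)) (by fun_prop)).aemeasurable
    _ = _ := by
        refine lintegral_congr fun y => lintegral_congr fun z => ?_
        rw [← lintegral_indicator measurableSet_Ioo, ← lintegral_const_mul _
          (hq.indicator measurableSet_Ioo)]
        refine lintegral_congr fun x => ?_
        by_cases hx : x ∈ Ioo y (y + z)
        · simp [hx, mul_comm]
        · simp [hx]

lemma Prof.weak {α ε : ℝ} {W : ℝ → ℝ → ℝ} {φ : ℝ → ℝ} (hW : GW α W) (h : Prof α ε W φ)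
    {q : ℝ → ℝ≥0∞} (hq : Measurable q) :
    ∫⁻ x, q x * ENNReal.ofReal (x ^ 2 * φ x) =
      ∫⁻ y, ∫⁻ z, ENNReal.ofReal (y * Kern ε W y z * (φ y * φ z)) * ∫⁻ x in Ioo y (y + z), q x := by
  rw [← tonelli_flux (flux_meas hW h.pos.meas h.pos.meas) hq]
  refine lintegral_congr_ae ?_
  filter_upwards [h.eq] with x hx
  rw [hx]

end part1

section part2

noncomputable def TT (φ : ℝ → ℝ) (a : ℝ) : ℝ≥0∞ := ∫⁻ t in Ioi a, ENNReal.ofReal (φ t)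

noncomputable def ell (a y z : ℝ) : ℝ := max (min y a + min z a - a) 0

lemma ell_nonneg (a y z : ℝ) : 0 ≤ ell a y z := le_max_right _ _
lemma ell_symm (a y z : ℝ) : ell a y z = ell a z y := by unfold ell; rw [add_comm (min y a)]
lemma ell_meas {Ω : Type*} [MeasurableSpace Ω] {f g h : Ω → ℝ} (hf : Measurable f)
    (hg : Measurable g) (hh : Measurable h) : Measurable (fun p => ell (f p) (g p) (h p)) := by
  unfold ell
  exact (((hg.min hf).add (hh.min hf)).sub hf).max measurable_const

lemma lint_inv_sq {b c : ℝ} (hb : 0 < b) (hbc : b ≤ c) :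
    ∫⁻ x in Ioo b c, ENNReal.ofReal (x ^ (-2:ℝ)) = ENNReal.ofReal (1 / b - 1 / c) := by
  rw [restrict_Ioo_eq_restrict_Ioc, ← ofReal_integral_eq_lintegral_ofReal,
    ← intervalIntegral.integral_of_le hbc, integral_rpow]
  · congr 1
    have hc : 0 < c := hb.trans_le hbc
    have : (-2:ℝ) + 1 = -1 := by norm_num
    rw [this, rpow_neg_one, rpow_neg_one]
    field_simp
    ring
  · right
    refine ⟨by norm_num, ?_⟩
    rw [uIcc_of_le hbc]
    exact fun h => absurd h.1 (not_le.2 hb)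
  · have := intervalIntegral.intervalIntegrable_rpow (μ := volume) (r := -2) (a := b) (b := c)
      (Or.inr (by rw [uIcc_of_le hbc]; exact fun h => absurd h.1 (not_le.2 hb)))
    exact (intervalIntegrable_iff_integrableOn_Ioc_of_le hbc).1 this
  · refine (ae_restrict_iff' measurableSet_Ioc).2 (Eventually.of_forall fun x hx => ?_)
    exact rpow_nonneg (hb.le.trans hx.1.le) _

lemma lint_q {a y z : ℝ} (ha : 0 < a) (hy : 0 < y) (hz : 0 < z) :
    ∫⁻ x in Ioo y (y + z), (Ioi a).indicator (fun s => ENNReal.ofReal (s ^ (-2:ℝ))) x =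
      ENNReal.ofReal (max (1 / max a y - 1 / (y + z)) 0) := by
  rw [lintegral_indicator measurableSet_Ioi, Measure.restrict_restrict measurableSet_Ioi]
  have hset : Ioi a ∩ Ioo y (y + z) = Ioo (max a y) (y + z) := by
    ext x; simp only [mem_inter_iff, mem_Ioi, mem_Ioo, max_lt_iff]; tauto
  rw [hset]
  rcases le_total (max a y) (y + z) with h | h
  · have := one_div_le_one_div_of_le (lt_max_of_lt_left ha) h
    rw [lint_inv_sq (lt_max_of_lt_left ha) h, max_eq_left (sub_nonneg.2 this)]
  · rw [Ioo_eq_empty (not_lt.2 h), max_eq_right]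
    · simp
    have := one_div_le_one_div_of_le (show 0 < y + z by positivity) h
    linarith

lemma ell_id {a y z : ℝ} (ha : 0 < a) (hy : 0 < y) (hz : 0 < z) :
    y * max (1 / max a y - 1 / (y + z)) 0 + z * max (1 / max a z - 1 / (z + y)) 0 =
      ell a y z / a := by
  have key : ∀ t : ℝ, 0 < t → t * (1 / max a t) = min t a / a := fun t ht => by
    rcases le_total a t with h | h
    · rw [max_eq_right h, min_eq_right h]; field_simp
    · rw [max_eq_left h, min_eq_left h]; field_simp
  have hyz : 0 < y + z := by positivity
  unfold ell
  rcases le_total (y + z) a with h | h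
  · rw [max_eq_right, max_eq_right, max_eq_right]
    · simp
    · rw [min_eq_left (by linarith), min_eq_left (by linarith)]; linarith
    · rw [max_eq_left (by linarith)]
      have := one_div_le_one_div_of_le (by positivity) h
      rw [add_comm z y]; linarith
    · rw [max_eq_left (by linarith)]
      have := one_div_le_one_div_of_le (by positivity) h
      linarith
  · have h1 : 1 / (y + z) ≤ 1 / max a y :=
      one_div_le_one_div_of_le (lt_max_of_lt_left ha) (max_le h (by linarith))
    have h2 : 1 / (z + y) ≤ 1 / max a z :=
      one_div_le_one_div_of_le (lt_max_of_lt_left ha) (max_le (by linarith) (by linarith))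
    rw [max_eq_left (sub_nonneg.2 h1), max_eq_left (sub_nonneg.2 h2),
      max_eq_left (a := min y a + min z a - a), mul_sub, mul_sub,
      key y hy, key z hz]
    · field_simp
      ring
    · rcases min_cases y a with ⟨h3, _⟩ | ⟨h3, _⟩ <;> rcases min_cases z a with ⟨h4, _⟩ | ⟨h4, _⟩ <;>
        rw [h3, h4] <;> linarith

lemma dbl_swap {F : ℝ → ℝ → ℝ≥0∞} (hF : Measurable (fun p : ℝ × ℝ => F p.1 p.2)) :
    ∫⁻ y, ∫⁻ z, F y z = ∫⁻ y, ∫⁻ z, F z y := by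
  rw [lintegral_lintegral_swap hF.aemeasurable]

lemma dbl_add {F G : ℝ → ℝ → ℝ≥0∞} (hF : Measurable (fun p : ℝ × ℝ => F p.1 p.2)) :
    ∫⁻ y, ∫⁻ z, (F y z + G y z) = (∫⁻ y, ∫⁻ z, F y z) + ∫⁻ y, ∫⁻ z, G y z := by
  rw [← lintegral_add_left (f := fun y => ∫⁻ z, F y z)]
  · refine lintegral_congr fun y => ?_
    rw [lintegral_add_left]
    exact hF.comp (f := fun z : ℝ => (y, z)) (by fun_prop)
  · exact hF.lintegral_prod_right'

lemma dbl_const_mul {F : ℝ → ℝ → ℝ≥0∞} (c : ℝ≥0∞) (hF : Measurable (fun p : ℝ × ℝ => F p.1 p.2)) :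
    ∫⁻ y, ∫⁻ z, c * F y z = c * ∫⁻ y, ∫⁻ z, F y z := by
  rw [← lintegral_const_mul (f := fun y => ∫⁻ z, F y z)]
  · refine lintegral_congr fun y => ?_
    rw [lintegral_const_mul]
    exact hF.comp (f := fun z : ℝ => (y, z)) (by fun_prop)
  · exact hF.lintegral_prod_right'

lemma Prof.tail {α ε : ℝ} {W : ℝ → ℝ → ℝ} {φ : ℝ → ℝ} (hW : GW α W) (hε : 0 ≤ ε)
    (h : Prof α ε W φ) {a : ℝ} (ha : 0 < a) :
    2 * (ENNReal.ofReal a * TT φ a) =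
      ∫⁻ y, ∫⁻ z, ENNReal.ofReal (Kern ε W y z * ell a y z * (φ y * φ z)) := by
  have hφ := h.pos.meas
  have hK := kern_meas (ε := ε) hW
  have hKs : ∀ y z, Kern ε W y z = Kern ε W z y := fun y z => by unfold Kern; rw [hW.symm]
  have hKn : ∀ y z, 0 ≤ Kern ε W y z := fun y z => by
    unfold Kern; have := mul_nonneg hε (hW.nonneg y z); linarith
  have h1 := h.weak hW (q := (Ioi a).indicator (fun s => ENNReal.ofReal (s ^ (-2:ℝ))))
    (Measurable.indicator (by fun_prop) measurableSet_Ioi)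
  have h2 : TT φ a = ∫⁻ x, (Ioi a).indicator (fun s => ENNReal.ofReal (s ^ (-2:ℝ))) x *
      ENNReal.ofReal (x ^ 2 * φ x) := by
    unfold TT
    rw [← lintegral_indicator measurableSet_Ioi]
    refine lintegral_congr fun x => ?_
    by_cases hx : x ∈ Ioi a
    · have hx0 : 0 < x := ha.trans hx
      rw [indicator_of_mem hx, indicator_of_mem hx, ← ENNReal.ofReal_mul (by positivity)]
      congr 1
      rw [rpow_neg hx0.le]
      norm_cast
      field_simp
    · simp [indicator_of_notMem hx]
  set F : ℝ → ℝ → ℝ≥0∞ := fun y z => ENNReal.ofReal (y * Kern ε W y z * (φ y * φ z) *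
    max (1 / max a y - 1 / (y + z)) 0) with hFdef
  have hF : Measurable (fun p : ℝ × ℝ => F p.1 p.2) := by
    simp only [hFdef]; fun_prop
  have hF' : Measurable (fun p : ℝ × ℝ => F p.2 p.1) :=
    hF.comp (f := fun p : ℝ × ℝ => (p.2, p.1)) (by fun_prop)
  have h3 : TT φ a = ∫⁻ y, ∫⁻ z, F y z := by
    rw [h2, h1]
    refine lintegral_congr fun y => lintegral_congr fun z => ?_
    rcases le_or_gt y 0 with hy | hy
    · simp [hFdef, h.pos.zero y hy]
    rcases le_or_gt z 0 with hz | hz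
    · simp [hFdef, h.pos.zero z hz]
    rw [lint_q ha hy hz, ← ENNReal.ofReal_mul]
    have := hKn y z
    have := h.pos.nonneg y
    have := h.pos.nonneg z
    positivity
  have h4 : 2 * TT φ a = ∫⁻ y, ∫⁻ z, (F y z + F z y) := by
    rw [dbl_add hF, ← dbl_swap hF, ← h3, two_mul]
  rw [mul_left_comm, h4, ← dbl_const_mul _ (hF.add hF')]
  refine lintegral_congr fun y => lintegral_congr fun z => ?_
  rcases le_or_gt y 0 with hy | hy
  · simp [hFdef, h.pos.zero y hy]
  rcases le_or_gt z 0 with hz | hz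
  · simp [hFdef, h.pos.zero z hz]
  have i1 := hKn y z
  have i2 := h.pos.nonneg y
  have i3 := h.pos.nonneg z
  simp only [hFdef]
  rw [hKs z y, ← ENNReal.ofReal_add (by positivity) (by positivity), ← ENNReal.ofReal_mul ha.le]
  congr 1
  have := ell_id ha hy hz
  have e : ell a y z = a * (y * max (1 / max a y - 1 / (y + z)) 0 +
      z * max (1 / max a z - 1 / (z + y)) 0) := by rw [this]; field_simp
  rw [e]; ring

lemma TT_meas {φ : ℝ → ℝ} : Measurable (TT φ) :=
  Antitone.measurable fun _ _ hab => lintegral_mono_set (Ioi_subset_Ioi hab)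

/-- convolution of tails -/
lemma conv_TT {φ χ : ℝ → ℝ} (hφ : PosF φ) (hχ : PosF χ) (a : ℝ) :
    ∫⁻ s in Ioo 0 a, TT φ s * TT χ (a - s) =
      ∫⁻ y, ∫⁻ z, ENNReal.ofReal (ell a y z * (φ y * χ z)) := by
  have hm1 := hφ.meas
  have hm2 := hχ.meas
  set k : ℝ → ℝ → ℝ → ℝ≥0∞ := fun s y z => (Ioi s).indicator (fun y => ENNReal.ofReal (φ y)) y *
    (Ioi (a - s)).indicator (fun z => ENNReal.ofReal (χ z)) z with hk
  have hkm : Measurable (fun p : ℝ × ℝ × ℝ => k p.1 p.2.1 p.2.2) := by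
    have e : (fun p : ℝ × ℝ × ℝ => k p.1 p.2.1 p.2.2) = fun p : ℝ × ℝ × ℝ =>
      ({p : ℝ × ℝ × ℝ | p.1 < p.2.1}.indicator (fun p => ENNReal.ofReal (φ p.2.1)) p) *
      ({p : ℝ × ℝ × ℝ | a - p.1 < p.2.2}.indicator (fun p => ENNReal.ofReal (χ p.2.2)) p) := by
      ext p; simp [hk, indicator]
    rw [e]
    have h1 : MeasurableSet {p : ℝ × ℝ × ℝ | p.1 < p.2.1} :=
      measurableSet_lt (by fun_prop) (by fun_prop)
    have h2 : MeasurableSet {p : ℝ × ℝ × ℝ | a - p.1 < p.2.2} :=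
      measurableSet_lt (by fun_prop) (by fun_prop)
    exact (Measurable.indicator (by fun_prop) h1).mul (Measurable.indicator (by fun_prop) h2)
  calc ∫⁻ s in Ioo 0 a, TT φ s * TT χ (a - s)
      = ∫⁻ s in Ioo 0 a, ∫⁻ y, ∫⁻ z, k s y z := by
        refine lintegral_congr fun s => ?_
        simp only [hk, TT]
        rw [← lintegral_indicator measurableSet_Ioi, ← lintegral_indicator measurableSet_Ioi,
          ← lintegral_mul_const _ (Measurable.indicator (by fun_prop) measurableSet_Ioi)]
        refine lintegral_congr fun y => ?_
        rw [← lintegral_const_mul _ (Measurable.indicator (by fun_prop) measurableSet_Ioi)]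
    _ = ∫⁻ y, ∫⁻ s in Ioo 0 a, ∫⁻ z, k s y z := by
        rw [lintegral_lintegral_swap]
        exact ((hkm.comp (f := fun p : (ℝ × ℝ) × ℝ => (p.1.1, p.1.2, p.2))
          (by fun_prop)).lintegral_prod_right').aemeasurable
    _ = ∫⁻ y, ∫⁻ z, ∫⁻ s in Ioo 0 a, k s y z := by
        refine lintegral_congr fun y => ?_
        rw [lintegral_lintegral_swap]
        exact (hkm.comp (f := fun p : ℝ × ℝ => (p.1, y, p.2)) (by fun_prop)).aemeasurable
    _ = _ := by
        refine lintegral_congr fun y => lintegral_congr fun z => ?_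
        have e : ∀ s, (Ioo 0 a).indicator (fun s => k s y z) s =
            (Ioo (max 0 (a - z)) (min y a)).indicator
              (fun _ => ENNReal.ofReal (φ y * χ z)) s := fun s => by
          simp only [hk, indicator, mem_Ioo, mem_Ioi, max_lt_iff, lt_min_iff]
          rw [ENNReal.ofReal_mul (hφ.nonneg y)]
          by_cases c1 : 0 < s <;> by_cases c2 : s < a <;> by_cases c3 : s < y <;>
            by_cases c4 : a - s < z <;> simp [c1, c2, c3, c4] <;> intros <;> exfalso <;> linarith
        rw [← lintegral_indicator measurableSet_Ioo, lintegral_congr e,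
          lintegral_indicator measurableSet_Ioo, lintegral_const, Measure.restrict_apply_univ,
          Real.volume_Ioo, mul_comm, ENNReal.ofReal_mul (ell_nonneg _ _ _)]
        congr 1
        unfold ell
        have : a - min z a = max 0 (a - z) := by
          rcases le_total z a with h | h
          · rw [min_eq_left h, max_eq_right (by linarith)]
          · rw [min_eq_right h, max_eq_left (by linarith)]; ring
        rw [← this, ENNReal.ofReal_max, ENNReal.ofReal_zero, max_eq_left zero_le]
        congr 1; ring

end part2

section part3

lemma TT_le_mom {φ : ℝ → ℝ} (hφ : PosF φ) {s : ℝ} (hs : 0 ≤ s) {a : ℝ} (ha : 0 < a) :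
    TT φ a ≤ ENNReal.ofReal (a ^ (-s)) * mom s φ := by
  unfold TT mom
  rw [← lintegral_const_mul _ (hφ.meas_mom s), ← lintegral_indicator measurableSet_Ioi]
  refine lintegral_mono fun x => ?_
  dsimp only
  by_cases hx : x ∈ Ioi a
  · have hx0 : 0 < x := ha.trans hx
    rw [indicator_of_mem hx, ← ENNReal.ofReal_mul (by positivity)]
    apply ENNReal.ofReal_le_ofReal
    have h1 : a ^ s ≤ x ^ s := rpow_le_rpow ha.le (le_of_lt hx) hs
    have h2 : 1 ≤ a ^ (-s) * x ^ s := by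
      rw [rpow_neg ha.le, inv_mul_eq_div, one_le_div (by positivity)]; exact h1
    have := hφ.nonneg x
    nlinarith
  · simp [indicator_of_notMem hx]

lemma Prof.TT_lt_top {α ε : ℝ} {W : ℝ → ℝ → ℝ} {φ : ℝ → ℝ} (h : Prof α ε W φ)
    {a : ℝ} (ha : 0 < a) : TT φ a < ∞ := by
  refine (TT_le_mom h.pos zero_le_one ha).trans_lt ?_
  rw [h.mass]; simp

noncomputable def UU (W : ℝ → ℝ → ℝ) (φ : ℝ → ℝ) (a : ℝ) : ℝ≥0∞ :=
  ∫⁻ y, ∫⁻ z, ENNReal.ofReal (W y z * ell a y z * (φ y * φ z))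

lemma Prof.tail_split {α ε : ℝ} {W : ℝ → ℝ → ℝ} {φ : ℝ → ℝ} (hW : GW α W) (hε : 0 ≤ ε)
    (h : Prof α ε W φ) {a : ℝ} (ha : 0 < a) :
    ENNReal.ofReal a * TT φ a =
      (∫⁻ s in Ioo 0 a, TT φ s * TT φ (a - s)) + ENNReal.ofReal (ε / 2) * UU W φ a := by
  have hφ := h.pos.meas
  have hWm := hW.meas' measurable_fst measurable_snd
  have hl : Measurable (fun p : ℝ × ℝ => ell a p.1 p.2) :=
    ell_meas measurable_const measurable_fst measurable_snd
  have h1 := h.tail hW hε ha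
  have h2 : (2:ℝ≥0∞) * ((∫⁻ s in Ioo 0 a, TT φ s * TT φ (a - s)) +
      ENNReal.ofReal (ε / 2) * UU W φ a) =
      ∫⁻ y, ∫⁻ z, ENNReal.ofReal (Kern ε W y z * ell a y z * (φ y * φ z)) := by
    have m1 : Measurable (fun p : ℝ × ℝ => ENNReal.ofReal (ell a p.1 p.2 * (φ p.1 * φ p.2))) := by
      fun_prop
    have m2 : Measurable (fun p : ℝ × ℝ => ENNReal.ofReal (W p.1 p.2 * ell a p.1 p.2 *
      (φ p.1 * φ p.2))) := by
      fun_prop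
    rw [conv_TT h.pos h.pos, UU, ← dbl_const_mul _ m2, ← dbl_add m1,
      ← dbl_const_mul _ (m1.add (m2.const_mul _))]
    refine lintegral_congr fun y => lintegral_congr fun z => ?_
    have i1 := hW.nonneg y z
    have i2 := h.pos.nonneg y
    have i3 := h.pos.nonneg z
    have i4 := ell_nonneg a y z
    rw [← ENNReal.ofReal_mul (by positivity), ← ENNReal.ofReal_add (by positivity) (by positivity)]
    have : (2:ℝ≥0∞) = ENNReal.ofReal 2 := by simp
    rw [this, ← ENNReal.ofReal_mul (by positivity)]
    congr 1; unfold Kern; ring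
  rw [← h2] at h1
  exact (ENNReal.mul_right_inj (by norm_num) (by norm_num)).1 h1

lemma TT_anti {φ : ℝ → ℝ} : Antitone (TT φ) :=
  fun _ _ hab => lintegral_mono_set (Ioi_subset_Ioi hab)

lemma Prof.TT_le_one {α ε : ℝ} {W : ℝ → ℝ → ℝ} {φ : ℝ → ℝ} (hW : GW α W) (hε : 0 ≤ ε)
    (h : Prof α ε W φ) {a : ℝ} (ha : 0 < a) : TT φ a ≤ 1 := by
  have h1 := h.tail_split hW hε ha
  have h2 : ENNReal.ofReal a * (TT φ a * TT φ a) ≤ ENNReal.ofReal a * TT φ a := by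
    rw [h1]
    refine le_trans ?_ le_self_add
    calc ENNReal.ofReal a * (TT φ a * TT φ a) = ∫⁻ s in Ioo 0 a, TT φ a * TT φ a := by
          rw [lintegral_const, Measure.restrict_apply_univ, Real.volume_Ioo, sub_zero, mul_comm]
      _ ≤ _ := by
          refine setLIntegral_mono' measurableSet_Ioo fun s hs => ?_
          exact mul_le_mul' (TT_anti hs.2.le) (TT_anti (by linarith [hs.1]))
  have h3 : TT φ a * TT φ a ≤ TT φ a :=
    (ENNReal.mul_le_mul_iff_right (by simpa using ha) (by simp)).1 h2
  by_contra hc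
  push Not at hc
  have hfin := h.TT_lt_top ha
  have : TT φ a * 1 < TT φ a * TT φ a :=
    (ENNReal.mul_lt_mul_iff_right (by positivity) hfin.ne).2 hc
  rw [mul_one] at this
  exact absurd h3 (not_le.2 this)

lemma mom_zero {φ : ℝ → ℝ} : mom 0 φ = ∫⁻ x, ENNReal.ofReal (φ x) := by
  unfold mom; simp

lemma mom_zero' {φ : ℝ → ℝ} (hφ : PosF φ) : mom 0 φ = TT φ 0 := by
  rw [mom_zero, TT, ← lintegral_indicator measurableSet_Ioi]
  refine lintegral_congr fun x => ?_
  by_cases hx : x ∈ Ioi (0:ℝ)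
  · simp [hx]
  · rw [indicator_of_notMem hx, hφ.zero x (not_lt.1 hx)]; simp

lemma TT_zero_le {φ : ℝ → ℝ} {c : ℝ≥0∞} (h : ∀ a, 0 < a → TT φ a ≤ c) : TT φ 0 ≤ c := by
  have e : Ioi (0:ℝ) = ⋃ n : ℕ, Ioi (1 / ((n:ℝ) + 1)) := by
    ext x; simp only [mem_Ioi, mem_iUnion]
    constructor
    · intro hx; exact exists_nat_one_div_lt hx
    · rintro ⟨n, hn⟩; exact lt_trans (by positivity) hn
  unfold TT
  rw [e, setLIntegral_iUnion_of_directed]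
  · exact iSup_le fun n => h _ (by positivity)
  · refine (Monotone.directed_le ?_)
    intro m n hmn
    exact Ioi_subset_Ioi (one_div_le_one_div_of_le (by positivity) (by
      have : (m:ℝ) ≤ n := by exact_mod_cast hmn
      linarith))

lemma Prof.mom0 {α ε : ℝ} {W : ℝ → ℝ → ℝ} {φ : ℝ → ℝ} (hW : GW α W) (hε : 0 ≤ ε)
    (h : Prof α ε W φ) : mom 0 φ ≤ 1 := by
  rw [mom_zero' h.pos]
  exact TT_zero_le fun a ha => h.TT_le_one hW hε ha

lemma lint_pow_le1 {k y z : ℝ} (hk2 : k ≤ 2) (hy : 0 < y) :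
    ∫⁻ x in Ioo y (y + z), ENNReal.ofReal (x ^ (k - 2)) ≤ ENNReal.ofReal (z * y ^ (k - 2)) := by
  calc ∫⁻ x in Ioo y (y + z), ENNReal.ofReal (x ^ (k - 2))
      ≤ ∫⁻ x in Ioo y (y + z), ENNReal.ofReal (y ^ (k - 2)) := by
        refine setLIntegral_mono' measurableSet_Ioo fun x hx => ENNReal.ofReal_le_ofReal ?_
        exact rpow_le_rpow_of_nonpos hy hx.1.le (by linarith)
    _ = _ := by
        rw [lintegral_const, Measure.restrict_apply_univ, Real.volume_Ioo, ← ENNReal.ofReal_mul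
          (by positivity)]
        congr 1; ring

lemma lint_pow_le2 {k y z : ℝ} (hk1 : 1 < k) (hk2 : k ≤ 2) (hy : 0 < y) (hz : 0 < z) :
    ∫⁻ x in Ioo y (y + z), ENNReal.ofReal (x ^ (k - 2)) ≤
      ENNReal.ofReal (z ^ (k - 1) / (k - 1)) := by
  have hbc : y ≤ y + z := by linarith
  rw [restrict_Ioo_eq_restrict_Ioc, ← ofReal_integral_eq_lintegral_ofReal,
    ← intervalIntegral.integral_of_le hbc, integral_rpow]
  · apply ENNReal.ofReal_le_ofReal
    have e : k - 2 + 1 = k - 1 := by ring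
    rw [e]
    have := rpow_add_le_add_rpow hy.le hz.le (show 0 ≤ k - 1 by linarith) (by linarith)
    apply div_le_div_of_nonneg_right _ (by linarith)
    linarith
  · left; linarith
  · exact (intervalIntegrable_iff_integrableOn_Ioc_of_le hbc).1
      (intervalIntegral.intervalIntegrable_rpow' (by linarith))
  · refine (ae_restrict_iff' measurableSet_Ioc).2 (Eventually.of_forall fun x hx => ?_)
    exact rpow_nonneg (hy.le.trans hx.1.le) _

lemma kern_le {α ε : ℝ} {W : ℝ → ℝ → ℝ} (hW : GW α W) (hε : 0 ≤ ε) (hε1 : ε ≤ 1) {y z : ℝ}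
    (hy : 0 < y) (hz : 0 < z) :
    Kern ε W y z ≤ 2 * (y ^ α * z ^ (-α) + y ^ (-α) * z ^ α) := by
  have h1 := hW.ub y z hy hz
  have h0 := hW.nonneg y z
  unfold Kern
  have e : (y ^ α * z ^ (-α)) * (y ^ (-α) * z ^ α) = 1 := by
    rw [rpow_neg hy.le, rpow_neg hz.le]
    have := rpow_pos_of_pos hy α
    have := rpow_pos_of_pos hz α
    field_simp
  have p1 : 0 < y ^ α * z ^ (-α) := by positivity
  have p2 : 0 < y ^ (-α) * z ^ α := by positivity
  have : ε * W y z ≤ W y z := by nlinarith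
  nlinarith [sq_nonneg (y ^ α * z ^ (-α) - y ^ (-α) * z ^ α)]

lemma Prof.mom_step {α ε : ℝ} {W : ℝ → ℝ → ℝ} {φ : ℝ → ℝ} (hα : α ∈ Ioo (0:ℝ) 1) (hW : GW α W)
    (hε : 0 ≤ ε) (hε1 : ε ≤ 1) (h : Prof α ε W φ) {k : ℝ} (hk1 : 1 < k) (hk2 : k ≤ 2) :
    mom k φ ≤ ENNReal.ofReal (4 + 4 / (k - 1)) * mom (k - 1 + α) φ := by
  have hk0 : 0 < k - 1 := by linarith
  have h1 := h.weak hW (q := fun x => ENNReal.ofReal (x ^ (k - 2))) (by fun_prop)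
  have h2 : ∫⁻ x, ENNReal.ofReal (x ^ (k - 2)) * ENNReal.ofReal (x ^ 2 * φ x) = mom k φ := by
    refine lintegral_congr fun x => ?_
    rcases le_or_gt x 0 with hx | hx
    · simp [h.pos.zero x hx]
    rw [← ENNReal.ofReal_mul (by positivity), ← mul_assoc]
    congr 2
    rw [← rpow_natCast, ← rpow_add hx]
    norm_num
  have hm : mom (1 - α) φ ≤ 2 := by
    refine (mom_interp h.pos (a := 0) (b := 1) (by linarith [hα.2]) (by linarith [hα.1])).trans ?_
    rw [h.mass]
    exact (add_le_add_left (h.mom0 hW hε) _).trans (by norm_num)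
  rw [h2] at h1
  rw [h1]
  set G : ℝ → ℝ → ℝ := fun y z => if 0 < y ∧ 0 < z then
    2 * (y ^ (k - 1 + α) * z ^ (1 - α)) + 2 / (k - 1) * (y ^ (1 - α) * z ^ (k - 1 + α)) else 0 with hG
  have h3 : ∀ y z, ENNReal.ofReal (y * Kern ε W y z * (φ y * φ z)) *
      ∫⁻ x in Ioo y (y + z), ENNReal.ofReal (x ^ (k - 2)) ≤ ENNReal.ofReal (G y z * (φ y * φ z)) := by
    intro y z
    rcases le_or_gt y 0 with hy | hy
    · simp [h.pos.zero y hy]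
    rcases le_or_gt z 0 with hz | hz
    · simp [h.pos.zero z hz]
    have i2 := h.pos.nonneg y
    have i3 := h.pos.nonneg z
    have hK := kern_le hW hε hε1 hy hz
    have hKn : 0 ≤ Kern ε W y z := by
      unfold Kern; have := mul_nonneg hε (hW.nonneg y z); linarith
    have b1 := lint_pow_le1 (z := z) hk2 hy
    have b2 := lint_pow_le2 hk1 hk2 hy hz
    have b3 : ∫⁻ x in Ioo y (y + z), ENNReal.ofReal (x ^ (k - 2)) ≤
        ENNReal.ofReal (min (z * y ^ (k - 2)) (z ^ (k - 1) / (k - 1))) := by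
      rw [ENNReal.ofReal_min]; exact le_min b1 b2
    refine (mul_le_mul_right b3 _).trans ?_
    rw [← ENNReal.ofReal_mul (by positivity)]
    apply ENNReal.ofReal_le_ofReal
    set M := min (z * y ^ (k - 2)) (z ^ (k - 1) / (k - 1)) with hM
    have hM0 : 0 ≤ M := le_min (by positivity) (by positivity)
    have hM1 : M ≤ z * y ^ (k - 2) := min_le_left _ _
    have hM2 : M ≤ z ^ (k - 1) / (k - 1) := min_le_right _ _
    have hG' : y * Kern ε W y z * M ≤ G y z := by
      simp only [hG, hy, hz, and_self, if_true]
      calc y * Kern ε W y z * M ≤ y * (2 * (y ^ α * z ^ (-α) + y ^ (-α) * z ^ α)) * M := by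
            gcongr
        _ = 2 * (y * y ^ α * z ^ (-α)) * M + 2 * (y * y ^ (-α) * z ^ α) * M := by ring
        _ ≤ 2 * (y * y ^ α * z ^ (-α)) * (z * y ^ (k - 2)) +
            2 * (y * y ^ (-α) * z ^ α) * (z ^ (k - 1) / (k - 1)) := by gcongr
        _ = 2 * ((y * y ^ α * y ^ (k - 2)) * (z * z ^ (-α))) + 2 / (k - 1) *
            ((y * y ^ (-α)) * (z ^ (k - 1) * z ^ α)) := by field_simp
        _ = _ := by
            have e1 : y * y ^ α * y ^ (k - 2) = y ^ (k - 1 + α) := by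
              nth_rewrite 1 [← rpow_one y]
              rw [← rpow_add hy, ← rpow_add hy]; congr 1; ring
            have e2 : z * z ^ (-α) = z ^ (1 - α) := by
              nth_rewrite 1 [← rpow_one z]
              rw [← rpow_add hz]; congr 1
            have e3 : y * y ^ (-α) = y ^ (1 - α) := by
              nth_rewrite 1 [← rpow_one y]
              rw [← rpow_add hy]; congr 1
            rw [e1, e2, e3, ← rpow_add hz]
    calc _ = (y * Kern ε W y z * M) * (φ y * φ z) := by ring
      _ ≤ _ := by gcongr
  refine (lintegral_mono fun y => lintegral_mono fun z => h3 y z).trans ?_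
  refine (dbl_bound h.pos h.pos G 2 (k - 1 + α) (1 - α) (2 / (k - 1)) (1 - α) (k - 1 + α)
    (by norm_num) (by positivity) ?_).trans ?_
  · intro y z hy hz
    simp [hG, hy, hz]
  · have : ENNReal.ofReal 2 * (mom (k - 1 + α) φ * mom (1 - α) φ) +
        ENNReal.ofReal (2 / (k - 1)) * (mom (1 - α) φ * mom (k - 1 + α) φ) =
        ENNReal.ofReal (2 + 2 / (k - 1)) * mom (1 - α) φ * mom (k - 1 + α) φ := by
      rw [ENNReal.ofReal_add (by norm_num) (by positivity)]; ring
    rw [this]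
    refine mul_le_mul_left ?_ _
    refine (mul_le_mul_right hm _).trans ?_
    have e2 : (2:ℝ≥0∞) = ENNReal.ofReal 2 := by simp
    rw [e2, ← ENNReal.ofReal_mul (by positivity)]
    apply ENNReal.ofReal_le_ofReal
    apply le_of_eq; ring

lemma mom_bound_aux {α : ℝ} (hα : α ∈ Ioo (0:ℝ) 1) (n : ℕ) : ∀ k : ℝ, 1 ≤ k → k ≤ 2 →
    k ≤ 1 + n * (1 - α) → ∃ C : ℝ≥0, ∀ (W : ℝ → ℝ → ℝ) (φ : ℝ → ℝ) (ε : ℝ), GW α W → 0 ≤ ε →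
      ε ≤ 1 → Prof α ε W φ → mom k φ ≤ C := by
  induction n with
  | zero =>
    intro k h1 h2 h3
    have : k = 1 := by simp at h3; linarith
    subst this
    exact ⟨1, fun W φ ε hW h0 h1 h => by rw [h.mass]; simp⟩
  | succ n ih =>
    intro k h1 h2 h3
    rcases h1.eq_or_lt with h1 | h1
    · subst h1
      exact ⟨1, fun W φ ε hW h0 h1 h => by rw [h.mass]; simp⟩
    obtain ⟨C', hC'⟩ : ∃ C : ℝ≥0, ∀ (W : ℝ → ℝ → ℝ) (φ : ℝ → ℝ) (ε : ℝ), GW α W → 0 ≤ ε →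
        ε ≤ 1 → Prof α ε W φ → mom (k - 1 + α) φ ≤ C := by
      rcases le_total 1 (k - 1 + α) with h | h
      · refine ih _ h (by linarith [hα.2]) ?_
        push_cast at h3; linarith
      · refine ⟨2, fun W φ ε hW h0 h1 hp => ?_⟩
        refine (mom_interp hp.pos (a := 0) (b := 1) (by linarith [hα.1]) h).trans ?_
        rw [hp.mass]
        exact (add_le_add_left (hp.mom0 hW h0) _).trans (by norm_num)
    refine ⟨(4 + 4 / (k - 1)).toNNReal * C', fun W φ ε hW he0 he1 hp => ?_⟩
    refine (hp.mom_step hα hW he0 he1 h1 h2).trans ?_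
    rw [ENNReal.coe_mul]
    exact mul_le_mul_right (hC' W φ ε hW he0 he1 hp) _

lemma mom_bound {α : ℝ} (hα : α ∈ Ioo (0:ℝ) 1) :
    ∃ C : ℝ≥0, 1 ≤ C ∧ ∀ (W : ℝ → ℝ → ℝ) (φ : ℝ → ℝ) (ε : ℝ), GW α W → 0 ≤ ε →
      ε ≤ 1 → Prof α ε W φ → ∀ s, 0 ≤ s → s ≤ 2 → mom s φ ≤ C := by
  obtain ⟨n, hn⟩ := exists_nat_gt (1 / (1 - α))
  have h1 : 0 < 1 - α := by linarith [hα.2]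
  rw [div_lt_iff₀ h1] at hn
  obtain ⟨C, hC⟩ := mom_bound_aux hα n 2 (by norm_num) le_rfl (by linarith)
  refine ⟨1 + C, by simp, fun W φ ε hW h0 h1 h s hs0 hs2 => ?_⟩
  refine (mom_interp h.pos hs0 hs2).trans ?_
  rw [ENNReal.coe_add]
  exact add_le_add (h.mom0 hW h0) (hC W φ ε hW h0 h1 h)

end part3

section part4

structure Tl (N : ℝ → ℝ) : Prop where
  anti : Antitone N
  nonneg : ∀ x, 0 ≤ N x
  le_one : ∀ x, N x ≤ 1
  int : IntegrableOn N (Ioi 0)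
  one : ∫ x in Ioi (0:ℝ), N x = 1

lemma Tl.int_mul {N : ℝ → ℝ} (h : Tl N) {f : ℝ → ℝ} (hf : Measurable f) {C : ℝ}
    (hC : ∀ x, 0 < x → |f x| ≤ C) : IntegrableOn (fun x => f x * N x) (Ioi 0) := by
  refine Integrable.bdd_mul (c := C) h.int hf.aestronglyMeasurable ?_
  exact (ae_restrict_iff' measurableSet_Ioi).2 (Eventually.of_forall fun x hx => hC x hx)

lemma tl_exp : Tl (fun x => min 1 (exp (-x))) := by
  have e : ∀ x ∈ Ioi (0:ℝ), min 1 (exp (-x)) = exp (-x) := fun x hx =>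
    min_eq_right (exp_le_one_iff.2 (by linarith [mem_Ioi.1 hx]))
  refine ⟨fun x y hxy => min_le_min le_rfl (exp_le_exp.2 (by linarith)), fun x => by positivity,
    fun x => min_le_left _ _, ?_, ?_⟩
  · exact (integrableOn_congr_fun e measurableSet_Ioi).2 (exp_neg_integrableOn_Ioi 0 one_pos |>.congr_fun
      (fun x _ => by simp) measurableSet_Ioi)
  · rw [setIntegral_congr_fun measurableSet_Ioi e]; exact integral_exp_neg_Ioi_zero

lemma lap_exp (m : ℕ) : ∫ x in Ioi (0:ℝ), exp (-(m * x)) * min 1 (exp (-x)) = 1 / (1 + m) := by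
  have e : ∀ x ∈ Ioi (0:ℝ), exp (-(m * x)) * min 1 (exp (-x)) = exp (-(1 + m) * x) := fun x hx => by
    rw [min_eq_right (exp_le_one_iff.2 (by linarith [mem_Ioi.1 hx])), ← exp_add]; ring_nf
  rw [setIntegral_congr_fun measurableSet_Ioi e, integral_exp_mul_Ioi (by have : (0:ℝ) ≤ m := by positivity
                                                                          linarith)]
  have : (1 + (m:ℝ)) ≠ 0 := by positivity
  rw [mul_zero, exp_zero, neg_div_neg_eq]

lemma exp_mem_Icc {x : ℝ} (hx : x ∈ Ioi (0:ℝ)) : exp (-x) ∈ Icc (0:ℝ) 1 :=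
  ⟨(exp_pos _).le, exp_le_one_iff.2 (by linarith [mem_Ioi.1 hx])⟩

section
variable {N : ℕ → ℝ → ℝ} {M : ℝ → ℝ}

lemma seq_poly (hN : ∀ k, Tl (N k)) (hM : Tl M)
    (hL : ∀ m : ℕ, Tendsto (fun k => ∫ x in Ioi (0:ℝ), exp (-(m * x)) * N k x) atTop
      (𝓝 (∫ x in Ioi (0:ℝ), exp (-(m * x)) * M x))) (p : Polynomial ℝ) :
    Tendsto (fun k => ∫ x in Ioi (0:ℝ), p.eval (exp (-x)) * N k x) atTop
      (𝓝 (∫ x in Ioi (0:ℝ), p.eval (exp (-x)) * M x)) := by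
  have key : ∀ L : ℝ → ℝ, Tl L → ∫ x in Ioi (0:ℝ), p.eval (exp (-x)) * L x =
      ∑ i ∈ Finset.range (p.natDegree + 1), p.coeff i * ∫ x in Ioi (0:ℝ), exp (-(i * x)) * L x := by
    intro L hL
    simp_rw [Polynomial.eval_eq_sum_range, Finset.sum_mul]
    rw [integral_finsetSum]
    · refine Finset.sum_congr rfl fun i _ => ?_
      rw [← integral_const_mul]
      congr 1; ext x
      rw [← exp_nat_mul]; ring_nf
    · intro i _
      simp_rw [mul_assoc]
      refine Integrable.const_mul ?_ _
      refine hL.int_mul (by fun_prop) (C := 1) fun x hx => ?_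
      rw [abs_of_nonneg (by positivity)]
      exact pow_le_one₀ (exp_pos _).le (exp_mem_Icc hx).2
  simp_rw [key M hM, fun k => key (N k) (hN k)]
  exact tendsto_finsetSum _ fun i _ => (hL i).const_mul _

lemma seq_cont (hN : ∀ k, Tl (N k)) (hM : Tl M)
    (hL : ∀ m : ℕ, Tendsto (fun k => ∫ x in Ioi (0:ℝ), exp (-(m * x)) * N k x) atTop
      (𝓝 (∫ x in Ioi (0:ℝ), exp (-(m * x)) * M x))) {h : ℝ → ℝ} (hc : Continuous h) :
    Tendsto (fun k => ∫ x in Ioi (0:ℝ), h (exp (-x)) * N k x) atTop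
      (𝓝 (∫ x in Ioi (0:ℝ), h (exp (-x)) * M x)) := by
  obtain ⟨B, hB⟩ := isCompact_Icc.exists_bound_of_continuousOn (s := Icc (0:ℝ) 1) hc.continuousOn
  rw [Metric.tendsto_atTop]
  intro δ hδ
  obtain ⟨p, hp⟩ := exists_polynomial_near_of_continuousOn 0 1 h hc.continuousOn (δ / 3) (by positivity)
  obtain ⟨B', hB'⟩ := isCompact_Icc.exists_bound_of_continuousOn (s := Icc (0:ℝ) 1)
    p.continuous.continuousOn
  have near : ∀ L : ℝ → ℝ, Tl L → |(∫ x in Ioi (0:ℝ), p.eval (exp (-x)) * L x) -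
      ∫ x in Ioi (0:ℝ), h (exp (-x)) * L x| ≤ δ / 3 := by
    intro L hL
    have i1 : IntegrableOn (fun x => p.eval (exp (-x)) * L x) (Ioi 0) :=
      hL.int_mul (by have := p.continuous.measurable; fun_prop) (C := B')
        fun x hx => hB' _ (exp_mem_Icc hx)
    have i2 : IntegrableOn (fun x => h (exp (-x)) * L x) (Ioi 0) :=
      hL.int_mul (by have := hc.measurable; fun_prop) (C := B) fun x hx => hB _ (exp_mem_Icc hx)
    rw [← integral_sub i1 i2]
    calc |∫ x in Ioi (0:ℝ), (p.eval (exp (-x)) * L x - h (exp (-x)) * L x)|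
        ≤ ∫ x in Ioi (0:ℝ), |p.eval (exp (-x)) * L x - h (exp (-x)) * L x| :=
          abs_integral_le_integral_abs
      _ ≤ ∫ x in Ioi (0:ℝ), δ / 3 * L x := by
          refine setIntegral_mono_on (i1.sub i2).abs (hL.int.const_mul _) measurableSet_Ioi ?_
          intro x hx
          rw [← sub_mul, abs_mul, abs_of_nonneg (hL.nonneg x)]
          exact mul_le_mul_of_nonneg_right (hp _ (exp_mem_Icc hx)).le (hL.nonneg x)
      _ = δ / 3 := by rw [integral_const_mul, hL.one, mul_one]
  obtain ⟨K, hK⟩ := (Metric.tendsto_atTop.1 (seq_poly hN hM hL p)) (δ / 3) (by positivity)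
  refine ⟨K, fun k hk => ?_⟩
  have h1 := near (N k) (hN k)
  have h2 := near M hM
  have h3 := hK k hk
  rw [Real.dist_eq] at h3 ⊢
  rw [abs_le] at h1 h2
  rw [abs_lt] at h3 ⊢
  constructor <;> linarith

/-- sandwich test function -/
lemma seq_test {a b : ℝ} (ha : 0 < a) (hab : a < b) :
    ∃ h : ℝ → ℝ, Continuous h ∧ 0 < ∫ x in Ioi (0:ℝ), h (exp (-x)) ∧
      ∀ L : ℝ → ℝ, Tl L → L b * (∫ x in Ioi (0:ℝ), h (exp (-x))) ≤
        ∫ x in Ioi (0:ℝ), h (exp (-x)) * L x ∧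
        ∫ x in Ioi (0:ℝ), h (exp (-x)) * L x ≤ L a * (∫ x in Ioi (0:ℝ), h (exp (-x))) := by
  set h : ℝ → ℝ := fun u => max 0 (min (u - exp (-b)) (exp (-a) - u)) with hh
  have hc : Continuous h := by fun_prop
  have hn : ∀ u, 0 ≤ h u := fun u => le_max_left _ _
  have hz : ∀ x, x ∉ Icc a b → h (exp (-x)) = 0 := by
    intro x hx
    rw [mem_Icc, not_and_or, not_le, not_le] at hx
    apply max_eq_left
    rcases hx with hx | hx
    · exact (min_le_right _ _).trans (by have := exp_lt_exp.2 (neg_lt_neg hx); linarith)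
    · exact (min_le_left _ _).trans (by have := exp_lt_exp.2 (neg_lt_neg hx); linarith)
  have hi : IntegrableOn (fun x => h (exp (-x))) (Ioi 0) := by
    have : Integrable (fun x => h (exp (-x))) :=
      Continuous.integrable_of_hasCompactSupport (by fun_prop)
        (HasCompactSupport.intro isCompact_Icc hz)
    exact this.integrableOn
  have hiL : ∀ L : ℝ → ℝ, Tl L → IntegrableOn (fun x => h (exp (-x)) * L x) (Ioi 0) := fun L hL =>
    hi.mul_bdd (c := 1) hL.anti.measurable.aestronglyMeasurable
      (Eventually.of_forall fun x => by
        rw [Real.norm_eq_abs, abs_of_nonneg (hL.nonneg x)]; exact hL.le_one x)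
  refine ⟨h, hc, ?_, fun L hL => ⟨?_, ?_⟩⟩
  · rw [integral_pos_iff_support_of_nonneg (fun x => hn _) hi]
    have : Ioo a b ⊆ Function.support (fun x => h (exp (-x))) := by
      intro x hx
      have h1 := exp_lt_exp.2 (neg_lt_neg hx.1)
      have h2 := exp_lt_exp.2 (neg_lt_neg hx.2)
      apply ne_of_gt
      exact lt_max_of_lt_right (lt_min (by linarith) (by linarith))
    refine lt_of_lt_of_le ?_ (measure_mono this)
    rw [Measure.restrict_apply measurableSet_Ioo]
    have e : Ioo a b ∩ Ioi 0 = Ioo a b := inter_eq_left.2 fun x hx => ha.trans hx.1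
    rw [e, Real.volume_Ioo]; simpa using hab
  · rw [← integral_const_mul]
    refine setIntegral_mono_on (hi.const_mul _) (hiL L hL) measurableSet_Ioi fun x hx => ?_
    by_cases hx' : x ∈ Icc a b
    · rw [mul_comm]; exact mul_le_mul_of_nonneg_left (hL.anti hx'.2) (hn _)
    · rw [hz x hx']; simp
  · rw [← integral_const_mul]
    refine setIntegral_mono_on (hiL L hL) (hi.const_mul _) measurableSet_Ioi fun x hx => ?_
    by_cases hx' : x ∈ Icc a b
    · rw [mul_comm]; exact mul_le_mul_of_nonneg_right (hL.anti hx'.1) (hn _)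
    · rw [hz x hx']; simp

lemma seq_ptwise (hN : ∀ k, Tl (N k)) (hM : Tl M) (hMc : Continuous M)
    (hL : ∀ m : ℕ, Tendsto (fun k => ∫ x in Ioi (0:ℝ), exp (-(m * x)) * N k x) atTop
      (𝓝 (∫ x in Ioi (0:ℝ), exp (-(m * x)) * M x))) {x : ℝ} (hx : 0 < x) :
    Tendsto (fun k => N k x) atTop (𝓝 (M x)) := by
  have low : ∀ c, c < M x → ∀ᶠ k in atTop, c < N k x := by
    intro c hc
    obtain ⟨b, hb, hcb⟩ : ∃ b, x < b ∧ c < M b := by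
      have : ∀ᶠ b in 𝓝[>] x, c < M b := (hMc.continuousAt.eventually_const_lt hc).filter_mono
        nhdsWithin_le_nhds
      obtain ⟨b, h1, h2⟩ := (this.and self_mem_nhdsWithin).exists
      exact ⟨b, h2, h1⟩
    obtain ⟨h, hc', hpos, hb'⟩ := seq_test hx hb
    have h1 := seq_cont hN hM hL hc'
    have h2 : c * (∫ x in Ioi (0:ℝ), h (exp (-x))) < ∫ x in Ioi (0:ℝ), h (exp (-x)) * M x :=
      lt_of_lt_of_le (mul_lt_mul_of_pos_right hcb hpos) (hb' M hM).1
    filter_upwards [h1.eventually_const_lt h2] with k hk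
    have := hk.trans_le (hb' (N k) (hN k)).2
    exact lt_of_mul_lt_mul_right this hpos.le
  have up : ∀ c, M x < c → ∀ᶠ k in atTop, N k x < c := by
    intro c hc
    obtain ⟨b, hb, hb0, hcb⟩ : ∃ b, b < x ∧ 0 < b ∧ M b < c := by
      have : ∀ᶠ b in 𝓝[<] x, M b < c := (hMc.continuousAt.eventually_lt_const hc).filter_mono
        nhdsWithin_le_nhds
      have h0 : ∀ᶠ b in 𝓝[<] x, 0 < b := (lt_mem_nhds hx).filter_mono nhdsWithin_le_nhds
      obtain ⟨b, ⟨h1, h3⟩, h2⟩ := ((this.and h0).and self_mem_nhdsWithin).exists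
      exact ⟨b, h2, h3, h1⟩
    obtain ⟨h, hc', hpos, hb'⟩ := seq_test hb0 hb
    have h1 := seq_cont hN hM hL hc'
    have h2 : ∫ x in Ioi (0:ℝ), h (exp (-x)) * M x < c * (∫ x in Ioi (0:ℝ), h (exp (-x))) :=
      lt_of_le_of_lt (hb' M hM).2 (mul_lt_mul_of_pos_right hcb hpos)
    filter_upwards [h1.eventually_lt_const h2] with k hk
    have := (hb' (N k) (hN k)).1.trans_lt hk
    exact lt_of_mul_lt_mul_right this hpos.le
  exact tendsto_order.2 ⟨low, up⟩

lemma seq_L1 (hN : ∀ k, Tl (N k)) (hM : Tl M) (hMc : Continuous M)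
    (hL : ∀ m : ℕ, Tendsto (fun k => ∫ x in Ioi (0:ℝ), exp (-(m * x)) * N k x) atTop
      (𝓝 (∫ x in Ioi (0:ℝ), exp (-(m * x)) * M x))) :
    Tendsto (fun k => ∫ x in Ioi (0:ℝ), |N k x - M x|) atTop (𝓝 0) := by
  have e : ∀ k, ∫ x in Ioi (0:ℝ), |N k x - M x| = 2 * ∫ x in Ioi (0:ℝ), max (M x - N k x) 0 := by
    intro k
    have i1 : IntegrableOn (fun x => N k x - M x) (Ioi 0) := (hN k).int.sub hM.int
    have i2 : IntegrableOn (fun x => max (M x - N k x) 0) (Ioi 0) := (hM.int.sub (hN k).int).pos_part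
    have : ∀ x, |N k x - M x| = (N k x - M x) + 2 * max (M x - N k x) 0 := fun x => by
      rcases le_total (N k x) (M x) with h | h
      · rw [abs_of_nonpos (by linarith), max_eq_left (by linarith)]; ring
      · rw [abs_of_nonneg (by linarith), max_eq_right (by linarith)]; ring
    simp_rw [this]
    rw [integral_add i1 (i2.const_mul 2), integral_const_mul, integral_sub (hN k).int hM.int,
      (hN k).one, hM.one]; ring
  simp_rw [e]
  have : Tendsto (fun k => ∫ x in Ioi (0:ℝ), max (M x - N k x) 0) atTop
      (𝓝 (∫ x in Ioi (0:ℝ), (0:ℝ))) := by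
    refine tendsto_integral_of_dominated_convergence M (fun k => ?_) hM.int (fun k => ?_) ?_
    · exact ((hM.int.sub (hN k).int).pos_part).aestronglyMeasurable
    · refine Eventually.of_forall fun x => ?_
      rw [Real.norm_eq_abs, abs_of_nonneg (le_max_right _ _)]
      exact max_le (by linarith [(hN k).nonneg x]) (hM.nonneg x)
    · refine (ae_restrict_iff' measurableSet_Ioi).2 (Eventually.of_forall fun x hx => ?_)
      have h1 := seq_ptwise hN hM hMc hL hx
      have h2 : Tendsto (fun k => max (M x - N k x) 0) atTop (𝓝 (max (M x - M x) 0)) :=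
        (tendsto_const_nhds.sub h1).max tendsto_const_nhds
      simpa using h2
  simpa using this.const_mul 2
end

end part4

section part5

noncomputable def lap (N : ℝ → ℝ) (p : ℝ) : ℝ := ∫ x in Ioi (0:ℝ), exp (-(p * x)) * N x

lemma exp_neg_mul_le {p x : ℝ} (hp : 0 ≤ p) (hx : 0 < x) : exp (-(p * x)) ≤ 1 :=
  exp_le_one_iff.2 (by have := mul_nonneg hp hx.le; linarith)

lemma Tl.lap_int {N : ℝ → ℝ} (h : Tl N) {p : ℝ} (hp : 0 ≤ p) :
    IntegrableOn (fun x => exp (-(p * x)) * N x) (Ioi 0) :=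
  h.int_mul (by fun_prop) (C := 1) fun x hx => by
    rw [abs_of_pos (exp_pos _)]; exact exp_neg_mul_le hp hx

lemma Tl.lap_anti {N : ℝ → ℝ} (h : Tl N) {p r : ℝ} (hp : 0 ≤ p) (hpr : p ≤ r) :
    lap N r ≤ lap N p := by
  refine setIntegral_mono_on (h.lap_int (hp.trans hpr)) (h.lap_int hp) measurableSet_Ioi ?_
  intro x hx
  refine mul_le_mul_of_nonneg_right (exp_le_exp.2 ?_) (h.nonneg x)
  have := mul_le_mul_of_nonneg_right hpr (le_of_lt (mem_Ioi.1 hx))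
  linarith

lemma Tl.lap_low {N : ℝ → ℝ} (h : Tl N) (hx : IntegrableOn (fun x => x * N x) (Ioi 0)) {X : ℝ}
    (hX : ∫ x in Ioi (0:ℝ), x * N x ≤ X) {p : ℝ} (hp : 0 ≤ p) : exp (-(p * X)) ≤ lap N p := by
  have i1 : IntegrableOn (fun x => exp (-(p * X)) * ((1 + p * X) * N x - p * (x * N x))) (Ioi 0) :=
    ((h.int.const_mul _).sub (hx.const_mul _)).const_mul _
  calc exp (-(p * X)) ≤ exp (-(p * X)) * ((1 + p * X) * 1 - p * ∫ x in Ioi (0:ℝ), x * N x) := by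
        have := mul_le_mul_of_nonneg_left hX hp
        have := exp_pos (-(p * X))
        nlinarith
    _ = ∫ x in Ioi (0:ℝ), exp (-(p * X)) * ((1 + p * X) * N x - p * (x * N x)) := by
        rw [integral_const_mul, integral_sub (h.int.const_mul _) (hx.const_mul _),
          integral_const_mul, integral_const_mul, h.one]
    _ ≤ lap N p := by
        refine setIntegral_mono_on i1 (h.lap_int hp) measurableSet_Ioi fun x _ => ?_
        have h1 := add_one_le_exp (p * X - p * x)
        have h2 : exp (-(p * x)) = exp (-(p * X)) * exp (p * X - p * x) := by
          rw [← exp_add]; ring_nf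
        rw [h2]
        have := exp_pos (-(p * X))
        have h3 : exp (-(p * X)) * ((p * X - p * x + 1) * N x) ≤
            exp (-(p * X)) * (exp (p * X - p * x) * N x) := by
          have := h.nonneg x
          gcongr
        calc _ = exp (-(p * X)) * ((p * X - p * x + 1) * N x) := by ring
          _ ≤ _ := h3
          _ = _ := by ring

lemma Tl.lap_deriv {N : ℝ → ℝ} (h : Tl N) (hx : IntegrableOn (fun x => x * N x) (Ioi 0)) {p : ℝ}
    (hp : 0 < p) :
    HasDerivAt (lap N) (∫ x in Ioi (0:ℝ), -x * exp (-(p * x)) * N x) p := by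
  have hNm := h.anti.measurable
  refine (hasDerivAt_integral_of_dominated_loc_of_deriv_le (s := Ioi 0)
    (F := fun p x => exp (-(p * x)) * N x) (F' := fun p x => -x * exp (-(p * x)) * N x)
    (bound := fun x => x * N x) (Ioi_mem_nhds hp) ?_ (h.lap_int hp.le) ?_ ?_ hx ?_).2
  · exact Eventually.of_forall fun r => by
      apply Measurable.aestronglyMeasurable; fun_prop
  · apply Measurable.aestronglyMeasurable; fun_prop
  · refine (ae_restrict_iff' measurableSet_Ioi).2 (Eventually.of_forall fun x hx0 r hr => ?_)
    have := exp_neg_mul_le (le_of_lt hr) hx0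
    have hx0' : 0 < x := hx0
    rw [norm_mul, norm_mul, norm_neg, Real.norm_of_nonneg hx0'.le, Real.norm_of_nonneg (exp_pos _).le,
      Real.norm_of_nonneg (h.nonneg x)]
    have := h.nonneg x
    calc x * exp (-(r * x)) * N x ≤ x * 1 * N x := by gcongr
      _ = _ := by ring
  · refine Eventually.of_forall fun x r _ => ?_
    have : HasDerivAt (fun r : ℝ => exp (-(r * x))) (exp (-(r * x)) * (-(1 * x))) r :=
      ((hasDerivAt_id r).mul_const x).neg.exp
    convert! this.mul_const (N x) using 1
    ring

lemma Tl.lap_cont {N : ℝ → ℝ} (h : Tl N) : ContinuousOn (lap N) (Ici 0) := by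
  have hNm := h.anti.measurable
  refine continuousOn_of_dominated (bound := N) (F := fun p x => exp (-(p * x)) * N x) ?_ ?_ h.int ?_
  · exact fun p _ => by apply Measurable.aestronglyMeasurable; fun_prop
  · refine fun p hp => (ae_restrict_iff' measurableSet_Ioi).2 (Eventually.of_forall fun x hx0 => ?_)
    rw [norm_mul, Real.norm_of_nonneg (exp_pos _).le, Real.norm_of_nonneg (h.nonneg x)]
    exact mul_le_of_le_one_left (h.nonneg x) (exp_neg_mul_le hp hx0)
  · exact Eventually.of_forall fun x => by fun_prop

lemma conv_exp_int {N : ℝ → ℝ} (h : Tl N) {p : ℝ} (hp : 0 ≤ p) :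
    ∫ x in Ioi (0:ℝ), exp (-(p * x)) * ∫ s in (0:ℝ)..x, N s * N (x - s) = lap N p ^ 2 ∧
    IntegrableOn (fun x => exp (-(p * x)) * ∫ s in (0:ℝ)..x, N s * N (x - s)) (Ioi 0) := by
  have e : ∀ x, exp (-(p * x)) * ∫ s in (0:ℝ)..x, N s * N (x - s) =
      ∫ s in (0:ℝ)..x, (ContinuousLinearMap.mul ℝ ℝ) (exp (-(p * s)) * N s)
        (exp (-(p * (x - s))) * N (x - s)) := fun x => by
    rw [← intervalIntegral.integral_const_mul]
    congr 1; ext s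
    have : exp (-(p * x)) = exp (-(p * s)) * exp (-(p * (x - s))) := by
      rw [← exp_add]; ring_nf
    rw [this, ContinuousLinearMap.mul_apply']; ring
  constructor
  · simp_rw [e]
    rw [integral_posConvolution (h.lap_int hp) (h.lap_int hp)]
    simp [lap, sq]
  · have := integrable_posConvolution (h.lap_int hp) (h.lap_int hp) (ContinuousLinearMap.mul ℝ ℝ)
    unfold posConvolution at this
    rw [integrable_indicator_iff measurableSet_Ioi] at this
    exact this.congr_fun (fun x _ => (e x).symm) measurableSet_Ioi

lemma Tl.lap_est {N U : ℝ → ℝ} (h : Tl N) (hx : IntegrableOn (fun x => x * N x) (Ioi 0)) {X B ε : ℝ}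
    (hX : ∫ x in Ioi (0:ℝ), x * N x ≤ X) (hU : IntegrableOn U (Ioi 0)) (hU0 : ∀ x, 0 ≤ U x)
    (hB : ∫ x in Ioi (0:ℝ), U x ≤ B) (hε : 0 ≤ ε)
    (heq : ∀ x, 0 < x → x * N x = (∫ s in (0:ℝ)..x, N s * N (x - s)) + ε / 2 * U x) (m : ℕ) :
    |(lap N m)⁻¹ - (1 + m)| ≤ ε * (B * m * exp (2 * (m * X))) := by
  have hB0 : 0 ≤ B := le_trans (setIntegral_nonneg measurableSet_Ioi fun x _ => hU0 x) hB
  rcases Nat.eq_zero_or_pos m with rfl | hm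
  · have : lap N 0 = 1 := by unfold lap; simpa using h.one
    simp [this]
  have hm' : (0:ℝ) < m := by exact_mod_cast hm
  have hpos : ∀ p, 0 ≤ p → 0 < lap N p := fun p hp => (exp_pos _).trans_le (h.lap_low hx hX hp)
  have hUi : ∀ p, 0 ≤ p → IntegrableOn (fun x => exp (-(p * x)) * U x) (Ioi 0) := fun p hp => by
    refine Integrable.bdd_mul (c := 1) hU (by fun_prop) ?_
    refine (ae_restrict_iff' measurableSet_Ioi).2 (Eventually.of_forall fun x hx => ?_)
    rw [Real.norm_of_nonneg (exp_pos _).le]; exact exp_neg_mul_le hp hx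
  have hUb : ∀ p, 0 ≤ p → ∫ x in Ioi (0:ℝ), exp (-(p * x)) * U x ≤ B := fun p hp => by
    refine le_trans (setIntegral_mono_on (hUi p hp) hU measurableSet_Ioi fun x hx => ?_) hB
    exact mul_le_of_le_one_left (hU0 x) (exp_neg_mul_le hp hx)
  have hUn : ∀ p, 0 ≤ ∫ x in Ioi (0:ℝ), exp (-(p * x)) * U x := fun p =>
    setIntegral_nonneg measurableSet_Ioi fun x _ => mul_nonneg (exp_pos _).le (hU0 x)
  have hd : ∀ p, 0 < p → ∫ x in Ioi (0:ℝ), -x * exp (-(p * x)) * N x =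
      -(lap N p ^ 2 + ε / 2 * ∫ x in Ioi (0:ℝ), exp (-(p * x)) * U x) := fun p hp => by
    rw [← (conv_exp_int h hp.le).1, ← integral_const_mul,
      ← integral_add (conv_exp_int h hp.le).2 ((hUi p hp.le).const_mul _), ← integral_neg]
    refine setIntegral_congr_fun measurableSet_Ioi fun x hx => ?_
    have := heq x hx
    linear_combination (-exp (-(p * x))) * this
  obtain ⟨c, hc, hslope⟩ := exists_hasDerivAt_eq_slope (fun p => (lap N p)⁻¹)
    (fun p => (lap N p ^ 2 + ε / 2 * ∫ x in Ioi (0:ℝ), exp (-(p * x)) * U x) / lap N p ^ 2) hm'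
    ((h.lap_cont.mono Icc_subset_Ici_self).inv₀ fun p hp => (hpos p hp.1).ne') (fun p hp => by
      have := (h.lap_deriv hx hp.1).inv (hpos p hp.1.le).ne'
      rw [hd p hp.1, neg_neg] at this
      exact this)
  have h0 : lap N 0 = 1 := by unfold lap; simpa using h.one
  have hcp := hpos c hc.1.le
  simp only [h0, inv_one, sub_zero] at hslope
  rw [eq_div_iff hm'.ne'] at hslope
  have hs2 : (lap N m)⁻¹ - (1 + m) =
      ε / 2 * (∫ x in Ioi (0:ℝ), exp (-(c * x)) * U x) / lap N c ^ 2 * m := by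
    have : (lap N c ^ 2 + ε / 2 * ∫ x in Ioi (0:ℝ), exp (-(c * x)) * U x) / lap N c ^ 2 =
      1 + ε / 2 * (∫ x in Ioi (0:ℝ), exp (-(c * x)) * U x) / lap N c ^ 2 := by field_simp
    rw [this] at hslope
    linear_combination -hslope
  rw [hs2, abs_of_nonneg (by have := hUn c; positivity)]
  have hlow : exp (-(m * X)) ≤ lap N c :=
    (h.lap_low hx hX hm'.le).trans (h.lap_anti hc.1.le hc.2.le)
  have hinv : 1 / lap N c ^ 2 ≤ exp (2 * (m * X)) := by
    have e1 : exp (2 * (m * X)) = 1 / exp (-(m * X)) ^ 2 := by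
      rw [← exp_nat_mul, one_div, ← exp_neg]; push_cast; ring_nf
    rw [e1]
    exact one_div_le_one_div_of_le (by positivity) (by gcongr)
  calc ε / 2 * (∫ x in Ioi (0:ℝ), exp (-(c * x)) * U x) / lap N c ^ 2 * m
      = ε / 2 * ((∫ x in Ioi (0:ℝ), exp (-(c * x)) * U x) * m * (1 / lap N c ^ 2)) := by ring
    _ ≤ ε / 2 * (B * m * exp (2 * (m * X))) := by
        have := hUb c hc.1.le
        gcongr
    _ ≤ _ := by
        have : 0 ≤ B * m * exp (2 * (m * X)) := by positivity
        nlinarith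

/-- The quantitative closeness, in abstract form -/
lemma close_abs (X B : ℝ) {η : ℝ} (hη : 0 < η) (x₀ : ℝ) (hx₀ : 0 < x₀) :
    ∃ ε₀ > (0:ℝ), ∀ (ε : ℝ) (N U : ℝ → ℝ), 0 ≤ ε → ε < ε₀ → Tl N →
      IntegrableOn (fun x => x * N x) (Ioi 0) → ∫ x in Ioi (0:ℝ), x * N x ≤ X →
      IntegrableOn U (Ioi 0) → (∀ x, 0 ≤ U x) → ∫ x in Ioi (0:ℝ), U x ≤ B →
      (∀ x, 0 < x → x * N x = (∫ s in (0:ℝ)..x, N s * N (x - s)) + ε / 2 * U x) →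
      ∫ x in Ioi (0:ℝ), |N x - exp (-x)| < η ∧ exp (-x₀) - η < N x₀ := by
  by_contra hcon
  push Not at hcon
  have hk : ∀ k : ℕ, (0:ℝ) < 1 / (k + 1) := fun k => by positivity
  choose ε N U h0 h1 hT hxi hX hU hU0 hB heq hbad using fun k : ℕ => hcon (1 / (k + 1)) (hk k)
  have hε : Tendsto ε atTop (𝓝 0) :=
    squeeze_zero h0 (fun k => (h1 k).le) tendsto_one_div_add_atTop_nhds_zero_nat
  have hMc : Continuous (fun x : ℝ => min 1 (exp (-x))) := by fun_prop
  have hL : ∀ m : ℕ, Tendsto (fun k => ∫ x in Ioi (0:ℝ), exp (-(m * x)) * N k x) atTop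
      (𝓝 (∫ x in Ioi (0:ℝ), exp (-(m * x)) * min 1 (exp (-x)))) := fun m => by
    rw [lap_exp m]
    have hinv : Tendsto (fun k => (lap (N k) m)⁻¹) atTop (𝓝 (1 + m)) := by
      rw [tendsto_iff_norm_sub_tendsto_zero]
      refine squeeze_zero (fun k => norm_nonneg _) (fun k => (hT k).lap_est (hxi k) (hX k) (hU k)
        (hU0 k) (hB k) (h0 k) (heq k) m) ?_
      simpa using hε.mul_const (B * m * exp (2 * (m * X)))
    have := hinv.inv₀ (by positivity)
    simp only [inv_inv] at this
    rw [one_div]; exact this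
  have t1 := seq_L1 hT tl_exp hMc hL
  have t2 := seq_ptwise hT tl_exp hMc hL hx₀
  have e : ∀ x, 0 < x → min 1 (exp (-x)) = exp (-x) := fun x hx =>
    min_eq_right (exp_le_one_iff.2 (by linarith))
  rw [e x₀ hx₀] at t2
  have ev1 := t1.eventually_lt_const hη
  have ev2 := t2.eventually_const_lt (show exp (-x₀) - η < exp (-x₀) by linarith)
  obtain ⟨k, hk1, hk2⟩ := (ev1.and ev2).exists
  have e2 : ∫ x in Ioi (0:ℝ), |N k x - min 1 (exp (-x))| = ∫ x in Ioi (0:ℝ), |N k x - exp (-x)| :=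
    setIntegral_congr_fun measurableSet_Ioi fun x hx => by simp only [e x hx]
  rw [e2] at hk1
  exact absurd (hbad k hk1) (not_le.2 hk2)

end part5

section part6

noncomputable def NN (φ : ℝ → ℝ) (x : ℝ) : ℝ := (TT φ x).toReal

lemma TT_le_mom0 {φ : ℝ → ℝ} (x : ℝ) : TT φ x ≤ mom 0 φ := by
  rw [mom_zero]; exact setLIntegral_le_lintegral _ _

lemma lint_TT {φ : ℝ → ℝ} (hφ : PosF φ) {w : ℝ → ℝ≥0∞} (hw : Measurable w) :
    ∫⁻ x in Ioi 0, w x * TT φ x = ∫⁻ y, ENNReal.ofReal (φ y) * ∫⁻ x in Ioo 0 y, w x := by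
  have hm := hφ.meas
  set k : ℝ → ℝ → ℝ≥0∞ := fun x y => (Ioo 0 y).indicator 1 x * (w x * ENNReal.ofReal (φ y)) with hk
  have hkm : Measurable (fun p : ℝ × ℝ => k p.1 p.2) := by
    have e : (fun p : ℝ × ℝ => k p.1 p.2) = fun p : ℝ × ℝ =>
      ({p : ℝ × ℝ | 0 < p.1} ∩ {p : ℝ × ℝ | p.1 < p.2}).indicator (1 : ℝ × ℝ → ℝ≥0∞) p *
        (w p.1 * ENNReal.ofReal (φ p.2)) := by
      ext p; simp [hk, indicator]
    rw [e]
    have h1 : MeasurableSet {p : ℝ × ℝ | 0 < p.1} :=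
      measurableSet_lt (by fun_prop) (by fun_prop)
    have h2 : MeasurableSet {p : ℝ × ℝ | p.1 < p.2} :=
      measurableSet_lt (by fun_prop) (by fun_prop)
    exact (measurable_one.indicator (h1.inter h2)).mul (by fun_prop)
  calc ∫⁻ x in Ioi 0, w x * TT φ x = ∫⁻ x, ∫⁻ y, k x y := by
        rw [← lintegral_indicator measurableSet_Ioi]
        refine lintegral_congr fun x => ?_
        by_cases hx : x ∈ Ioi (0:ℝ)
        · rw [indicator_of_mem hx, TT, ← lintegral_const_mul _ (by fun_prop),
            ← lintegral_indicator measurableSet_Ioi]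
          refine lintegral_congr fun y => ?_
          simp only [hk, indicator, mem_Ioo, mem_Ioi.1 hx, true_and, mem_Ioi]
          split_ifs <;> simp
        · rw [indicator_of_notMem hx]
          have : ∀ y, k x y = 0 := fun y => by
            have : x ∉ Ioo 0 y := fun h => hx h.1
            simp [hk, this]
          simp [this]
    _ = ∫⁻ y, ∫⁻ x, k x y := lintegral_lintegral_swap hkm.aemeasurable
    _ = _ := by
        refine lintegral_congr fun y => ?_
        rw [← lintegral_indicator measurableSet_Ioo, ← lintegral_const_mul _
          (hw.indicator measurableSet_Ioo)]
        refine lintegral_congr fun x => ?_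
        simp only [hk, indicator]
        split_ifs <;> simp [mul_comm]

lemma ell_le1 (x y z : ℝ) (hx : 0 ≤ x) (hy : 0 ≤ y) : ell x y z ≤ y := by
  unfold ell
  refine max_le ?_ hy
  have := min_le_left y x
  have := min_le_right z x
  linarith

lemma ell_le2 (x y z : ℝ) (hx : 0 ≤ x) (hz : 0 ≤ z) : ell x y z ≤ z := by
  rw [ell_symm]; exact ell_le1 x z y hx hz

lemma ell_le0 (x y z : ℝ) (hx : 0 ≤ x) : ell x y z ≤ x := by
  unfold ell
  refine max_le ?_ hx
  have := min_le_right y x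
  have := min_le_right z x
  linarith

lemma ell_zero (x y z : ℝ) (h : y + z ≤ x) : ell x y z = 0 := by
  unfold ell
  refine max_eq_right ?_
  have := min_le_left y x
  have := min_le_left z x
  linarith

lemma ell_int1 {y z : ℝ} (hy : 0 < y) (hz : 0 < z) :
    ∫⁻ x in Ioi 0, ENNReal.ofReal (ell x y z) ≤ ENNReal.ofReal (2 * (y * z)) := by
  calc ∫⁻ x in Ioi 0, ENNReal.ofReal (ell x y z)
      ≤ ∫⁻ x, (Ioo 0 (y + z)).indicator (fun _ => ENNReal.ofReal (min y z)) x := by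
        rw [← lintegral_indicator measurableSet_Ioi]
        refine lintegral_mono fun x => ?_
        dsimp only
        by_cases hx : x ∈ Ioi (0:ℝ)
        · rw [indicator_of_mem hx]
          by_cases h : x < y + z
          · rw [indicator_of_mem (show x ∈ Ioo 0 (y + z) from ⟨hx, h⟩)]
            exact ENNReal.ofReal_le_ofReal (le_min (ell_le1 x y z (le_of_lt hx) hy.le)
              (ell_le2 x y z (le_of_lt hx) hz.le))
          · rw [ell_zero x y z (not_lt.1 h)]; simp
        · rw [indicator_of_notMem hx]; exact zero_le
    _ = ENNReal.ofReal (min y z * (y + z)) := by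
        rw [lintegral_indicator measurableSet_Ioo, lintegral_const, Measure.restrict_apply_univ,
          Real.volume_Ioo, ← ENNReal.ofReal_mul (by positivity), sub_zero]
    _ ≤ _ := by
        apply ENNReal.ofReal_le_ofReal
        rcases le_total y z with h | h
        · rw [min_eq_left h]; nlinarith
        · rw [min_eq_right h]; nlinarith

lemma ell_int2 {y z : ℝ} (hy : 0 < y) (hz : 0 < z) :
    ∫⁻ x in Ioi 0, ENNReal.ofReal (1 + 1 / x) * ENNReal.ofReal (ell x y z) ≤
      ENNReal.ofReal (1 + 4 * (y * z)) := by
  calc ∫⁻ x in Ioi 0, ENNReal.ofReal (1 + 1 / x) * ENNReal.ofReal (ell x y z)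
      ≤ ∫⁻ x in Ioi 0, ((Ioo 0 1).indicator (fun _ => 1) x + 2 * ENNReal.ofReal (ell x y z)) := by
        refine lintegral_mono_ae ((ae_restrict_iff' measurableSet_Ioi).2 ?_)
        have hne : ∀ᵐ x : ℝ, x ≠ 1 := by simp [ae_iff]
        filter_upwards [hne] with x hx1 hx
        have hx : 0 < x := hx
        have e0 := ell_nonneg x y z
        rw [← ENNReal.ofReal_mul (by positivity)]
        have e2 : (2:ℝ≥0∞) = ENNReal.ofReal 2 := by simp
        by_cases h : x < 1
        · rw [indicator_of_mem (show x ∈ Ioo (0:ℝ) 1 from ⟨hx, h⟩), e2,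
            ← ENNReal.ofReal_mul (by norm_num), ← ENNReal.ofReal_one,
            ← ENNReal.ofReal_add (by norm_num) (by positivity)]
          apply ENNReal.ofReal_le_ofReal
          have : 1 / x * ell x y z ≤ 1 := by
            rw [one_div, inv_mul_le_iff₀ hx, mul_one]; exact ell_le0 x y z hx.le
          nlinarith
        · rw [indicator_of_notMem (fun hh => h hh.2), zero_add, e2,
            ← ENNReal.ofReal_mul (by norm_num)]
          apply ENNReal.ofReal_le_ofReal
          have : 1 / x ≤ 1 := by rw [div_le_one hx]; exact not_lt.1 h
          nlinarith
    _ = (∫⁻ x in Ioi (0:ℝ), (Ioo (0:ℝ) 1).indicator (fun _ => 1) x) +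
        2 * ∫⁻ x in Ioi 0, ENNReal.ofReal (ell x y z) := by
        have hl : Measurable (fun x => ENNReal.ofReal (ell x y z)) :=
          (ell_meas measurable_id measurable_const measurable_const).ennreal_ofReal
        rw [lintegral_add_left (measurable_const.indicator measurableSet_Ioo),
          lintegral_const_mul _ hl]
    _ ≤ 1 + 2 * ENNReal.ofReal (2 * (y * z)) := by
        gcongr
        · refine (setLIntegral_le_lintegral _ _).trans ?_
          rw [lintegral_indicator measurableSet_Ioo]; simp
        · exact ell_int1 hy hz
    _ = _ := by
        have e2 : (2:ℝ≥0∞) = ENNReal.ofReal 2 := by simp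
        rw [e2, ← ENNReal.ofReal_mul (by norm_num), ← ENNReal.ofReal_one,
          ← ENNReal.ofReal_add (by norm_num) (by positivity)]
        congr 1; ring

lemma tonelli_ell {k : ℝ → ℝ → ℝ≥0∞} (hk : Measurable (fun p : ℝ × ℝ => k p.1 p.2))
    {w : ℝ → ℝ≥0∞} (hw : Measurable w) :
    ∫⁻ x in Ioi 0, w x * ∫⁻ y, ∫⁻ z, k y z * ENNReal.ofReal (ell x y z) =
      ∫⁻ y, ∫⁻ z, k y z * ∫⁻ x in Ioi 0, w x * ENNReal.ofReal (ell x y z) := by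
  have hl : Measurable (fun p : ℝ × ℝ × ℝ => ell p.1 p.2.1 p.2.2) :=
    ell_meas measurable_fst (by fun_prop) (by fun_prop)
  have hm : Measurable (fun p : ℝ × ℝ × ℝ => k p.2.1 p.2.2 * ENNReal.ofReal (ell p.1 p.2.1 p.2.2)) :=
    (hk.comp (f := fun p : ℝ × ℝ × ℝ => (p.2.1, p.2.2)) (by fun_prop)).mul hl.ennreal_ofReal
  have hm' : Measurable (fun p : ℝ × ℝ × ℝ => w p.1 * (k p.2.1 p.2.2 *
      ENNReal.ofReal (ell p.1 p.2.1 p.2.2))) := (hw.comp measurable_fst).mul hm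
  have hmx : ∀ x, Measurable (fun p : ℝ × ℝ => k p.1 p.2 * ENNReal.ofReal (ell x p.1 p.2)) :=
    fun x => hm.comp (f := fun p : ℝ × ℝ => (x, p.1, p.2)) (by fun_prop)
  calc ∫⁻ x in Ioi 0, w x * ∫⁻ y, ∫⁻ z, k y z * ENNReal.ofReal (ell x y z)
      = ∫⁻ x in Ioi 0, ∫⁻ y, ∫⁻ z, w x * (k y z * ENNReal.ofReal (ell x y z)) := by
        refine lintegral_congr fun x => ?_
        rw [← dbl_const_mul _ (hmx x)]
    _ = ∫⁻ y, ∫⁻ x in Ioi 0, ∫⁻ z, w x * (k y z * ENNReal.ofReal (ell x y z)) := by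
        rw [lintegral_lintegral_swap]
        exact ((hm'.comp (f := fun p : (ℝ × ℝ) × ℝ => (p.1.1, p.1.2, p.2))
          (by fun_prop)).lintegral_prod_right').aemeasurable
    _ = ∫⁻ y, ∫⁻ z, ∫⁻ x in Ioi 0, w x * (k y z * ENNReal.ofReal (ell x y z)) := by
        refine lintegral_congr fun y => ?_
        rw [lintegral_lintegral_swap]
        exact (hm'.comp (f := fun p : ℝ × ℝ => (p.1, y, p.2)) (by fun_prop)).aemeasurable
    _ = _ := by
        refine lintegral_congr fun y => lintegral_congr fun z => ?_
        have h1 : Measurable (fun x => w x * ENNReal.ofReal (ell x y z)) :=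
          hw.mul (ell_meas measurable_id measurable_const measurable_const).ennreal_ofReal
        rw [← lintegral_const_mul _ h1]
        refine lintegral_congr fun x => ?_
        ring

/-- double W-ell integral with two densities -/
noncomputable def DD (W : ℝ → ℝ → ℝ) (φ χ : ℝ → ℝ) (a : ℝ) : ℝ≥0∞ :=
  ∫⁻ y, ∫⁻ z, ENNReal.ofReal (W y z * (φ y * χ z)) * ENNReal.ofReal (ell a y z)

lemma DD_meas {α : ℝ} {W : ℝ → ℝ → ℝ} (hW : GW α W) {φ χ : ℝ → ℝ} (hφ : Measurable φ)
    (hχ : Measurable χ) : Measurable (DD W φ χ) := by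
  have hl : Measurable (fun p : (ℝ × ℝ) × ℝ => ell p.1.1 p.1.2 p.2) :=
    ell_meas (by fun_prop) (by fun_prop) (by fun_prop)
  have hk : Measurable (fun p : (ℝ × ℝ) × ℝ => ENNReal.ofReal (W p.1.2 p.2 * (φ p.1.2 * χ p.2))) := by
    have : Measurable (fun p : (ℝ × ℝ) × ℝ => W p.1.2 p.2) :=
      hW.meas.comp (f := fun p : (ℝ × ℝ) × ℝ => (p.1.2, p.2)) (by fun_prop)
    exact (this.mul ((hφ.comp (measurable_snd.comp measurable_fst)).mul
      (hχ.comp measurable_snd))).ennreal_ofReal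
  exact ((hk.mul hl.ennreal_ofReal).lintegral_prod_right').lintegral_prod_right'

lemma UU_eq {α : ℝ} {W : ℝ → ℝ → ℝ} (hW : GW α W) {φ : ℝ → ℝ} (h : PosF φ) (a : ℝ) :
    UU W φ a = DD W φ φ a := by
  refine lintegral_congr fun y => lintegral_congr fun z => ?_
  have := hW.nonneg y z
  have := h.nonneg y
  have := h.nonneg z
  rw [← ENNReal.ofReal_mul (by positivity)]
  congr 1; ring

lemma DD_int {α : ℝ} {W : ℝ → ℝ → ℝ} (hW : GW α W) {φ χ : ℝ → ℝ} (hφ : PosF φ) (hχ : PosF χ) :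
    ∫⁻ x in Ioi 0, ENNReal.ofReal (1 + 1 / x) * DD W φ χ x ≤
      (mom α φ * mom (-α) χ + mom (-α) φ * mom α χ) +
      4 * (mom (1 + α) φ * mom (1 - α) χ + mom (1 - α) φ * mom (1 + α) χ) := by
  have hWm := hW.meas' measurable_fst measurable_snd
  have h1 := hφ.meas
  have h2 := hχ.meas
  have hk : Measurable (fun p : ℝ × ℝ => ENNReal.ofReal (W p.1 p.2 * (φ p.1 * χ p.2))) := by
    fun_prop
  unfold DD
  rw [tonelli_ell hk (by fun_prop)]
  calc _ ≤ ∫⁻ y, ∫⁻ z, (ENNReal.ofReal (W y z * (φ y * χ z)) +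
        4 * ENNReal.ofReal (W y z * max (y * z) 0 * (φ y * χ z))) := by
        refine lintegral_mono fun y => lintegral_mono fun z => ?_
        dsimp only
        rcases le_or_gt y 0 with hy | hy
        · simp [hφ.zero y hy]
        rcases le_or_gt z 0 with hz | hz
        · simp [hχ.zero z hz]
        refine (mul_le_mul_right (ell_int2 hy hz) _).trans ?_
        have i1 := hW.nonneg y z
        have i2 := hφ.nonneg y
        have i3 := hχ.nonneg z
        have e4 : (4:ℝ≥0∞) = ENNReal.ofReal 4 := by simp
        rw [max_eq_left (by positivity), e4, ← ENNReal.ofReal_mul (by positivity),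
          ← ENNReal.ofReal_mul (by positivity), ← ENNReal.ofReal_add (by positivity) (by positivity)]
        apply ENNReal.ofReal_le_ofReal
        apply le_of_eq; ring
    _ = (∫⁻ y, ∫⁻ z, ENNReal.ofReal (W y z * (φ y * χ z))) +
        4 * ∫⁻ y, ∫⁻ z, ENNReal.ofReal (W y z * max (y * z) 0 * (φ y * χ z)) := by
        rw [dbl_add hk, dbl_const_mul]
        fun_prop
    _ ≤ _ := by
        have b1 := dbl_bound hφ hχ W 1 α (-α) 1 (-α) α zero_le_one zero_le_one
          (fun y z hy hz => by simpa using hW.ub y z hy hz)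
        have b2 := dbl_bound hφ hχ (fun y z => W y z * max (y * z) 0) 1 (1 + α) (1 - α) 1 (1 - α)
          (1 + α) zero_le_one zero_le_one (fun y z hy hz => by
            have := hW.ub y z hy hz
            rw [max_eq_left (by positivity), sub_eq_add_neg, rpow_add hy, rpow_add hz, rpow_add hy,
              rpow_add hz, rpow_one, rpow_one]
            calc W y z * (y * z) ≤ (y ^ α * z ^ (-α) + y ^ (-α) * z ^ α) * (y * z) := by gcongr
              _ = _ := by ring)
        simp only [ENNReal.ofReal_one, one_mul] at b1 b2
        gcongr

lemma DD_int0 {α : ℝ} {W : ℝ → ℝ → ℝ} (hW : GW α W) {φ χ : ℝ → ℝ} (hφ : PosF φ) (hχ : PosF χ) :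
    ∫⁻ x in Ioi 0, DD W φ χ x ≤
      2 * (mom (1 + α) φ * mom (1 - α) χ + mom (1 - α) φ * mom (1 + α) χ) := by
  have hWm := hW.meas' measurable_fst measurable_snd
  have h1 := hφ.meas
  have h2 := hχ.meas
  have hk : Measurable (fun p : ℝ × ℝ => ENNReal.ofReal (W p.1 p.2 * (φ p.1 * χ p.2))) := by
    fun_prop
  have := tonelli_ell (k := fun y z => ENNReal.ofReal (W y z * (φ y * χ z))) hk (w := fun _ => 1) measurable_const
  simp only [one_mul] at this
  unfold DD
  rw [this]
  have b2 := dbl_bound hφ hχ (fun y z => W y z * max (2 * (y * z)) 0) 2 (1 + α) (1 - α) 2 (1 - α)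
    (1 + α) zero_le_two zero_le_two (fun y z hy hz => by
      have := hW.ub y z hy hz
      rw [max_eq_left (by positivity), sub_eq_add_neg, rpow_add hy, rpow_add hz, rpow_add hy,
        rpow_add hz, rpow_one, rpow_one]
      calc W y z * (2 * (y * z)) ≤ (y ^ α * z ^ (-α) + y ^ (-α) * z ^ α) * (2 * (y * z)) := by gcongr
        _ = _ := by ring)
  have e2 : (2:ℝ≥0∞) = ENNReal.ofReal 2 := by simp
  rw [e2, mul_add]
  refine le_trans (lintegral_mono fun y => lintegral_mono fun z => ?_) b2
  dsimp only
  rcases le_or_gt y 0 with hy | hy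
  · simp [hφ.zero y hy]
  rcases le_or_gt z 0 with hz | hz
  · simp [hχ.zero z hz]
  refine (mul_le_mul_right (ell_int1 hy hz) _).trans ?_
  have i1 := hW.nonneg y z
  have i2 := hφ.nonneg y
  have i3 := hχ.nonneg z
  rw [max_eq_left (by positivity), ← ENNReal.ofReal_mul (by positivity)]
  apply ENNReal.ofReal_le_ofReal
  apply le_of_eq; ring

lemma DD_le {α : ℝ} {W : ℝ → ℝ → ℝ} (hW : GW α W) {φ χ : ℝ → ℝ} (hφ : PosF φ)
    (hχ : PosF χ) {a : ℝ} (ha : 0 ≤ a) :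
    DD W φ χ a ≤ mom α φ * mom (1 - α) χ + mom (1 - α) φ * mom α χ := by
  have b2 := dbl_bound hφ hχ (fun y z => W y z * ell a y z) 1 α (1 - α) 1 (1 - α)
    α zero_le_one zero_le_one (fun y z hy hz => by
      have := hW.ub y z hy hz
      have l1 := ell_le1 a y z ha hy.le
      have l2 := ell_le2 a y z ha hz.le
      have l0 := ell_nonneg a y z
      rw [sub_eq_add_neg, rpow_add hz, rpow_add hy, rpow_one, rpow_one]
      calc W y z * ell a y z ≤ (y ^ α * z ^ (-α) + y ^ (-α) * z ^ α) * ell a y z := by gcongr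
        _ = y ^ α * z ^ (-α) * ell a y z + y ^ (-α) * z ^ α * ell a y z := by ring
        _ ≤ y ^ α * z ^ (-α) * z + y ^ (-α) * z ^ α * y := by gcongr
        _ = _ := by ring)
  simp only [ENNReal.ofReal_one, one_mul] at b2
  refine le_trans (lintegral_mono fun y => lintegral_mono fun z => ?_) b2
  dsimp only
  rcases le_or_gt y 0 with hy | hy
  · simp [hφ.zero y hy]
  rcases le_or_gt z 0 with hz | hz
  · simp [hχ.zero z hz]
  have i1 := hW.nonneg y z
  have i2 := hφ.nonneg y
  have i3 := hχ.nonneg z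
  rw [← ENNReal.ofReal_mul (by positivity)]
  apply ENNReal.ofReal_le_ofReal
  apply le_of_eq; ring

end part6

section part7

lemma Prof.TT_le_one' {α ε : ℝ} {W : ℝ → ℝ → ℝ} {φ : ℝ → ℝ} (hW : GW α W) (hε : 0 ≤ ε)
    (h : Prof α ε W φ) (x : ℝ) : TT φ x ≤ 1 := (TT_le_mom0 x).trans (h.mom0 hW hε)

lemma Prof.TT_ne_top {α ε : ℝ} {W : ℝ → ℝ → ℝ} {φ : ℝ → ℝ} (hW : GW α W) (hε : 0 ≤ ε)
    (h : Prof α ε W φ) (x : ℝ) : TT φ x ≠ ∞ :=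
  ((h.TT_le_one' hW hε x).trans_lt (by simp)).ne

lemma lint_TT_one {φ : ℝ → ℝ} (hφ : PosF φ) : ∫⁻ x in Ioi 0, TT φ x = mom 1 φ := by
  have := lint_TT hφ (w := fun _ => 1) measurable_const
  simp only [one_mul] at this
  rw [this]
  refine lintegral_congr fun y => ?_
  rcases le_or_gt y 0 with hy | hy
  · simp [hφ.zero y hy]
  rw [lintegral_const, Measure.restrict_apply_univ, Real.volume_Ioo, one_mul, sub_zero, rpow_one,
    mul_comm, ENNReal.ofReal_mul hy.le]

lemma lint_TT_id {φ : ℝ → ℝ} (hφ : PosF φ) :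
    ∫⁻ x in Ioi 0, ENNReal.ofReal x * TT φ x ≤ mom 2 φ := by
  rw [lint_TT hφ (w := fun x => ENNReal.ofReal x) (by fun_prop)]
  refine lintegral_mono fun y => ?_
  dsimp only
  rcases le_or_gt y 0 with hy | hy
  · simp [hφ.zero y hy]
  calc ENNReal.ofReal (φ y) * ∫⁻ x in Ioo 0 y, ENNReal.ofReal x
      ≤ ENNReal.ofReal (φ y) * ∫⁻ x in Ioo 0 y, ENNReal.ofReal y := by
        refine mul_le_mul_right (setLIntegral_mono' measurableSet_Ioo fun x hx => ?_) _
        exact ENNReal.ofReal_le_ofReal hx.2.le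
    _ = _ := by
        rw [lintegral_const, Measure.restrict_apply_univ, Real.volume_Ioo, sub_zero,
          ← ENNReal.ofReal_mul hy.le, ← ENNReal.ofReal_mul (hφ.nonneg y), rpow_two]
        congr 1; ring

lemma Prof.tl {α ε : ℝ} {W : ℝ → ℝ → ℝ} {φ : ℝ → ℝ} (hW : GW α W) (hε : 0 ≤ ε)
    (h : Prof α ε W φ) : Tl (NN φ) := by
  have hne := h.TT_ne_top hW hε
  have h1 := lint_TT_one h.pos
  rw [h.mass] at h1
  refine ⟨fun x y hxy => ENNReal.toReal_mono (hne x) (TT_anti hxy), fun x => ENNReal.toReal_nonneg,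
    fun x => ?_, ?_, ?_⟩
  · have := ENNReal.toReal_mono (by simp) (h.TT_le_one' hW hε x)
    simpa [NN] using this
  · exact integrable_toReal_of_lintegral_ne_top TT_meas.aemeasurable (by rw [h1]; simp)
  · unfold NN
    rw [integral_toReal TT_meas.aemeasurable (Eventually.of_forall fun x => (hne x).lt_top), h1]
    simp

lemma Prof.xNN {α ε : ℝ} {W : ℝ → ℝ → ℝ} {φ : ℝ → ℝ} (h : Prof α ε W φ) {C : ℝ≥0}
    (hC : mom 2 φ ≤ C) : IntegrableOn (fun x => x * NN φ x) (Ioi 0) ∧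
      ∫ x in Ioi (0:ℝ), x * NN φ x ≤ C := by
  have h1 := (lint_TT_id h.pos).trans hC
  have hm : Measurable (fun x => ENNReal.ofReal x * TT φ x) := by
    have := TT_meas (φ := φ); fun_prop
  have e : ∀ x ∈ Ioi (0:ℝ), (ENNReal.ofReal x * TT φ x).toReal = x * NN φ x := fun x hx => by
    rw [ENNReal.toReal_mul, ENNReal.toReal_ofReal (le_of_lt hx), NN]
  constructor
  · exact (integrable_toReal_of_lintegral_ne_top (μ := volume.restrict (Ioi 0)) hm.aemeasurable
      (h1.trans_lt (by simp)).ne).congr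
      ((ae_restrict_iff' measurableSet_Ioi).2 (Eventually.of_forall e))
  · rw [← setIntegral_congr_fun measurableSet_Ioi e, integral_toReal hm.aemeasurable]
    · exact ENNReal.toReal_mono (by simp) h1
    · exact ae_lt_top hm (h1.trans_lt (by simp)).ne

noncomputable def UR (W : ℝ → ℝ → ℝ) (φ : ℝ → ℝ) (x : ℝ) : ℝ := (DD W φ φ x).toReal

lemma Prof.tail_real {α ε : ℝ} {W : ℝ → ℝ → ℝ} {φ : ℝ → ℝ} (hα : α ∈ Ioo (0:ℝ) 1) (hW : GW α W)
    (hε : 0 ≤ ε) (h : Prof α ε W φ) {x : ℝ} (hx : 0 < x) :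
    x * NN φ x = (∫ s in (0:ℝ)..x, NN φ s * NN φ (x - s)) + ε / 2 * UR W φ x := by
  have h1 := congrArg ENNReal.toReal (h.tail_split hW hε hx)
  have hne := h.TT_ne_top hW hε
  have hT1 := h.TT_le_one' hW hε
  have f1 : ∫⁻ s in Ioo 0 x, TT φ s * TT φ (x - s) ≠ ∞ := by
    refine ne_top_of_le_ne_top (b := ∫⁻ s in Ioo 0 x, 1) ?_ (lintegral_mono fun s => ?_)
    · simp
    · simpa using mul_le_mul' (hT1 s) (hT1 (x - s))
  have hm : ∀ s, 0 ≤ s → s ≤ 1 → mom s φ ≠ ∞ := fun s h0 h1 => by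
    refine ne_top_of_le_ne_top ?_ (mom_interp h.pos h0 h1)
    rw [h.mass]
    exact ENNReal.add_ne_top.2 ⟨((h.mom0 hW hε).trans_lt (by simp)).ne, by simp⟩
  have f2 : DD W φ φ x ≠ ∞ := by
    refine ne_top_of_le_ne_top ?_ (DD_le hW h.pos h.pos hx.le)
    have a1 := hm α hα.1.le hα.2.le
    have a2 := hm (1 - α) (by linarith [hα.2]) (by linarith [hα.1])
    exact ENNReal.add_ne_top.2 ⟨ENNReal.mul_ne_top a1 a2, ENNReal.mul_ne_top a2 a1⟩
  rw [UU_eq hW h.pos, ENNReal.toReal_add f1 (ENNReal.mul_ne_top (by simp) f2), ENNReal.toReal_mul,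
    ENNReal.toReal_mul, ENNReal.toReal_ofReal hx.le, ENNReal.toReal_ofReal (by positivity)] at h1
  rw [NN, UR, h1, intervalIntegral.integral_of_le hx.le, integral_Ioc_eq_integral_Ioo]
  congr 1
  rw [← integral_toReal]
  · simp [NN, ENNReal.toReal_mul]
  · have := TT_meas (φ := φ)
    exact (this.mul (this.comp (by fun_prop))).aemeasurable
  · exact Eventually.of_forall fun s => (ENNReal.mul_ne_top (hne _) (hne _)).lt_top

lemma Prof.close {α : ℝ} (hα : α ∈ Ioo (0:ℝ) 1) {η : ℝ} (hη : 0 < η) (x₀ : ℝ) (hx₀ : 0 < x₀) :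
    ∃ ε₀ > (0:ℝ), ε₀ ≤ 1 ∧ ∀ (ε : ℝ) (W : ℝ → ℝ → ℝ) (φ : ℝ → ℝ), 0 ≤ ε → ε < ε₀ → GW α W →
      Prof α ε W φ →
      ∫ x in Ioi (0:ℝ), |NN φ x - exp (-x)| < η ∧ exp (-x₀) - η < NN φ x₀ := by
  obtain ⟨C, hC1, hC⟩ := mom_bound hα
  obtain ⟨ε₀, h0, hcl⟩ := close_abs (C : ℝ) ((4 * C * C : ℝ≥0) : ℝ) hη x₀ hx₀
  refine ⟨min ε₀ 1, lt_min h0 one_pos, min_le_right _ _, fun ε W φ he he' hW h => ?_⟩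
  have he1 : ε ≤ 1 := he'.le.trans (min_le_right _ _)
  have hm := hC W φ ε hW he he1 h
  have hx := h.xNN (hm 2 (by norm_num) le_rfl)
  have hD : ∫⁻ x in Ioi 0, DD W φ φ x ≤ ((4 * C * C : ℝ≥0) : ℝ≥0∞) := by
    refine (DD_int0 hW h.pos h.pos).trans ?_
    have a1 := hm (1 + α) (by linarith [hα.1]) (by linarith [hα.2])
    have a2 := hm (1 - α) (by linarith [hα.2]) (by linarith [hα.1])
    calc _ ≤ 2 * ((C:ℝ≥0∞) * C + C * C) := by gcongr
      _ = _ := by push_cast; ring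
  have hDm := DD_meas hW h.pos.meas h.pos.meas
  refine hcl ε (NN φ) (UR W φ) he (he'.trans_le (min_le_left _ _)) (h.tl hW he) hx.1 hx.2 ?_
    (fun x => ENNReal.toReal_nonneg) ?_ (fun x hx => h.tail_real hα hW he hx)
  · exact integrable_toReal_of_lintegral_ne_top hDm.aemeasurable (hD.trans_lt ENNReal.coe_lt_top).ne
  · unfold UR
    rw [integral_toReal hDm.aemeasurable (ae_lt_top hDm (hD.trans_lt ENNReal.coe_lt_top).ne)]
    exact ENNReal.toReal_mono ENNReal.coe_ne_top hD

end part7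

section part8

lemma lint_pow_neg {a b c : ℝ} (ha : 0 ≤ a) (hb : 0 < b) (hbc : b ≤ c) :
    ∫⁻ x in Ioo b c, ENNReal.ofReal (x ^ (-a - 2)) =
      ENNReal.ofReal ((b ^ (-1 - a) - c ^ (-1 - a)) / (1 + a)) := by
  have h0 : (0:ℝ) ∉ uIcc b c := by
    rw [uIcc_of_le hbc]; exact fun h => absurd h.1 (not_le.2 hb)
  rw [restrict_Ioo_eq_restrict_Ioc, ← ofReal_integral_eq_lintegral_ofReal,
    ← intervalIntegral.integral_of_le hbc, integral_rpow]
  · congr 1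
    have e : (-a - 2 : ℝ) + 1 = -1 - a := by ring
    rw [e, div_eq_div_iff (by linarith) (by linarith)]
    ring
  · right
    exact ⟨by linarith, h0⟩
  · have := intervalIntegral.intervalIntegrable_rpow (μ := volume) (r := -a - 2) (a := b) (b := c)
      (Or.inr h0)
    exact (intervalIntegrable_iff_integrableOn_Ioc_of_le hbc).1 this
  · refine (ae_restrict_iff' measurableSet_Ioc).2 (Eventually.of_forall fun x hx => ?_)
    exact rpow_nonneg (hb.le.trans hx.1.le) _

lemma Prof.neg_mom {α ε : ℝ} {W : ℝ → ℝ → ℝ} {φ : ℝ → ℝ} (hW : GW α W)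
    (h : Prof α ε W φ) {a β κ x₀ n r : ℝ} (ha : 0 ≤ a) (hβ : 0 ≤ β) (hκ : 0 ≤ κ)
    (hK : ∀ y z, 0 < y → 0 < z → κ * (y ^ (-β) * z ^ β) ≤ Kern ε W y z) (hx₀ : 0 < x₀)
    (hn0 : 0 ≤ n) (hn : ENNReal.ofReal n ≤ TT φ x₀) (hr : 0 < r) :
    ENNReal.ofReal (κ * x₀ ^ β * n / (1 + a)) *
        (∫⁻ y in Ioi r, ENNReal.ofReal (y ^ (-a - β) * φ y)) ≤
      (∫⁻ y in Ioi r, ENNReal.ofReal (y ^ (-a) * φ y)) +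
        ENNReal.ofReal (κ * x₀ ^ β * n / (1 + a) * x₀ ^ (-1 - a)) * mom (1 - β) φ := by
  have hφm := h.pos.meas
  have hqm : Measurable (fun x : ℝ => ENNReal.ofReal (x ^ (-a - 2))) := by fun_prop
  have hw := h.weak hW (q := (Ioi r).indicator fun x => ENNReal.ofReal (x ^ (-a - 2)))
    (hqm.indicator measurableSet_Ioi)
  have hL : ∫⁻ x, (Ioi r).indicator (fun x => ENNReal.ofReal (x ^ (-a - 2))) x *
      ENNReal.ofReal (x ^ 2 * φ x) = ∫⁻ y in Ioi r, ENNReal.ofReal (y ^ (-a) * φ y) := by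
    rw [← lintegral_indicator measurableSet_Ioi]
    refine lintegral_congr fun x => ?_
    by_cases hx : x ∈ Ioi r
    · have hx0 : 0 < x := hr.trans hx
      rw [indicator_of_mem hx, indicator_of_mem hx, ← ENNReal.ofReal_mul (by positivity),
        ← mul_assoc, ← rpow_natCast, ← rpow_add hx0]
      congr 3; push_cast; ring
    · rw [indicator_of_notMem hx, indicator_of_notMem hx, zero_mul]
  rw [hL] at hw
  set p : ℝ → ℝ≥0∞ := (Ioi r).indicator fun y => ENNReal.ofReal
    (κ / (1 + a) * (y ^ (-β) * (y ^ (-a) - y * x₀ ^ (-1 - a))) * φ y) with hp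
  have hpm : Measurable p := by
    refine Measurable.indicator ?_ measurableSet_Ioi
    fun_prop
  have h1 : ENNReal.ofReal (x₀ ^ β * n) * ∫⁻ y, p y ≤
      ∫⁻ y in Ioi r, ENNReal.ofReal (y ^ (-a) * φ y) := by
    rw [hw]
    have hz : ∫⁻ z, (Ioi x₀).indicator (fun z => ENNReal.ofReal (x₀ ^ β * φ z)) z =
        ENNReal.ofReal (x₀ ^ β) * TT φ x₀ := by
      rw [lintegral_indicator measurableSet_Ioi, TT, ← lintegral_const_mul _ (by fun_prop)]
      refine lintegral_congr fun z => ?_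
      rw [ENNReal.ofReal_mul (by positivity)]
    calc ENNReal.ofReal (x₀ ^ β * n) * ∫⁻ y, p y
        ≤ (ENNReal.ofReal (x₀ ^ β) * TT φ x₀) * ∫⁻ y, p y := by
          rw [ENNReal.ofReal_mul (by positivity)]; gcongr
      _ = ∫⁻ y, ∫⁻ z, p y * (Ioi x₀).indicator (fun z => ENNReal.ofReal (x₀ ^ β * φ z)) z := by
          rw [mul_comm, ← hz, ← lintegral_mul_const _ hpm]
          refine lintegral_congr fun y => ?_
          rw [lintegral_const_mul]
          exact Measurable.indicator (by fun_prop) measurableSet_Ioi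
      _ ≤ _ := by
          refine lintegral_mono fun y => lintegral_mono fun z => ?_
          dsimp only
          by_cases hy : y ∈ Ioi r
          swap
          · rw [hp, indicator_of_notMem hy, zero_mul]; exact zero_le
          by_cases hz : z ∈ Ioi x₀
          swap
          · rw [indicator_of_notMem hz, mul_zero]; exact zero_le
          have hy0 : 0 < y := hr.trans hy
          have hz0 : 0 < z := hx₀.trans hz
          have hzx : x₀ < z := hz
          have e : ∫⁻ x in Ioo y (y + z), (Ioi r).indicator
              (fun x => ENNReal.ofReal (x ^ (-a - 2))) x =
              ENNReal.ofReal ((y ^ (-1 - a) - (y + z) ^ (-1 - a)) / (1 + a)) := by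
            rw [← lint_pow_neg ha hy0 (by linarith)]
            refine setLIntegral_congr_fun measurableSet_Ioo fun x hx => ?_
            exact indicator_of_mem (show r < x from lt_trans hy hx.1) _
          have hφy := h.pos.nonneg y
          have hφz := h.pos.nonneg z
          have hKp := hK y z hy0 hz0
          have hK0 : 0 ≤ Kern ε W y z := le_trans (by positivity) hKp
          rw [e, hp, indicator_of_mem hy, indicator_of_mem hz, ← ENNReal.ofReal_mul' (by positivity),
            ← ENNReal.ofReal_mul (by positivity)]
          apply ENNReal.ofReal_le_ofReal
          have m1 : (y + z) ^ (-1 - a) ≤ x₀ ^ (-1 - a) :=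
            rpow_le_rpow_of_nonpos hx₀ (by linarith) (by linarith)
          have m1' : (y + z) ^ (-1 - a) ≤ y ^ (-1 - a) :=
            rpow_le_rpow_of_nonpos hy0 (by linarith) (by linarith)
          have m2 : x₀ ^ β ≤ z ^ β := rpow_le_rpow hx₀.le hzx.le hβ
          have m3 : y ^ (-a) = y * y ^ (-1 - a) := by
            nth_rewrite 2 [← rpow_one y]; rw [← rpow_add hy0]; congr 1; ring
          have hd : 0 ≤ (y ^ (-1 - a) - (y + z) ^ (-1 - a)) / (1 + a) := by
            apply div_nonneg <;> linarith
          calc κ / (1 + a) * (y ^ (-β) * (y ^ (-a) - y * x₀ ^ (-1 - a))) * φ y * (x₀ ^ β * φ z)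
              = (κ * (y ^ (-β) * x₀ ^ β)) * (y * (φ y * φ z)) *
                ((y ^ (-1 - a) - x₀ ^ (-1 - a)) / (1 + a)) := by rw [m3]; ring
            _ ≤ (κ * (y ^ (-β) * x₀ ^ β)) * (y * (φ y * φ z)) *
                ((y ^ (-1 - a) - (y + z) ^ (-1 - a)) / (1 + a)) := by gcongr
            _ ≤ (κ * (y ^ (-β) * z ^ β)) * (y * (φ y * φ z)) *
                ((y ^ (-1 - a) - (y + z) ^ (-1 - a)) / (1 + a)) := by gcongr
            _ ≤ Kern ε W y z * (y * (φ y * φ z)) *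
                ((y ^ (-1 - a) - (y + z) ^ (-1 - a)) / (1 + a)) := by gcongr
            _ = _ := by ring
  have h2 : ENNReal.ofReal (κ / (1 + a)) * (∫⁻ y in Ioi r, ENNReal.ofReal (y ^ (-a - β) * φ y)) ≤
      (∫⁻ y, p y) + ENNReal.ofReal (κ / (1 + a) * x₀ ^ (-1 - a)) * mom (1 - β) φ := by
    rw [mom, ← lintegral_const_mul _ (h.pos.meas_mom _), ← lintegral_const_mul _ (by fun_prop),
      ← lintegral_indicator measurableSet_Ioi]
    refine (lintegral_mono fun y => ?_).trans (lintegral_add_left hpm _).le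
    dsimp only
    by_cases hy : y ∈ Ioi r
    swap
    · rw [indicator_of_notMem hy]; exact zero_le
    have hy0 : 0 < y := hr.trans hy
    have hφy := h.pos.nonneg y
    rw [hp, indicator_of_mem hy, indicator_of_mem hy, ← ENNReal.ofReal_mul (by positivity),
      ← ENNReal.ofReal_mul (by positivity)]
    refine le_trans (ENNReal.ofReal_le_ofReal ?_) ENNReal.ofReal_add_le
    have e1 : y ^ (-a - β) = y ^ (-β) * y ^ (-a) := by rw [← rpow_add hy0]; congr 1; ring
    have e2 : y ^ (1 - β) = y ^ (-β) * y := by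
      nth_rewrite 3 [← rpow_one y]; rw [← rpow_add hy0]; congr 1; ring
    rw [e1, e2]
    apply le_of_eq; ring
  calc ENNReal.ofReal (κ * x₀ ^ β * n / (1 + a)) *
        (∫⁻ y in Ioi r, ENNReal.ofReal (y ^ (-a - β) * φ y))
      = ENNReal.ofReal (x₀ ^ β * n) * (ENNReal.ofReal (κ / (1 + a)) *
        (∫⁻ y in Ioi r, ENNReal.ofReal (y ^ (-a - β) * φ y))) := by
        rw [← mul_assoc, ← ENNReal.ofReal_mul (by positivity)]
        congr 2; ring
    _ ≤ ENNReal.ofReal (x₀ ^ β * n) * ((∫⁻ y, p y) +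
          ENNReal.ofReal (κ / (1 + a) * x₀ ^ (-1 - a)) * mom (1 - β) φ) := mul_le_mul_right h2 _
    _ ≤ _ := by
        rw [mul_add, ← mul_assoc, ← ENNReal.ofReal_mul (by positivity)]
        refine add_le_add h1 (le_of_eq ?_)
        congr 2; ring

lemma mom_sup {φ : ℝ → ℝ} (hφ : PosF φ) {s : ℝ} {B : ℝ≥0∞}
    (h : ∀ r > 0, ∫⁻ y in Ioi r, ENNReal.ofReal (y ^ s * φ y) ≤ B) : mom s φ ≤ B := by
  have e : mom s φ = ∫⁻ y in Ioi 0, ENNReal.ofReal (y ^ s * φ y) := by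
    rw [mom, ← lintegral_indicator measurableSet_Ioi]
    refine lintegral_congr fun x => ?_
    by_cases hx : x ∈ Ioi (0:ℝ)
    · rw [indicator_of_mem hx]
    · rw [indicator_of_notMem hx, hφ.zero x (not_lt.1 hx)]; simp
  have hU : Ioi (0:ℝ) = ⋃ n : ℕ, Ioi (1 / ((n:ℝ) + 1)) := by
    ext x; simp only [mem_Ioi, mem_iUnion]
    constructor
    · exact fun hx => exists_nat_one_div_lt hx
    · rintro ⟨n, hn⟩; exact lt_trans (by positivity) hn
  rw [e, hU, setLIntegral_iUnion_of_directed]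
  · exact iSup_le fun n => h _ (by positivity)
  · refine Monotone.directed_le fun m n hmn => Ioi_subset_Ioi ?_
    exact one_div_le_one_div_of_le (by positivity) (by simpa using hmn)

lemma neg_bound {α : ℝ} (hα : α ∈ Ioo (0:ℝ) 1) {a : ℝ} (ha : a ∈ Ioo (0:ℝ) 1) :
    ∃ C : ℝ≥0, ∃ ε₀ > (0:ℝ), ε₀ ≤ 1 ∧ ∀ (ε : ℝ) (W : ℝ → ℝ → ℝ) (φ : ℝ → ℝ), 0 ≤ ε → ε < ε₀ →
      GW α W → Prof α ε W φ → mom (-a) φ ≤ C := by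
  obtain ⟨ha0, ha1⟩ := ha
  obtain ⟨ε₀, h0, h1, H⟩ := Prof.close hα (η := (1 - a) / 8) (by linarith) ((1 - a) / 8) (by linarith)
  set x₀ := (1 - a) / 8 with hx₀
  have hx0 : 0 < x₀ := by rw [hx₀]; linarith
  set n := (3 + a) / 4 with hn
  set c := 2 * n / (1 + a) with hc
  have hc1 : 1 < c := by rw [hc, lt_div_iff₀ (by linarith), hn]; linarith
  refine ⟨(c * x₀ ^ (-1 - a) / (c - 1)).toNNReal, ε₀, h0, h1, fun ε W φ he he' hW h => ?_⟩
  refine mom_sup h.pos fun r hr => ?_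
  have hnT : ENNReal.ofReal n ≤ TT φ x₀ := by
    have := (H ε W φ he he' hW h).2
    have h2 := add_one_le_exp (-x₀)
    rw [NN] at this
    rw [← ENNReal.ofReal_toReal (h.TT_ne_top hW he x₀)]
    apply ENNReal.ofReal_le_ofReal
    rw [hn]; rw [hx₀] at h2 this ⊢; linarith
  have key := h.neg_mom hW (a := a) (β := 0) (κ := 2) (x₀ := x₀) (n := n) (r := r) ha0.le le_rfl
    (by norm_num) (fun y z hy hz => by
      have := mul_nonneg he (hW.nonneg y z)
      simp [Kern, this]) hx0 (by rw [hn]; linarith) hnT hr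
  simp only [rpow_zero, mul_one, sub_zero] at key
  rw [h.mass, mul_one, ← hc] at key
  set X := ∫⁻ y in Ioi r, ENNReal.ofReal (y ^ (-a) * φ y) with hX
  have hXf : X ≠ ∞ := by
    have : X ≤ ENNReal.ofReal (r ^ (-a)) * mom 0 φ := by
      rw [mom, ← lintegral_const_mul _ (h.pos.meas_mom _), hX, ← lintegral_indicator measurableSet_Ioi]
      refine lintegral_mono fun y => ?_
      by_cases hy : y ∈ Ioi r
      · have hy0 : 0 < y := hr.trans hy
        have hφy := h.pos.nonneg y
        rw [indicator_of_mem hy, ← ENNReal.ofReal_mul (by positivity), rpow_zero, one_mul]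
        apply ENNReal.ofReal_le_ofReal
        exact mul_le_mul_of_nonneg_right (rpow_le_rpow_of_nonpos hr (le_of_lt hy) (by linarith)) hφy
      · rw [indicator_of_notMem hy]; exact zero_le
    refine ne_top_of_le_ne_top (ENNReal.mul_ne_top ENNReal.ofReal_ne_top ?_) this
    exact ((h.mom0 hW he).trans_lt (by simp)).ne
  have hk := ENNReal.toReal_mono (ENNReal.add_ne_top.2 ⟨hXf, ENNReal.ofReal_ne_top⟩) key
  rw [ENNReal.toReal_mul, ENNReal.toReal_add hXf ENNReal.ofReal_ne_top,
    ENNReal.toReal_ofReal (by linarith), ENNReal.toReal_ofReal (by positivity)] at hk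
  rw [← ENNReal.ofReal_toReal hXf]
  apply ENNReal.ofReal_le_ofReal
  rw [le_div_iff₀ (by linarith)]
  linarith

lemma neg_bound2 {α : ℝ} (hα : α ∈ Ioo (0:ℝ) 1) {W : ℝ → ℝ → ℝ} (hW : GW α W)
    {cs : ℝ} (hcs : 0 < cs) (hlow : ∀ x y : ℝ, 0 < x → 0 < y → cs * (x ^ (-α) * y ^ α) ≤ W x y)
    {a : ℝ} (ha : a ∈ Ioo (0:ℝ) 1) :
    ∃ C : ℝ≥0, ∃ ε₀ > (0:ℝ), ε₀ ≤ 1 ∧ ∀ (ε : ℝ) (φ : ℝ → ℝ), 0 < ε → ε < ε₀ →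
      Prof α ε W φ → ENNReal.ofReal ε * mom (-a - α) φ ≤ C := by
  obtain ⟨C, ε₁, h0, h1, H⟩ := neg_bound hα ha
  obtain ⟨D, hD1, HD⟩ := mom_bound hα
  obtain ⟨ε₂, h02, h12, H2⟩ := Prof.close hα (η := 1 / 4) (by norm_num) (1 / 4) (by norm_num)
  set x₀ : ℝ := 1 / 4 with hx₀
  have hx0 : 0 < x₀ := by rw [hx₀]; norm_num
  set k := cs * x₀ ^ α * (1 / 2) / (1 + a) with hk
  have hk0 : 0 < k := by have := ha.1; positivity
  set E := (C : ℝ≥0∞) + ENNReal.ofReal (k * x₀ ^ (-1 - a)) * D with hE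
  have hEf : E ≠ ∞ := ENNReal.add_ne_top.2 ⟨ENNReal.coe_ne_top,
    ENNReal.mul_ne_top ENNReal.ofReal_ne_top ENNReal.coe_ne_top⟩
  have hk0' : ENNReal.ofReal k ≠ 0 := by simpa using hk0
  have hfin : E / ENNReal.ofReal k ≠ ∞ := ENNReal.div_ne_top hEf hk0'
  refine ⟨(E / ENNReal.ofReal k).toNNReal, min ε₁ ε₂, lt_min h0 h02, (min_le_left _ _).trans h1,
    fun ε φ he he' h => ?_⟩
  rw [ENNReal.coe_toNNReal hfin, ENNReal.le_div_iff_mul_le (Or.inl hk0') (Or.inl ENNReal.ofReal_ne_top)]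
  have e1 : ε < ε₁ := he'.trans_le (min_le_left _ _)
  have e2 : ε < ε₂ := he'.trans_le (min_le_right _ _)
  have he1 : ε ≤ 1 := e1.le.trans h1
  have hnT : ENNReal.ofReal (1 / 2) ≤ TT φ x₀ := by
    have := (H2 ε W φ he.le e2 hW h).2
    have h2 := add_one_le_exp (-x₀)
    rw [NN] at this
    rw [← ENNReal.ofReal_toReal (h.TT_ne_top hW he.le x₀)]
    apply ENNReal.ofReal_le_ofReal
    rw [hx₀] at h2 this ⊢; linarith
  have hmain : mom (-a - α) φ ≤ E / ENNReal.ofReal (ε * k) := by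
    refine mom_sup h.pos fun r hr => ?_
    rw [ENNReal.le_div_iff_mul_le (Or.inl (by simp; positivity)) (Or.inl ENNReal.ofReal_ne_top),
      mul_comm]
    have key := h.neg_mom hW (a := a) (β := α) (κ := ε * cs) (x₀ := x₀) (n := 1 / 2) (r := r)
      ha.1.le hα.1.le (by positivity) (fun y z hy hz => by
        have := mul_le_mul_of_nonneg_left (hlow y z hy hz) he.le
        rw [Kern]; linarith) hx0 (by norm_num) hnT hr
    have ek : ε * cs * x₀ ^ α * (1 / 2) / (1 + a) = ε * k := by rw [hk]; ring
    rw [ek] at key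
    refine key.trans (add_le_add ?_ ?_)
    · refine (setLIntegral_le_lintegral _ _).trans (H ε W φ he.le e1 hW h)
    · refine mul_le_mul' (ENNReal.ofReal_le_ofReal ?_)
        (HD W φ ε hW he.le he1 h _ (by linarith [hα.2]) (by linarith [hα.1]))
      rw [mul_assoc]
      exact mul_le_of_le_one_left (by positivity) he1
  rw [ENNReal.le_div_iff_mul_le (Or.inl (by simp; positivity)) (Or.inl ENNReal.ofReal_ne_top),
    ENNReal.ofReal_mul he.le] at hmain
  calc _ = mom (-a - α) φ * (ENNReal.ofReal ε * ENNReal.ofReal k) := by ring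
    _ ≤ _ := hmain

lemma neg_small {α : ℝ} (hα : α ∈ Ioo (0:ℝ) 1) {W : ℝ → ℝ → ℝ} (hW : GW α W)
    (hlow : 1 / 2 ≤ α → ∃ cs > (0:ℝ), ∀ x y : ℝ, 0 < x → 0 < y → cs * (x ^ (-α) * y ^ α) ≤ W x y)
    {δ : ℝ} (hδ : 0 < δ) :
    ∃ ε₀ > (0:ℝ), ε₀ ≤ 1 ∧ ∀ (ε : ℝ) (φ : ℝ → ℝ), 0 < ε → ε < ε₀ →
      Prof α ε W φ → ENNReal.ofReal ε * mom (-(2 * α)) φ ≤ ENNReal.ofReal δ := by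
  rcases lt_or_ge α (1 / 2) with hlt | hge
  · obtain ⟨C, ε₁, h0, h1, H⟩ := neg_bound hα (a := 2 * α) ⟨by linarith [hα.1], by linarith⟩
    refine ⟨min ε₁ (δ / (C + 1)), lt_min h0 (by positivity), (min_le_left _ _).trans h1,
      fun ε φ he he' h => ?_⟩
    have e1 : ε < ε₁ := he'.trans_le (min_le_left _ _)
    have e2 : ε < δ / (C + 1) := he'.trans_le (min_le_right _ _)
    refine (mul_le_mul_right (H ε W φ he.le e1 hW h) _).trans ?_
    rw [← ENNReal.ofReal_coe_nnreal, ← ENNReal.ofReal_mul he.le]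
    apply ENNReal.ofReal_le_ofReal
    rw [lt_div_iff₀ (by positivity)] at e2
    linarith
  · obtain ⟨cs, hcs, hl⟩ := hlow hge
    set a := (1 + α) / 2 with ha
    have haα : 0 < a - α := by rw [ha]; linarith [hα.2]
    obtain ⟨C, ε₁, h0, h1, H⟩ := neg_bound2 hα hW hcs hl (a := a)
      ⟨by rw [ha]; linarith [hα.1], by rw [ha]; linarith [hα.2]⟩
    set s : ℝ := (δ / (2 * (C + 1))) ^ (1 / (a - α)) with hs
    have hs0 : 0 < s := by positivity
    have hsp : s ^ (a - α) * C ≤ δ / 2 := by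
      rw [hs, ← rpow_mul (by positivity), one_div_mul_cancel haα.ne', rpow_one]
      rw [div_mul_eq_mul_div, div_le_div_iff₀ (by positivity) (by positivity)]
      nlinarith [hδ]
    refine ⟨min ε₁ (δ / 2 / s ^ (-(2 * α))), lt_min h0 (by positivity), (min_le_left _ _).trans h1,
      fun ε φ he he' h => ?_⟩
    have e1 : ε < ε₁ := he'.trans_le (min_le_left _ _)
    have e2 : ε < δ / 2 / s ^ (-(2 * α)) := he'.trans_le (min_le_right _ _)
    rw [lt_div_iff₀ (by positivity)] at e2
    have hm : mom (-(2 * α)) φ ≤ ENNReal.ofReal (s ^ (a - α)) * mom (-a - α) φ +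
        ENNReal.ofReal (s ^ (-(2 * α))) * mom 0 φ := by
      unfold mom
      rw [← lintegral_const_mul _ (h.pos.meas_mom _), ← lintegral_const_mul _ (h.pos.meas_mom _),
        ← lintegral_add_left ((h.pos.meas_mom _).const_mul _)]
      refine lintegral_mono fun x => ?_
      dsimp only
      rcases le_or_gt x 0 with hx | hx
      · simp [h.pos.zero x hx]
      have hφ := h.pos.nonneg x
      rw [← ENNReal.ofReal_mul (by positivity), ← ENNReal.ofReal_mul (by positivity),
        ← ENNReal.ofReal_add (by positivity) (by positivity)]
      apply ENNReal.ofReal_le_ofReal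
      rw [← mul_assoc, ← mul_assoc, ← add_mul]
      apply mul_le_mul_of_nonneg_right _ hφ
      rw [rpow_zero, mul_one]
      rcases le_total x s with hxs | hxs
      · have e : x ^ (-(2 * α)) = x ^ (a - α) * x ^ (-a - α) := by
          rw [← rpow_add hx]; congr 1; ring
        rw [e]
        have := rpow_le_rpow hx.le hxs haα.le
        have p := rpow_pos_of_pos hs0 (-(2 * α))
        have := mul_le_mul_of_nonneg_right this (rpow_nonneg hx.le (-a - α))
        linarith
      · have := rpow_le_rpow_of_nonpos hs0 hxs (z := -(2 * α)) (by linarith [hα.1])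
        have : 0 ≤ s ^ (a - α) * x ^ (-a - α) := by positivity
        linarith
    calc ENNReal.ofReal ε * mom (-(2 * α)) φ
        ≤ ENNReal.ofReal ε * (ENNReal.ofReal (s ^ (a - α)) * mom (-a - α) φ +
          ENNReal.ofReal (s ^ (-(2 * α))) * mom 0 φ) := mul_le_mul_right hm _
      _ = ENNReal.ofReal (s ^ (a - α)) * (ENNReal.ofReal ε * mom (-a - α) φ) +
          ENNReal.ofReal (ε * s ^ (-(2 * α))) * mom 0 φ := by
          rw [ENNReal.ofReal_mul he.le]; ring
      _ ≤ ENNReal.ofReal (s ^ (a - α)) * C + ENNReal.ofReal (ε * s ^ (-(2 * α))) * 1 := by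
          gcongr
          · exact H ε φ he e1 h
          · exact h.mom0 hW he.le
      _ = ENNReal.ofReal (s ^ (a - α) * C + ε * s ^ (-(2 * α))) := by
          rw [mul_one, ← ENNReal.ofReal_coe_nnreal, ← ENNReal.ofReal_mul (by positivity),
            ENNReal.ofReal_add (by positivity) (by positivity)]
      _ ≤ _ := ENNReal.ofReal_le_ofReal (by linarith)

end part8

section part9

lemma poly_exp_tendsto (c d e : ℝ) :
    Tendsto (fun x : ℝ => -(c * x ^ 2 + d * x + e) * exp (-x)) atTop (𝓝 0) := by
  have h2 := tendsto_pow_mul_exp_neg_atTop_nhds_zero 2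
  have h1 := tendsto_pow_mul_exp_neg_atTop_nhds_zero 1
  have h0 := tendsto_pow_mul_exp_neg_atTop_nhds_zero 0
  have := (((h2.const_mul c).add (h1.const_mul d)).add (h0.const_mul e)).neg
  simp only [mul_zero, add_zero, neg_zero] at this
  refine this.congr fun x => ?_
  simp only [pow_one, pow_zero]; ring

lemma poly_exp_deriv (c d e x : ℝ) :
    HasDerivAt (fun x : ℝ => -(c * x ^ 2 + d * x + e) * exp (-x))
      ((c * x ^ 2 + (d - 2 * c) * x + (e - d)) * exp (-x)) x := by
  have h1 : HasDerivAt (fun x : ℝ => -(c * x ^ 2 + d * x + e)) (-(c * (2 * x) + d)) x := by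
    have := ((((hasDerivAt_pow 2 x).const_mul c).add ((hasDerivAt_id x).const_mul d)).add_const e).neg
    refine this.congr_deriv ?_
    simp
  have h2 : HasDerivAt (fun x : ℝ => exp (-x)) (-exp (-x)) x := by
    have := (hasDerivAt_neg x).exp
    simpa using this
  refine (h1.mul h2).congr_deriv ?_
  ring

lemma int_w {t : ℝ} (ht : 0 ≤ t) :
    IntegrableOn (fun x : ℝ => (x + x ^ 2) * exp (-x)) (Ioi t) ∧
    ∫ x in Ioi t, (x + x ^ 2) * exp (-x) = (t ^ 2 + 3 * t + 3) * exp (-t) := by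
  have hd : ∀ x ∈ Ici t, HasDerivAt (fun x : ℝ => -(1 * x ^ 2 + 3 * x + 3) * exp (-x))
      ((x + x ^ 2) * exp (-x)) x := fun x _ => (poly_exp_deriv 1 3 3 x).congr_deriv (by ring)
  have hp : ∀ x ∈ Ioi t, 0 ≤ (x + x ^ 2) * exp (-x) := fun x hx => by
    have : 0 < x := lt_of_le_of_lt ht hx
    positivity
  refine ⟨integrableOn_Ioi_deriv_of_nonneg' hd hp (poly_exp_tendsto 1 3 3), ?_⟩
  rw [integral_Ioi_of_hasDerivAt_of_nonneg' hd hp (poly_exp_tendsto 1 3 3)]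
  ring

lemma int_w2 :
    IntegrableOn (fun x : ℝ => x ^ 2 * exp (-x)) (Ioi 0) ∧
    ∫ x in Ioi (0:ℝ), x ^ 2 * exp (-x) = 2 := by
  have hd : ∀ x ∈ Ici (0:ℝ), HasDerivAt (fun x : ℝ => -(1 * x ^ 2 + 2 * x + 2) * exp (-x))
      (x ^ 2 * exp (-x)) x := fun x _ => (poly_exp_deriv 1 2 2 x).congr_deriv (by ring)
  have hp : ∀ x ∈ Ioi (0:ℝ), 0 ≤ x ^ 2 * exp (-x) := fun x hx => by positivity
  refine ⟨integrableOn_Ioi_deriv_of_nonneg' hd hp (poly_exp_tendsto 1 2 2), ?_⟩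
  rw [integral_Ioi_of_hasDerivAt_of_nonneg' hd hp (poly_exp_tendsto 1 2 2)]
  simp

lemma lint_w {t : ℝ} (ht : 0 ≤ t) :
    ∫⁻ x in Ioi t, ENNReal.ofReal ((x + x ^ 2) * exp (-x)) =
      ENNReal.ofReal ((t ^ 2 + 3 * t + 3) * exp (-t)) := by
  rw [← (int_w ht).2, ofReal_integral_eq_lintegral_ofReal (int_w ht).1]
  refine (ae_restrict_iff' measurableSet_Ioi).2 (Eventually.of_forall fun x hx => ?_)
  have : 0 < x := lt_of_le_of_lt ht hx
  show 0 ≤ _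
  positivity

/-- Tonelli estimate for the variation of constants formula. -/
lemma ode_tonelli {V : ℝ → ℝ} (hV : Measurable V) :
    ∫⁻ x in Ioi 0, ENNReal.ofReal ((x + x ^ 2) * exp (-x)) *
      ∫⁻ t in uIoc 1 x, ENNReal.ofReal (exp t * |V t| / t ^ 3) ≤
    7 * ∫⁻ t in Ioi 0, ENNReal.ofReal ((1 + 1 / t) * |V t|) := by
  set k : ℝ → ℝ≥0∞ := fun t => ENNReal.ofReal (exp t * |V t| / t ^ 3) with hk
  set w : ℝ → ℝ≥0∞ := fun x => ENNReal.ofReal ((x + x ^ 2) * exp (-x)) with hw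
  have hVa : Measurable fun t => |V t| := continuous_abs.measurable.comp hV
  have hkm : Measurable k := by rw [hk]; fun_prop
  have hwm : Measurable w := by rw [hw]; fun_prop
  have hS : MeasurableSet {p : ℝ × ℝ | min 1 p.1 < p.2 ∧ p.2 ≤ max 1 p.1} :=
    MeasurableSet.inter (measurableSet_lt (f := fun p : ℝ × ℝ => min 1 p.1) (g := fun p => p.2)
      (by fun_prop) (by fun_prop))
      (measurableSet_le (f := fun p : ℝ × ℝ => p.2) (g := fun p => max 1 p.1)
      (by fun_prop) (by fun_prop))
  have hm : Measurable (fun p : ℝ × ℝ => w p.1 * (uIoc 1 p.1).indicator k p.2) := by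
    refine (hwm.comp measurable_fst).mul ?_
    have : (fun p : ℝ × ℝ => (uIoc 1 p.1).indicator k p.2) =
        {p : ℝ × ℝ | min 1 p.1 < p.2 ∧ p.2 ≤ max 1 p.1}.indicator (fun p => k p.2) := by
      ext p; simp [indicator, uIoc]
    rw [this]
    exact (hkm.comp measurable_snd).indicator hS
  calc ∫⁻ x in Ioi 0, w x * ∫⁻ t in uIoc 1 x, k t
      = ∫⁻ x in Ioi 0, ∫⁻ t, w x * (uIoc 1 x).indicator k t := by
        refine lintegral_congr fun x => ?_
        rw [lintegral_const_mul _ (hkm.indicator measurableSet_uIoc),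
          lintegral_indicator measurableSet_uIoc]
    _ = ∫⁻ t, ∫⁻ x in Ioi 0, w x * (uIoc 1 x).indicator k t :=
        lintegral_lintegral_swap hm.aemeasurable
    _ ≤ ∫⁻ t, (Ioi 0).indicator (fun t => 7 * ENNReal.ofReal ((1 + 1 / t) * |V t|)) t := by
        refine lintegral_mono fun t => ?_
        rcases le_or_gt t 0 with ht | ht
        · rw [indicator_of_notMem (by simpa using ht)]
          refine le_of_eq ?_
          rw [setLIntegral_congr_fun (g := fun _ => 0) measurableSet_Ioi, lintegral_zero]
          intro x hx
          dsimp only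
          rw [indicator_of_notMem, mul_zero]
          rw [uIoc]
          intro h
          have := h.1
          have : 0 < min 1 x := lt_min one_pos hx
          linarith
        rw [indicator_of_mem (show t ∈ Ioi 0 from ht), show (7:ℝ≥0∞) = ENNReal.ofReal 7 by simp,
          ← ENNReal.ofReal_mul (by norm_num)]
        have hVt := abs_nonneg (V t)
        rcases le_or_gt t 1 with h1 | h1
        · calc ∫⁻ x in Ioi 0, w x * (uIoc 1 x).indicator k t
              ≤ ∫⁻ x in Ioi 0, (Ioo 0 t).indicator (fun _ => ENNReal.ofReal (2 * t) * k t) x := by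
                refine setLIntegral_mono' measurableSet_Ioi fun x hx => ?_
                have hx0 : 0 < x := hx
                by_cases hxt : x < t
                · rw [indicator_of_mem (show x ∈ Ioo 0 t from ⟨hx, hxt⟩)]
                  refine mul_le_mul' (ENNReal.ofReal_le_ofReal ?_)
                    (indicator_le_self' (fun _ _ => zero_le) _)
                  have : exp (-x) ≤ 1 := exp_le_one_iff.2 (by linarith)
                  have : (x + x ^ 2) * exp (-x) ≤ (x + x ^ 2) * 1 := by gcongr
                  nlinarith
                · rw [indicator_of_notMem, mul_zero]; exact zero_le
                  rw [uIoc]; intro h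
                  have := h.1
                  rcases min_lt_iff.1 this with h | h <;> linarith
            _ = ENNReal.ofReal t * (ENNReal.ofReal (2 * t) * k t) := by
                rw [lintegral_indicator measurableSet_Ioo, lintegral_const,
                  Measure.restrict_restrict measurableSet_Ioo, Measure.restrict_apply_univ,
                  inter_eq_left.2 Ioo_subset_Ioi_self, Real.volume_Ioo, sub_zero, mul_comm]
            _ = ENNReal.ofReal (t * (2 * t * (exp t * |V t| / t ^ 3))) := by
                rw [← ENNReal.ofReal_mul (by positivity), ← ENNReal.ofReal_mul (by positivity)]
            _ ≤ _ := by
                apply ENNReal.ofReal_le_ofReal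
                have e : t * (2 * t * (exp t * |V t| / t ^ 3)) = 2 * exp t * (1 / t * |V t|) := by
                  field_simp
                rw [e]
                have : exp t ≤ 3 := by
                  have := exp_le_exp.2 h1
                  have := exp_one_lt_d9
                  linarith
                have p : 0 ≤ 1 / t * |V t| := by positivity
                nlinarith
        · calc ∫⁻ x in Ioi 0, w x * (uIoc 1 x).indicator k t
              ≤ ∫⁻ x in Ioi 0, (Ici t).indicator (fun x => w x * k t) x := by
                refine setLIntegral_mono' measurableSet_Ioi fun x hx => ?_
                by_cases hxt : t ≤ x
                · rw [indicator_of_mem (show x ∈ Ici t from hxt)]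
                  exact mul_le_mul_right (indicator_le_self' (fun _ _ => zero_le) _) _
                · rw [indicator_of_notMem, mul_zero]; exact zero_le
                  rw [uIoc]; intro h
                  have := h.2
                  rcases le_max_iff.1 this with h | h <;> linarith
            _ = (∫⁻ x in Ioi t, w x) * k t := by
                rw [lintegral_indicator measurableSet_Ici,
                  Measure.restrict_restrict measurableSet_Ici,
                  inter_eq_left.2 (show Ici t ⊆ Ioi 0 from fun x hx => lt_of_lt_of_le ht hx), lintegral_mul_const _ hwm,
                  restrict_Ioi_eq_restrict_Ici]
            _ = ENNReal.ofReal ((t ^ 2 + 3 * t + 3) * exp (-t) * (exp t * |V t| / t ^ 3)) := by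
                rw [lint_w ht.le, ← ENNReal.ofReal_mul (by positivity)]
            _ ≤ _ := by
                apply ENNReal.ofReal_le_ofReal
                have e : (t ^ 2 + 3 * t + 3) * exp (-t) * (exp t * |V t| / t ^ 3) =
                    (t ^ 2 + 3 * t + 3) / t ^ 2 * (1 / t * |V t|) := by
                  rw [exp_neg]; field_simp
                rw [e]
                have : (t ^ 2 + 3 * t + 3) / t ^ 2 ≤ 7 := by
                  rw [div_le_iff₀ (by positivity)]; nlinarith
                have p : 0 ≤ 1 / t * |V t| := by positivity
                nlinarith
    _ = _ := by
        rw [lintegral_indicator measurableSet_Ioi, lintegral_const_mul _ (by fun_prop)]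

lemma ode_abs {τ : ℝ → ℝ} (hτ : Continuous τ) (hi : IntegrableOn τ (Ioi 0))
    (h0 : ∫ x in Ioi (0:ℝ), τ x = 0) {V : ℝ → ℝ}
    (hV : ∀ x, V x = x * τ x - 2 * ∫ s in (0:ℝ)..x, exp (-(x - s)) * τ s) :
    ∫⁻ x in Ioi 0, ENNReal.ofReal ((1 + x) * |τ x|) ≤
      36 * ∫⁻ x in Ioi 0, ENNReal.ofReal ((1 + 1 / x) * |V x|) := by
  set Q : ℝ → ℝ := fun x => ∫ s in (0:ℝ)..x, exp s * τ s with hQ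
  have hc : Continuous fun s => exp s * τ s := by fun_prop
  have hQd : ∀ x, HasDerivAt Q (exp x * τ x) x := fun x =>
    intervalIntegral.integral_hasDerivAt_right (hc.intervalIntegrable _ _)
      (hc.stronglyMeasurableAtFilter _ _) hc.continuousAt
  have hQc : Continuous Q := continuous_iff_continuousAt.2 fun x => (hQd x).continuousAt
  have hq : ∀ x, ∫ s in (0:ℝ)..x, exp (-(x - s)) * τ s = exp (-x) * Q x := fun x => by
    rw [hQ, ← intervalIntegral.integral_const_mul]
    refine intervalIntegral.integral_congr fun s _ => ?_
    rw [show -(x - s) = -x + s by ring, exp_add]; ring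
  have hV' : V = fun x => x * τ x - 2 * (exp (-x) * Q x) := by
    ext x; rw [hV, hq]
  have hVc : Continuous V := by rw [hV']; fun_prop
  set Y : ℝ → ℝ := fun x => ∫ t in (1:ℝ)..x, exp t * V t / t ^ 3 with hY
  have hrep : ∀ x, 0 < x → Q x = x ^ 2 * (Q 1 + Y x) := fun x hx => by
    have hpos : ∀ t ∈ uIcc 1 x, 0 < t := fun t ht => by
      have := ht.1
      exact lt_of_lt_of_le (lt_min one_pos hx) this
    have hder : ∀ t ∈ uIcc 1 x, HasDerivAt (fun t => Q t / t ^ 2) (exp t * V t / t ^ 3) t :=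
      fun t ht => by
      have ht0 := hpos t ht
      refine ((hQd t).div (hasDerivAt_pow 2 t) (by positivity)).congr_deriv ?_
      rw [hV']
      simp only [exp_neg]
      have := (exp_pos t).ne'
      field_simp
      ring
    have := intervalIntegral.integral_eq_sub_of_hasDerivAt hder
      (ContinuousOn.intervalIntegrable (ContinuousOn.div (by fun_prop) (by fun_prop)
        fun t ht => by have := hpos t ht; positivity))
    rw [hY]; dsimp only
    rw [this]
    field_simp
    ring
  -- ∫ q = 0
  have hexp : IntegrableOn (fun x : ℝ => exp (-x)) (Ioi 0) := integrableOn_exp_neg_Ioi 0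
  have hconv : ∀ x, exp (-x) * Q x = ∫ s in (0:ℝ)..x, (ContinuousLinearMap.mul ℝ ℝ) (τ s)
      ((fun u : ℝ => exp (-u)) (x - s)) := fun x => by
    rw [← hq]
    refine intervalIntegral.integral_congr fun s _ => ?_
    simp [mul_comm]
  have hqi : IntegrableOn (fun x => exp (-x) * Q x) (Ioi 0) := by
    have := (integrable_posConvolution hi hexp (ContinuousLinearMap.mul ℝ ℝ)).integrableOn (s := Ioi 0)
    refine this.congr ((ae_restrict_iff' measurableSet_Ioi).2 (Eventually.of_forall fun x hx => ?_))
    simp only [hconv, posConvolution, indicator_of_mem hx]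
  have hq0 : ∫ x in Ioi (0:ℝ), exp (-x) * Q x = 0 := by
    simp_rw [hconv]
    rw [integral_posConvolution hi hexp, h0]; simp
  have hyi : ∀ x ∈ Ioi (0:ℝ), exp (-x) * Q x - Q 1 * (x ^ 2 * exp (-x)) = x ^ 2 * exp (-x) * Y x :=
    fun x hx => by rw [hrep x hx]; ring
  have hC : 2 * ENNReal.ofReal |Q 1| ≤ ∫⁻ x in Ioi 0, ENNReal.ofReal ((x + x ^ 2) * exp (-x)) *
      ENNReal.ofReal |Y x| := by
    have e : ∫ x in Ioi (0:ℝ), x ^ 2 * exp (-x) * Y x = -(Q 1 * 2) := by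
      rw [← setIntegral_congr_fun measurableSet_Ioi hyi, integral_sub hqi (int_w2.1.const_mul _),
        hq0, integral_const_mul, int_w2.2]; ring
    calc 2 * ENNReal.ofReal |Q 1| = ‖∫ x in Ioi (0:ℝ), x ^ 2 * exp (-x) * Y x‖ₑ := by
          rw [e, enorm_neg, ← ofReal_norm, norm_mul, Real.norm_eq_abs,
            ENNReal.ofReal_mul (abs_nonneg _), mul_comm]
          simp
      _ ≤ ∫⁻ x in Ioi (0:ℝ), ‖x ^ 2 * exp (-x) * Y x‖ₑ := enorm_integral_le_lintegral_enorm _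
      _ ≤ _ := by
          refine setLIntegral_mono' measurableSet_Ioi fun x hx => ?_
          have hx0 : 0 < x := hx
          rw [← ofReal_norm, norm_mul, Real.norm_of_nonneg (by positivity),
            Real.norm_eq_abs, ENNReal.ofReal_mul (by positivity)]
          gcongr
          linarith
  have hYb : ∀ x, 0 < x → ENNReal.ofReal |Y x| ≤
      ∫⁻ t in uIoc 1 x, ENNReal.ofReal (exp t * |V t| / t ^ 3) := fun x hx => by
    rw [← Real.norm_eq_abs, hY]
    dsimp only
    rw [intervalIntegral.norm_integral_eq_norm_integral_uIoc, ofReal_norm]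
    refine (enorm_integral_le_lintegral_enorm _).trans ?_
    refine setLIntegral_mono' measurableSet_uIoc fun t ht => ?_
    have ht0 : 0 < t := lt_trans (lt_min one_pos hx) ht.1
    rw [← ofReal_norm, norm_div, norm_mul, Real.norm_of_nonneg (exp_pos t).le,
      Real.norm_eq_abs, Real.norm_of_nonneg (show 0 ≤ t ^ 3 by positivity)]
  set Z := ∫⁻ x in Ioi 0, ENNReal.ofReal ((x + x ^ 2) * exp (-x)) *
    ∫⁻ t in uIoc 1 x, ENNReal.ofReal (exp t * |V t| / t ^ 3) with hZ
  set v := ∫⁻ x in Ioi 0, ENNReal.ofReal ((1 + 1 / x) * |V x|) with hv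
  have hZv : Z ≤ 7 * v := ode_tonelli hVc.measurable
  have hCZ : 2 * ENNReal.ofReal |Q 1| ≤ Z :=
    hC.trans (setLIntegral_mono' measurableSet_Ioi fun x hx => mul_le_mul_right (hYb x hx) _)
  have hwm : Measurable fun x : ℝ => ENNReal.ofReal ((x + x ^ 2) * exp (-x)) := by fun_prop
  have hvm : Measurable fun x : ℝ => ENNReal.ofReal ((1 + 1 / x) * |V x|) := by
    have := hVc.abs.measurable
    fun_prop
  calc ∫⁻ x in Ioi 0, ENNReal.ofReal ((1 + x) * |τ x|)
      ≤ ∫⁻ x in Ioi 0, (ENNReal.ofReal ((1 + 1 / x) * |V x|) +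
          (2 * ENNReal.ofReal |Q 1| * ENNReal.ofReal ((x + x ^ 2) * exp (-x)) +
          2 * (ENNReal.ofReal ((x + x ^ 2) * exp (-x)) *
            ∫⁻ t in uIoc 1 x, ENNReal.ofReal (exp t * |V t| / t ^ 3)))) := by
        refine setLIntegral_mono' measurableSet_Ioi fun x hx => ?_
        have hx0 : 0 < x := hx
        have e : x * τ x = V x + 2 * (exp (-x) * Q x) := by rw [hV']; ring
        have e2 : (1 + x) * |τ x| ≤ (1 + 1 / x) * |V x| +
            (2 * |Q 1| * ((x + x ^ 2) * exp (-x)) + 2 * ((x + x ^ 2) * exp (-x) * |Y x|)) := by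
          have a1 : x * |τ x| ≤ |V x| + 2 * (exp (-x) * (x ^ 2 * (|Q 1| + |Y x|))) := by
            rw [← abs_of_pos hx0, ← abs_mul, abs_of_pos hx0, e, hrep x hx0]
            refine (abs_add_le _ _).trans ?_
            rw [abs_mul, abs_mul, abs_mul, abs_of_pos (exp_pos _), abs_of_pos (pow_pos hx0 2),
              abs_two]
            gcongr
            exact abs_add_le _ _
          have a2 : (1 + x) * |τ x| = (1 + 1 / x) * (x * |τ x|) := by field_simp; ring
          rw [a2]
          refine (mul_le_mul_of_nonneg_left a1 (by positivity)).trans (le_of_eq ?_)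
          field_simp
          ring
        refine (ENNReal.ofReal_le_ofReal e2).trans ?_
        rw [ENNReal.ofReal_add (by positivity) (by positivity),
          ENNReal.ofReal_add (by positivity) (by positivity),
          ENNReal.ofReal_mul (p := 2 * |Q 1|) (by positivity),
          ENNReal.ofReal_mul (p := 2) (q := |Q 1|) (by positivity),
          ENNReal.ofReal_mul (p := 2) (q := (x + x ^ 2) * exp (-x) * |Y x|) (by positivity),
          ENNReal.ofReal_mul (p := (x + x ^ 2) * exp (-x)) (by positivity)]
        have h2 : ENNReal.ofReal 2 = 2 := by simp
        rw [h2]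
        gcongr
        exact hYb x hx0
    _ = v + (2 * ENNReal.ofReal |Q 1| * ENNReal.ofReal 3 + 2 * Z) := by
        rw [lintegral_add_left hvm, lintegral_add_left (hwm.const_mul _),
          lintegral_const_mul _ hwm, lintegral_const_mul' _ _ (by simp), lint_w le_rfl,
          show ((0:ℝ) ^ 2 + 3 * 0 + 3) * exp (-0) = 3 by simp]
    _ ≤ v + (Z * ENNReal.ofReal 3 + 2 * Z) := by gcongr
    _ = v + 5 * Z := by
        rw [show ENNReal.ofReal 3 = 3 by simp]; ring
    _ ≤ v + 5 * (7 * v) := by gcongr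
    _ = 36 * v := by ring

end part9

section part10

/-- absolute difference and sum of two densities -/
noncomputable def gg (φ₁ φ₂ : ℝ → ℝ) (x : ℝ) : ℝ := |φ₁ x - φ₂ x|
noncomputable def ff (φ₁ φ₂ : ℝ → ℝ) (x : ℝ) : ℝ := φ₁ x + φ₂ x
noncomputable def tt (φ₁ φ₂ : ℝ → ℝ) (x : ℝ) : ℝ := NN φ₁ x - NN φ₂ x
noncomputable def Ta (φ₁ φ₂ : ℝ → ℝ) (x : ℝ) : ℝ := if 0 < x then |tt φ₁ φ₂ x| else 0

structure Pair (α ε : ℝ) (W : ℝ → ℝ → ℝ) (φ₁ φ₂ : ℝ → ℝ) (C : ℝ≥0) (θ : ℝ) : Prop where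
  hα : α ∈ Ioo (0:ℝ) 1
  hW : GW α W
  hε : 0 < ε
  hε1 : ε ≤ 1
  p1 : Prof α ε W φ₁
  p2 : Prof α ε W φ₂
  hC : 1 ≤ C
  m1 : ∀ s, -α ≤ s → s ≤ 2 → mom s φ₁ ≤ C
  m2 : ∀ s, -α ≤ s → s ≤ 2 → mom s φ₂ ≤ C
  hθ : 0 < θ
  hθ1 : θ ≤ 1
  n1 : ∫ x in Ioi (0:ℝ), |NN φ₁ x - exp (-x)| < θ ^ 2
  n2 : ∫ x in Ioi (0:ℝ), |NN φ₂ x - exp (-x)| < θ ^ 2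
  hεθ : ε ≤ θ
  s1 : ENNReal.ofReal ε * mom (-(2 * α)) φ₁ ≤ ENNReal.ofReal θ
  s2 : ENNReal.ofReal ε * mom (-(2 * α)) φ₂ ≤ ENNReal.ofReal θ
  l1 : ENNReal.ofReal (1 - θ) ≤ mom 0 φ₁
  l2 : ENNReal.ofReal (1 - θ) ≤ mom 0 φ₂

noncomputable def nrm (α : ℝ) (φ₁ φ₂ : ℝ → ℝ) : ℝ≥0∞ :=
  mom (-α) (gg φ₁ φ₂) + mom 2 (gg φ₁ φ₂)

section
variable {α ε θ : ℝ} {W : ℝ → ℝ → ℝ} {φ₁ φ₂ : ℝ → ℝ} {C : ℝ≥0}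

lemma gg_symm : gg φ₁ φ₂ = gg φ₂ φ₁ := by
  ext x; unfold gg; rw [_root_.abs_sub_comm]

lemma ff_symm : ff φ₁ φ₂ = ff φ₂ φ₁ := by
  ext x; unfold ff; rw [add_comm]

lemma Ta_symm : Ta φ₁ φ₂ = Ta φ₂ φ₁ := by
  ext x; unfold Ta tt; rw [_root_.abs_sub_comm]

lemma nrm_symm : nrm α φ₁ φ₂ = nrm α φ₂ φ₁ := by unfold nrm; rw [gg_symm]

lemma Pair.symm (h : Pair α ε W φ₁ φ₂ C θ) : Pair α ε W φ₂ φ₁ C θ :=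
  ⟨h.hα, h.hW, h.hε, h.hε1, h.p2, h.p1, h.hC, h.m2, h.m1, h.hθ, h.hθ1, h.n2, h.n1, h.hεθ, h.s2,
    h.s1, h.l2, h.l1⟩

lemma Pair.gpos (h : Pair α ε W φ₁ φ₂ C θ) : PosF (gg φ₁ φ₂) := h.p1.pos.abs_sub h.p2.pos
lemma Pair.fpos (h : Pair α ε W φ₁ φ₂ C θ) : PosF (ff φ₁ φ₂) := h.p1.pos.add h.p2.pos

lemma Pair.g_mom (h : Pair α ε W φ₁ φ₂ C θ) {s : ℝ} (h1 : -α ≤ s) (h2 : s ≤ 2) :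
    mom s (gg φ₁ φ₂) ≤ nrm α φ₁ φ₂ := mom_interp h.gpos h1 h2

lemma Pair.f_mom (h : Pair α ε W φ₁ φ₂ C θ) {s : ℝ} (h1 : -α ≤ s) (h2 : s ≤ 2) :
    mom s (ff φ₁ φ₂) ≤ 2 * C := by
  have := mom_add h.p1.pos h.p2.pos s
  change mom s (ff φ₁ φ₂) = _ at this
  rw [this, two_mul]
  exact add_le_add (h.m1 s h1 h2) (h.m2 s h1 h2)

lemma Pair.nrm_lt (h : Pair α ε W φ₁ φ₂ C θ) : nrm α φ₁ φ₂ < ∞ := by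
  have a := h.hα.1
  have k : ∀ s, -α ≤ s → s ≤ 2 → mom s (gg φ₁ φ₂) < ∞ := fun s h1 h2 => by
    refine (mom_abs_sub_le h.p1.pos h.p2.pos s).trans_lt ?_
    exact ENNReal.add_lt_top.2 ⟨(h.m1 s h1 h2).trans_lt ENNReal.coe_lt_top,
      (h.m2 s h1 h2).trans_lt ENNReal.coe_lt_top⟩
  exact ENNReal.add_lt_top.2 ⟨k _ le_rfl (by linarith), k _ (by linarith) le_rfl⟩

lemma NN_cont {φ : ℝ → ℝ} (hφ : PosF φ) (h0 : mom 0 φ ≠ ∞) : Continuous (NN φ) := by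
  rw [mom_zero] at h0
  have hi : Integrable φ := ⟨hφ.meas.aestronglyMeasurable, by
    rw [hasFiniteIntegral_iff_ofReal (Eventually.of_forall hφ.nonneg)]; exact h0.lt_top⟩
  have e : ∀ x, NN φ x = (∫ t in Ioi 0, φ t) - ∫ t in (0:ℝ)..x, φ t := fun x => by
    rw [← intervalIntegral.integral_Ioi_sub_Ioi' hi.integrableOn hi.integrableOn]
    · rw [sub_sub_cancel, NN, TT, integral_eq_lintegral_of_nonneg_ae
        (Eventually.of_forall hφ.nonneg) hφ.meas.aestronglyMeasurable]
  have : NN φ = fun x => (∫ t in Ioi 0, φ t) - ∫ t in (0:ℝ)..x, φ t := funext e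
  rw [this]
  exact continuous_const.sub (intervalIntegral.continuous_primitive
    (fun a b => hi.intervalIntegrable) 0)

lemma TT_le_add_gg (hp1 : PosF φ₁) (hp2 : PosF φ₂) (x : ℝ) :
    TT φ₁ x ≤ TT φ₂ x + TT (gg φ₁ φ₂) x := by
  unfold TT
  have := hp2.meas
  rw [← lintegral_add_left (by fun_prop)]
  refine lintegral_mono fun t => ?_
  unfold gg
  rw [← ENNReal.ofReal_add (hp2.nonneg t) (abs_nonneg _)]
  apply ENNReal.ofReal_le_ofReal
  have := le_abs_self (φ₁ t - φ₂ t)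
  linarith

lemma Pair.tt_le (h : Pair α ε W φ₁ φ₂ C θ) (x : ℝ) :
    ENNReal.ofReal |tt φ₁ φ₂ x| ≤ TT (gg φ₁ φ₂) x := by
  have f1 := h.p1.TT_ne_top h.hW h.hε.le x
  have f2 := h.p2.TT_ne_top h.hW h.hε.le x
  have e1 := TT_le_add_gg h.p1.pos h.p2.pos x
  have e2 := TT_le_add_gg h.p2.pos h.p1.pos x
  rw [gg_symm] at e2
  rcases eq_or_ne (TT (gg φ₁ φ₂) x) ∞ with hx | hx
  · rw [hx]; exact le_top
  rw [ENNReal.ofReal_le_iff_le_toReal hx]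
  have i1 := ENNReal.toReal_mono (ENNReal.add_ne_top.2 ⟨f2, hx⟩) e1
  have i2 := ENNReal.toReal_mono (ENNReal.add_ne_top.2 ⟨f1, hx⟩) e2
  rw [ENNReal.toReal_add f2 hx] at i1
  rw [ENNReal.toReal_add f1 hx] at i2
  unfold tt NN
  rw [abs_le]; constructor <;> linarith

lemma Pair.tt_cont (h : Pair α ε W φ₁ φ₂ C θ) : Continuous (tt φ₁ φ₂) := by
  have a := h.hα.1
  exact (NN_cont h.p1.pos ((h.m1 0 (by linarith) (by norm_num)).trans_lt ENNReal.coe_lt_top).ne).sub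
    (NN_cont h.p2.pos ((h.m2 0 (by linarith) (by norm_num)).trans_lt ENNReal.coe_lt_top).ne)

lemma Pair.tpos (h : Pair α ε W φ₁ φ₂ C θ) : PosF (Ta φ₁ φ₂) := by
  refine ⟨?_, fun x => ?_, fun x hx => ?_⟩
  · exact Measurable.ite measurableSet_Ioi h.tt_cont.abs.measurable measurable_const
  · unfold Ta; split_ifs <;> simp
  · unfold Ta; rw [if_neg (not_lt.2 hx)]

lemma Pair.t_mom0 (h : Pair α ε W φ₁ φ₂ C θ) :
    ∫⁻ x in Ioi 0, ENNReal.ofReal |tt φ₁ φ₂ x| ≤ mom 1 (gg φ₁ φ₂) := by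
  rw [← lint_TT_one h.gpos]
  exact lintegral_mono fun x => h.tt_le x

/-- convolution Tonelli -/
lemma lconv {a b : ℝ → ℝ≥0∞} (ha : Measurable a) (hb : Measurable b) :
    ∫⁻ x in Ioi (0:ℝ), ∫⁻ s in Ioo 0 x, a (x - s) * b s =
      (∫⁻ x in Ioi (0:ℝ), a x) * ∫⁻ x in Ioi (0:ℝ), b x := by
  have e1 : ∀ x ∈ Ioi (0:ℝ), ∫⁻ s in Ioo 0 x, a (x - s) * b s =
      ∫⁻ s, (Ioi (0:ℝ)).indicator a (x - s) * (Ioi (0:ℝ)).indicator b s := fun x hx => by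
    rw [← lintegral_indicator measurableSet_Ioo]
    refine lintegral_congr fun s => ?_
    by_cases h1 : 0 < s <;> by_cases h2 : s < x <;> simp [indicator, h1, h2]
  have e2 : ∫⁻ x in Ioi (0:ℝ), ∫⁻ s in Ioo 0 x, a (x - s) * b s =
      ∫⁻ x, ∫⁻ s, (Ioi (0:ℝ)).indicator a (x - s) * (Ioi (0:ℝ)).indicator b s := by
    rw [setLIntegral_congr_fun measurableSet_Ioi e1, ← lintegral_indicator measurableSet_Ioi]
    refine lintegral_congr fun x => ?_
    by_cases hx : 0 < x
    · simp [hx]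
    · simp only [indicator, mem_Ioi, hx, if_false]
      symm
      rw [lintegral_eq_zero_iff']
      · refine Eventually.of_forall fun s => ?_
        by_cases h1 : 0 < s
        · have : ¬ s < x := by linarith
          simp [this]
        · simp [h1]
      · have h1 := ha.indicator measurableSet_Ioi (s := Ioi (0:ℝ))
        have h2 := hb.indicator measurableSet_Ioi (s := Ioi (0:ℝ))
        exact ((h1.comp (by fun_prop : Measurable fun s => x - s)).mul h2).aemeasurable
  have h1 := ha.indicator measurableSet_Ioi (s := Ioi (0:ℝ))
  have h2 := hb.indicator measurableSet_Ioi (s := Ioi (0:ℝ))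
  rw [e2, lintegral_lintegral_swap (((h1.comp (f := fun p : ℝ × ℝ => p.1 - p.2)
    (by fun_prop)).mul (h2.comp measurable_snd)).aemeasurable)]
  have e3 : ∀ s, ∫⁻ x, (Ioi (0:ℝ)).indicator a (x - s) * (Ioi (0:ℝ)).indicator b s =
      (∫⁻ x in Ioi (0:ℝ), a x) * (Ioi (0:ℝ)).indicator b s := fun s => by
    have h3 : Measurable (fun x => (Ioi (0:ℝ)).indicator a (x - s)) :=
      h1.comp (by fun_prop : Measurable fun x => x - s)
    rw [lintegral_mul_const _ h3,
      lintegral_sub_right_eq_self (fun x => (Ioi (0:ℝ)).indicator a x) s,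
      lintegral_indicator measurableSet_Ioi]
  simp_rw [e3]
  rw [lintegral_const_mul _ h2, lintegral_indicator measurableSet_Ioi]
end

end part10

section part11

section
variable {α ε θ : ℝ} {W : ℝ → ℝ → ℝ} {φ₁ φ₂ : ℝ → ℝ} {C : ℝ≥0}

lemma prod_le_gg (h : Pair α ε W φ₁ φ₂ C θ) (y z : ℝ) :
    φ₁ y * φ₁ z ≤ φ₂ y * φ₂ z + (gg φ₁ φ₂ y * ff φ₁ φ₂ z + ff φ₁ φ₂ y * gg φ₁ φ₂ z) := by
  have a1 := h.p1.pos.nonneg y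
  have a2 := h.p1.pos.nonneg z
  have b1 := h.p2.pos.nonneg y
  have b2 := h.p2.pos.nonneg z
  unfold gg ff
  have c1 := le_abs_self (φ₁ y - φ₂ y)
  have c2 := le_abs_self (φ₁ z - φ₂ z)
  have d1 := abs_nonneg (φ₁ y - φ₂ y)
  have d2 := abs_nonneg (φ₁ z - φ₂ z)
  nlinarith [mul_nonneg a2 (sub_nonneg.2 c1), mul_nonneg b1 (sub_nonneg.2 c2), mul_nonneg d1 b2,
    mul_nonneg a1 d2]

lemma Pair.DD_diff (h : Pair α ε W φ₁ φ₂ C θ) (x : ℝ) :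
    DD W φ₁ φ₁ x ≤ DD W φ₂ φ₂ x + (DD W (gg φ₁ φ₂) (ff φ₁ φ₂) x + DD W (ff φ₁ φ₂) (gg φ₁ φ₂) x) := by
  have hWm := h.hW.meas' measurable_fst measurable_snd
  have mk : ∀ u v : ℝ → ℝ, Measurable u → Measurable v → Measurable (fun p : ℝ × ℝ =>
      ENNReal.ofReal (W p.1 p.2 * (u p.1 * v p.2)) * ENNReal.ofReal (ell x p.1 p.2)) :=
    fun u v hu hv => by
      have hl : Measurable (fun p : ℝ × ℝ => ell x p.1 p.2) :=
        ell_meas (by fun_prop) (by fun_prop) (by fun_prop)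
      fun_prop
  have g1 := h.gpos.meas
  have f1 := h.fpos.meas
  have q2 := h.p2.pos.meas
  unfold DD
  rw [← dbl_add (mk _ _ g1 f1), ← dbl_add (mk _ _ q2 q2)]
  refine lintegral_mono fun y => lintegral_mono fun z => ?_
  dsimp only
  rw [← add_mul, ← add_mul]
  gcongr
  have w := h.hW.nonneg y z
  have b1 := h.p2.pos.nonneg y
  have b2 := h.p2.pos.nonneg z
  have c1 := h.gpos.nonneg y
  have c2 := h.gpos.nonneg z
  have d1 := h.fpos.nonneg y
  have d2 := h.fpos.nonneg z
  rw [← ENNReal.ofReal_add (by positivity) (by positivity),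
    ← ENNReal.ofReal_add (by positivity) (by positivity)]
  apply ENNReal.ofReal_le_ofReal
  have := mul_le_mul_of_nonneg_left (prod_le_gg h y z) w
  linarith

lemma Pair.DD_ne (h : Pair α ε W φ₁ φ₂ C θ) {x : ℝ} (hx : 0 < x) : DD W φ₁ φ₁ x ≠ ∞ := by
  refine ne_top_of_le_ne_top ?_ (DD_le h.hW h.p1.pos h.p1.pos hx.le)
  have := h.hα.1
  have := h.hα.2
  have a1 := ((h.m1 α (by linarith) (by linarith)).trans_lt ENNReal.coe_lt_top).ne
  have a2 := ((h.m1 (1 - α) (by linarith) (by linarith)).trans_lt ENNReal.coe_lt_top).ne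
  exact ENNReal.add_ne_top.2 ⟨ENNReal.mul_ne_top a1 a2, ENNReal.mul_ne_top a2 a1⟩

lemma Pair.UR_diff (h : Pair α ε W φ₁ φ₂ C θ) {x : ℝ} (hx : 0 < x) :
    ENNReal.ofReal |UR W φ₁ x - UR W φ₂ x| ≤
      DD W (gg φ₁ φ₂) (ff φ₁ φ₂) x + DD W (ff φ₁ φ₂) (gg φ₁ φ₂) x := by
  have e1 := h.DD_diff x
  have e2 := h.symm.DD_diff x
  rw [gg_symm, ff_symm] at e2
  have f1 := h.DD_ne hx
  have f2 := h.symm.DD_ne hx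
  generalize DD W (gg φ₁ φ₂) (ff φ₁ φ₂) x + DD W (ff φ₁ φ₂) (gg φ₁ φ₂) x = S at *
  rcases eq_or_ne S ∞ with hS | hS
  · rw [hS]; exact le_top
  rw [ENNReal.ofReal_le_iff_le_toReal hS]
  have i1 := ENNReal.toReal_mono (ENNReal.add_ne_top.2 ⟨f2, hS⟩) e1
  have i2 := ENNReal.toReal_mono (ENNReal.add_ne_top.2 ⟨f1, hS⟩) e2
  rw [ENNReal.toReal_add f2 hS] at i1
  rw [ENNReal.toReal_add f1 hS] at i2
  unfold UR
  rw [abs_le]; constructor <;> linarith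

lemma Pair.tt_eq (h : Pair α ε W φ₁ φ₂ C θ) {x : ℝ} (hx : 0 < x) :
    x * tt φ₁ φ₂ x = (∫ s in (0:ℝ)..x, (NN φ₁ (x - s) + NN φ₂ (x - s)) * tt φ₁ φ₂ s) +
      ε / 2 * (UR W φ₁ x - UR W φ₂ x) := by
  have a := h.hα.1
  have c1 := NN_cont h.p1.pos
    ((h.m1 0 (by linarith) (by norm_num)).trans_lt ENNReal.coe_lt_top).ne
  have c2 := NN_cont h.p2.pos
    ((h.m2 0 (by linarith) (by norm_num)).trans_lt ENNReal.coe_lt_top).ne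
  have e1 := h.p1.tail_real h.hα h.hW h.hε.le hx
  have e2 := h.p2.tail_real h.hα h.hW h.hε.le hx
  have r := intervalIntegral.integral_comp_sub_left (a := 0) (b := x)
    (fun s => (NN φ₁ (x - s) + NN φ₂ (x - s)) * tt φ₁ φ₂ s) x
  simp only [sub_zero, sub_self, sub_sub_cancel] at r
  have ct := h.tt_cont
  have i1 : (∫ s in (0:ℝ)..x, NN φ₁ s * NN φ₁ (x - s)) - (∫ s in (0:ℝ)..x, NN φ₂ s * NN φ₂ (x - s))
      = 1 / 2 * ((∫ s in (0:ℝ)..x, (NN φ₁ (x - s) + NN φ₂ (x - s)) * tt φ₁ φ₂ s) +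
        ∫ s in (0:ℝ)..x, (NN φ₁ s + NN φ₂ s) * tt φ₁ φ₂ (x - s)) := by
    rw [← intervalIntegral.integral_sub, ← intervalIntegral.integral_add,
      ← intervalIntegral.integral_const_mul]
    · refine intervalIntegral.integral_congr fun s _ => ?_
      simp only [tt]; ring
    all_goals exact Continuous.intervalIntegrable (by fun_prop) _ _
  rw [r] at i1
  unfold tt at *
  linarith

lemma Pair.n_int (h : Pair α ε W φ₁ φ₂ C θ) :
    ∫⁻ x in Ioi (0:ℝ), ENNReal.ofReal |NN φ₁ x + NN φ₂ x - 2 * exp (-x)| ≤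
      ENNReal.ofReal (2 * θ ^ 2) := by
  have t1 := h.p1.tl h.hW h.hε.le
  have t2 := h.p2.tl h.hW h.hε.le
  have he : IntegrableOn (fun x : ℝ => exp (-x)) (Ioi 0) := by
    have := integrableOn_exp_mul_Ioi (a := -1) (by norm_num) 0
    simpa using this
  have i1 := (t1.int.sub he).abs
  have i2 := (t2.int.sub he).abs
  have e := ofReal_integral_eq_lintegral_ofReal (i1.add i2)
    (Eventually.of_forall fun x => add_nonneg (abs_nonneg _) (abs_nonneg _))
  refine le_trans (lintegral_mono (g := fun x => ENNReal.ofReal (((fun x => |(NN φ₁ - fun x => exp (-x)) x|)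
    + fun x => |(NN φ₂ - fun x => exp (-x)) x|) x)) fun x => ?_) ?_
  · apply ENNReal.ofReal_le_ofReal
    simp only [Pi.add_apply, Pi.sub_apply]
    have : NN φ₁ x + NN φ₂ x - 2 * exp (-x) = (NN φ₁ x - exp (-x)) + (NN φ₂ x - exp (-x)) := by ring
    rw [this]
    exact abs_add_le _ _
  · rw [← e]
    apply ENNReal.ofReal_le_ofReal
    simp only [Pi.sub_apply] at i1 i2
    simp only [Pi.add_apply, Pi.sub_apply]
    rw [integral_add i1 i2]
    have := h.n1
    have := h.n2
    linarith

lemma Pair.V_le (h : Pair α ε W φ₁ φ₂ C θ) {x : ℝ} (hx : 0 < x) :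
    ENNReal.ofReal |x * tt φ₁ φ₂ x - 2 * ∫ s in (0:ℝ)..x, exp (-(x - s)) * tt φ₁ φ₂ s| ≤
      (∫⁻ s in Ioo 0 x, ENNReal.ofReal |NN φ₁ (x - s) + NN φ₂ (x - s) - 2 * exp (-(x - s))| *
        ENNReal.ofReal |tt φ₁ φ₂ s|) + ENNReal.ofReal ε *
      (DD W (gg φ₁ φ₂) (ff φ₁ φ₂) x + DD W (ff φ₁ φ₂) (gg φ₁ φ₂) x) := by
  have a := h.hα.1
  have c1 := NN_cont h.p1.pos
    ((h.m1 0 (by linarith) (by norm_num)).trans_lt ENNReal.coe_lt_top).ne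
  have c2 := NN_cont h.p2.pos
    ((h.m2 0 (by linarith) (by norm_num)).trans_lt ENNReal.coe_lt_top).ne
  have ct := h.tt_cont
  have e : x * tt φ₁ φ₂ x - 2 * ∫ s in (0:ℝ)..x, exp (-(x - s)) * tt φ₁ φ₂ s =
      (∫ s in (0:ℝ)..x, (NN φ₁ (x - s) + NN φ₂ (x - s) - 2 * exp (-(x - s))) * tt φ₁ φ₂ s) +
      ε / 2 * (UR W φ₁ x - UR W φ₂ x) := by
    rw [h.tt_eq hx, ← intervalIntegral.integral_const_mul, add_sub_right_comm,
      ← intervalIntegral.integral_sub]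
    · congr 1
      refine intervalIntegral.integral_congr fun s _ => ?_
      ring
    all_goals exact Continuous.intervalIntegrable (by fun_prop) _ _
  rw [e]
  refine (ENNReal.ofReal_le_ofReal (abs_add_le _ _)).trans ?_
  rw [ENNReal.ofReal_add (abs_nonneg _) (abs_nonneg _)]
  refine add_le_add ?_ ?_
  · rw [intervalIntegral.integral_of_le hx.le, integral_Ioc_eq_integral_Ioo, ← Real.norm_eq_abs,
      ofReal_norm]
    refine (enorm_integral_le_lintegral_enorm _).trans (lintegral_mono fun s => ?_)
    rw [← ofReal_norm, Real.norm_eq_abs, abs_mul, ENNReal.ofReal_mul (abs_nonneg _)]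
  · have := h.hε
    rw [abs_mul, ENNReal.ofReal_mul (abs_nonneg _), abs_of_pos (by positivity)]
    exact mul_le_mul' (ENNReal.ofReal_le_ofReal (by linarith)) (h.UR_diff hx)

lemma lint_half : ∫⁻ x in Ioo (0:ℝ) 1, ENNReal.ofReal (x ^ (-(1/2) : ℝ)) = 2 := by
  rw [← ofReal_integral_eq_lintegral_ofReal, ← integral_Ioc_eq_integral_Ioo,
    ← intervalIntegral.integral_of_le zero_le_one, integral_rpow (by left; norm_num)]
  · norm_num
  · rw [← IntegrableOn, ← intervalIntegrable_iff_integrableOn_Ioo_of_le zero_le_one]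
    exact intervalIntegral.intervalIntegrable_rpow' (by norm_num)
  · refine (ae_restrict_iff' measurableSet_Ioo).2 (Eventually.of_forall fun x hx => ?_)
    exact rpow_nonneg hx.1.le _

end

end part11

section part12

section
variable {α ε θ : ℝ} {W : ℝ → ℝ → ℝ} {φ₁ φ₂ : ℝ → ℝ} {C : ℝ≥0}

/-- abstract convolution estimate near zero -/
lemma conv_small {a b : ℝ → ℝ≥0∞} (ha : Measurable a) {G : ℝ≥0∞} (hG : ∀ s, b s ≤ G)
    (ha2 : ∀ s, 0 < s → a s ≤ 2) (hθ : 0 < θ)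
    (hinteg : ∫⁻ x in Ioi (0:ℝ), a x ≤ ENNReal.ofReal (2 * θ ^ 2)) {x : ℝ} (hx : 0 < x) (hx1 : x < 1) :
    ENNReal.ofReal (1 + 1 / x) * ∫⁻ s in Ioo 0 x, a (x - s) * b s ≤
      ENNReal.ofReal (4 * θ) * ENNReal.ofReal (x ^ (-(1/2) : ℝ)) * G := by
  have hac : Measurable (fun s => a (x - s)) := ha.comp (by fun_prop)
  have i0 : ∫⁻ s in Ioo 0 x, a (x - s) * b s ≤ (∫⁻ s in Ioo 0 x, a (x - s)) * G := by
    rw [← lintegral_mul_const _ hac]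
    exact lintegral_mono fun s => mul_le_mul' le_rfl (hG s)
  have i1 : ∫⁻ s in Ioo 0 x, a (x - s) ≤ ENNReal.ofReal (2 * x) := by
    calc ∫⁻ s in Ioo 0 x, a (x - s) ≤ ∫⁻ s in Ioo 0 x, 2 := by
          refine setLIntegral_mono measurable_const fun s hs => ha2 _ (by linarith [hs.2])
      _ = ENNReal.ofReal (2 * x) := by
          simp [ENNReal.ofReal_mul]
  have i2 : ∫⁻ s in Ioo 0 x, a (x - s) ≤ ENNReal.ofReal (2 * θ ^ 2) := by
    refine le_trans ?_ hinteg
    rw [← lintegral_indicator measurableSet_Ioo, ← lintegral_indicator measurableSet_Ioi,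
      ← lintegral_sub_left_eq_self _ x]
    refine lintegral_mono fun s => ?_
    by_cases hs : x - s ∈ Ioo 0 x
    · have : 0 < s := by linarith [hs.2]
      rw [indicator_of_mem hs, indicator_of_mem (show s ∈ Ioi 0 from this), sub_sub_cancel]
    · rw [indicator_of_notMem hs]; exact zero_le
  have hr : x ^ (-(1/2) : ℝ) = (√x)⁻¹ := by
    rw [rpow_neg hx.le, sqrt_eq_rpow]
  have hs : 0 < √x := sqrt_pos.2 hx
  have hsq : √x * √x = x := mul_self_sqrt hx.le
  have i3 : ∫⁻ s in Ioo 0 x, a (x - s) ≤ ENNReal.ofReal (2 * θ * √x) := by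
    rcases le_total θ (√x) with h | h
    · refine i2.trans (ENNReal.ofReal_le_ofReal ?_)
      nlinarith
    · refine i1.trans (ENNReal.ofReal_le_ofReal ?_)
      nlinarith
  calc _ ≤ ENNReal.ofReal (1 + 1 / x) * (ENNReal.ofReal (2 * θ * √x) * G) := by
        gcongr; exact i0.trans (by gcongr)
    _ = ENNReal.ofReal ((1 + 1 / x) * (2 * θ * √x)) * G := by
        rw [← mul_assoc, ← ENNReal.ofReal_mul (by positivity)]
    _ ≤ ENNReal.ofReal (4 * θ * x ^ (-(1/2) : ℝ)) * G := by
        refine mul_le_mul' (ENNReal.ofReal_le_ofReal ?_) le_rfl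
        rw [hr, ← div_eq_mul_inv, le_div_iff₀ hs]
        have : (1 + 1 / x) * (2 * θ * √x) * √x = (1 + 1 / x) * (2 * θ) * (√x * √x) := by ring
        rw [this, hsq]
        have : (1 + 1 / x) * (2 * θ) * x = 2 * θ * (x + 1) := by field_simp
        rw [this]; nlinarith
    _ = _ := by rw [ENNReal.ofReal_mul (by positivity)]

lemma conv_est {a b : ℝ → ℝ≥0∞} (ha : Measurable a) (hb : Measurable b) {G H : ℝ≥0∞}
    (hG : ∀ s, b s ≤ G)
    (ha2 : ∀ s, 0 < s → a s ≤ 2) (hθ : 0 < θ) (hθ1 : θ ≤ 1) (hH : ∫⁻ x in Ioi (0:ℝ), b x ≤ H)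
    (hinteg : ∫⁻ x in Ioi (0:ℝ), a x ≤ ENNReal.ofReal (2 * θ ^ 2)) :
    ∫⁻ x in Ioi (0:ℝ), ENNReal.ofReal (1 + 1 / x) * ∫⁻ s in Ioo 0 x, a (x - s) * b s ≤
      ENNReal.ofReal (8 * θ) * (G + H) := by
  have m1 : Measurable (fun x : ℝ => (Ioo (0:ℝ) 1).indicator
      (fun x => ENNReal.ofReal (4 * θ) * ENNReal.ofReal (x ^ (-(1/2) : ℝ)) * G) x) :=
    Measurable.indicator (by fun_prop) measurableSet_Ioo
  calc _ ≤ ∫⁻ x in Ioi (0:ℝ), ((Ioo (0:ℝ) 1).indicator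
      (fun x => ENNReal.ofReal (4 * θ) * ENNReal.ofReal (x ^ (-(1/2) : ℝ)) * G) x +
        2 * ∫⁻ s in Ioo 0 x, a (x - s) * b s) := by
        refine setLIntegral_mono' measurableSet_Ioi fun x hx => ?_
        by_cases h : x < 1
        · rw [indicator_of_mem (show x ∈ Ioo (0:ℝ) 1 from ⟨hx, h⟩)]
          exact (conv_small ha hG ha2 hθ hinteg hx h).trans le_self_add
        · refine le_trans ?_ le_add_self
          gcongr
          rw [show (2:ℝ≥0∞) = ENNReal.ofReal 2 by simp]
          apply ENNReal.ofReal_le_ofReal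
          have : 1 / x ≤ 1 := by
            rw [div_le_one hx]; linarith
          linarith
    _ = ENNReal.ofReal (4 * θ) * 2 * G + 2 * ((∫⁻ x in Ioi (0:ℝ), a x) * ∫⁻ x in Ioi (0:ℝ), b x) := by
        rw [lintegral_add_left m1, lintegral_const_mul' _ _ (by simp), lconv ha hb,
          setLIntegral_indicator measurableSet_Ioo, inter_eq_left.2 Ioo_subset_Ioi_self,
          lintegral_mul_const _ (by fun_prop), lintegral_const_mul _ (by fun_prop), lint_half]
    _ ≤ ENNReal.ofReal (8 * θ) * G + 2 * (ENNReal.ofReal (2 * θ ^ 2) * H) := by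
        gcongr
        rw [show (2:ℝ≥0∞) = ENNReal.ofReal 2 by simp, ← ENNReal.ofReal_mul (by positivity)]
        apply ENNReal.ofReal_le_ofReal; linarith
    _ ≤ _ := by
        rw [mul_add, ← mul_assoc, show (2:ℝ≥0∞) = ENNReal.ofReal 2 by simp,
          ← ENNReal.ofReal_mul (by positivity)]
        refine add_le_add le_rfl (mul_le_mul' (ENNReal.ofReal_le_ofReal ?_) le_rfl)
        nlinarith

/-- constant-kernel tau estimate. -/
lemma Pair.tau (h : Pair α ε W φ₁ φ₂ C θ) :
    ∫⁻ x in Ioi 0, ENNReal.ofReal ((1 + x) * |tt φ₁ φ₂ x|) ≤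
      ENNReal.ofReal (2100 * C * θ) * nrm α φ₁ φ₂ := by
  have a := h.hα.1
  have a1 := h.hα.2
  have hθ := h.hθ
  have t1 := h.p1.tl h.hW h.hε.le
  have t2 := h.p2.tl h.hW h.hε.le
  have c1 := NN_cont h.p1.pos
    ((h.m1 0 (by linarith) (by norm_num)).trans_lt ENNReal.coe_lt_top).ne
  have c2 := NN_cont h.p2.pos
    ((h.m2 0 (by linarith) (by norm_num)).trans_lt ENNReal.coe_lt_top).ne
  have ct := h.tt_cont
  have h0 : ∫ x in Ioi (0:ℝ), tt φ₁ φ₂ x = 0 := by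
    unfold tt
    rw [integral_sub t1.int t2.int, t1.one, t2.one, sub_self]
  refine (ode_abs ct (t1.int.sub t2.int) h0 (fun x => rfl)).trans ?_
  have mD : Measurable (DD W (gg φ₁ φ₂) (ff φ₁ φ₂)) := DD_meas h.hW h.gpos.meas h.fpos.meas
  have mD' : Measurable (DD W (ff φ₁ φ₂) (gg φ₁ φ₂)) := DD_meas h.hW h.fpos.meas h.gpos.meas
  set n : ℝ → ℝ≥0∞ := fun x => ENNReal.ofReal |NN φ₁ x + NN φ₂ x - 2 * exp (-x)| with hn
  set b : ℝ → ℝ≥0∞ := fun x => ENNReal.ofReal |tt φ₁ φ₂ x| with hb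
  have hnm : Measurable n := by
    have := c1.measurable
    have := c2.measurable
    fun_prop
  have hbm : Measurable b := by
    have := ct.measurable
    fun_prop
  have key := conv_est hnm hbm (G := nrm α φ₁ φ₂) (H := nrm α φ₁ φ₂) (θ := θ)
    (fun s => (h.tt_le s).trans ((TT_le_mom0 s).trans (h.g_mom (by linarith) (by norm_num))))
    (fun s hs => by
      rw [show (2:ℝ≥0∞) = ENNReal.ofReal 2 by simp]
      apply ENNReal.ofReal_le_ofReal
      have := t1.nonneg s
      have := t2.nonneg s
      have := t1.le_one s
      have := t2.le_one s
      have := exp_pos (-s)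
      have : exp (-s) ≤ 1 := exp_le_one_iff.2 (by linarith)
      rw [abs_le]; constructor <;> linarith) hθ h.hθ1
    (h.t_mom0.trans (h.g_mom (by linarith) (by norm_num))) h.n_int
  have d1 : ∫⁻ x in Ioi 0, ENNReal.ofReal (1 + 1 / x) * DD W (gg φ₁ φ₂) (ff φ₁ φ₂) x ≤
      20 * C * nrm α φ₁ φ₂ := by
    refine (DD_int h.hW h.gpos h.fpos).trans ?_
    calc _ ≤ (nrm α φ₁ φ₂ * (2 * C) + nrm α φ₁ φ₂ * (2 * C)) +
          4 * (nrm α φ₁ φ₂ * (2 * C) + nrm α φ₁ φ₂ * (2 * C)) := by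
          gcongr <;> first
            | exact h.g_mom (by linarith) (by linarith)
            | exact h.f_mom (by linarith) (by linarith)
      _ = _ := by ring
  have d2 : ∫⁻ x in Ioi 0, ENNReal.ofReal (1 + 1 / x) * DD W (ff φ₁ φ₂) (gg φ₁ φ₂) x ≤
      20 * C * nrm α φ₁ φ₂ := by
    refine (DD_int h.hW h.fpos h.gpos).trans ?_
    calc _ ≤ ((2 * C) * nrm α φ₁ φ₂ + (2 * C) * nrm α φ₁ φ₂) +
          4 * ((2 * C) * nrm α φ₁ φ₂ + (2 * C) * nrm α φ₁ φ₂) := by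
          gcongr <;> first
            | exact h.g_mom (by linarith) (by linarith)
            | exact h.f_mom (by linarith) (by linarith)
      _ = _ := by ring
  calc _ ≤ 36 * ∫⁻ x in Ioi (0:ℝ), ((ENNReal.ofReal (1 + 1 / x) * ∫⁻ s in Ioo 0 x, n (x - s) * b s) +
        ENNReal.ofReal ε * (ENNReal.ofReal (1 + 1 / x) * DD W (gg φ₁ φ₂) (ff φ₁ φ₂) x +
          ENNReal.ofReal (1 + 1 / x) * DD W (ff φ₁ φ₂) (gg φ₁ φ₂) x)) := by
        gcongr 36 * ?_
        refine setLIntegral_mono' measurableSet_Ioi fun x hx => ?_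
        have hx' : 0 < x := hx
        rw [ENNReal.ofReal_mul (by positivity)]
        refine (mul_le_mul' le_rfl (h.V_le hx')).trans (le_of_eq ?_)
        rw [mul_add]
        congr 1
        ring
    _ = 36 * ((∫⁻ x in Ioi (0:ℝ), (ENNReal.ofReal (1 + 1 / x) * ∫⁻ s in Ioo 0 x, n (x - s) * b s)) +
        ENNReal.ofReal ε * ((∫⁻ x in Ioi 0, ENNReal.ofReal (1 + 1 / x) * DD W (gg φ₁ φ₂) (ff φ₁ φ₂) x) +
          ∫⁻ x in Ioi 0, ENNReal.ofReal (1 + 1 / x) * DD W (ff φ₁ φ₂) (gg φ₁ φ₂) x)) := by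
        rw [lintegral_add_right _ (by fun_prop), lintegral_const_mul _ (by fun_prop),
          lintegral_add_left (by fun_prop)]
    _ ≤ 36 * (ENNReal.ofReal (8 * θ) * (nrm α φ₁ φ₂ + nrm α φ₁ φ₂) +
        ENNReal.ofReal θ * (20 * C * nrm α φ₁ φ₂ + 20 * C * nrm α φ₁ φ₂)) := by
        gcongr
        exact h.hεθ
    _ = ENNReal.ofReal (36 * (16 * θ + θ * 40 * C)) * nrm α φ₁ φ₂ := by
        rw [ENNReal.ofReal_mul (p := 36) (by norm_num),
          ENNReal.ofReal_add (by positivity) (by positivity),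
          ENNReal.ofReal_mul (p := 8) (by norm_num), ENNReal.ofReal_mul (p := 16) (by norm_num),
          ENNReal.ofReal_mul (p := θ * 40) (by positivity),
          ENNReal.ofReal_mul (p := θ) (by positivity)]
        simp only [ENNReal.ofReal_ofNat, ENNReal.ofReal_coe_nnreal]
        ring
    _ ≤ _ := by
        refine mul_le_mul' (ENNReal.ofReal_le_ofReal ?_) le_rfl
        have : (1:ℝ) ≤ C := by exact_mod_cast h.hC
        nlinarith
end

end part12

section part13

lemma abs_ofReal {a b : ℝ} {R : ℝ≥0∞} (ha : 0 ≤ a) (hb : 0 ≤ b)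
    (h1 : ENNReal.ofReal a ≤ ENNReal.ofReal b + R) (h2 : ENNReal.ofReal b ≤ ENNReal.ofReal a + R) :
    ENNReal.ofReal |a - b| ≤ R := by
  rcases eq_or_ne R ∞ with hR | hR
  · rw [hR]; exact le_top
  lift R to ℝ≥0 using hR
  rw [← ENNReal.ofReal_coe_nnreal, ← ENNReal.ofReal_add hb (by positivity),
    ENNReal.ofReal_le_ofReal_iff (by positivity)] at h1
  rw [← ENNReal.ofReal_coe_nnreal, ← ENNReal.ofReal_add ha (by positivity),
    ENNReal.ofReal_le_ofReal_iff (by positivity)] at h2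
  rw [← ENNReal.ofReal_coe_nnreal]
  apply ENNReal.ofReal_le_ofReal
  rw [abs_le]; constructor <;> linarith

noncomputable def MM (φ : ℝ → ℝ) (x : ℝ) : ℝ≥0∞ := ∫⁻ y in Ioi x, ENNReal.ofReal (y * φ y)

lemma MM_meas {φ : ℝ → ℝ} : Measurable (MM φ) :=
  (show Antitone (MM φ) from fun _ _ hab => lintegral_mono_set (Ioi_subset_Ioi hab)).measurable

lemma MM_neg {φ : ℝ → ℝ} (hφ : PosF φ) {x : ℝ} (hx : x ≤ 0) : MM φ x = mom 1 φ := by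
  unfold MM mom
  rw [← lintegral_indicator measurableSet_Ioi]
  refine lintegral_congr fun y => ?_
  by_cases hy : x < y
  · simp [hy]
  · have : y ≤ 0 := by linarith
    simp [hy, hφ.zero y this]

lemma MM_le {φ : ℝ → ℝ} (hφ : PosF φ) (x : ℝ) : MM φ x ≤ mom 1 φ := by
  unfold MM mom
  refine (setLIntegral_le_lintegral _ _).trans (le_of_eq ?_)
  simp

lemma MM_eq {φ : ℝ → ℝ} (hφ : PosF φ) {x : ℝ} (hx : 0 ≤ x) :
    MM φ x = ENNReal.ofReal x * TT φ x + ∫⁻ t in Ioi x, TT φ t := by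
  have hm := hφ.meas
  have h1 := lint_TT hφ (w := (Ioi x).indicator 1) (measurable_one.indicator measurableSet_Ioi)
  have h2 : ∫⁻ t in Ioi 0, (Ioi x).indicator 1 t * TT φ t = ∫⁻ t in Ioi x, TT φ t := by
    rw [← lintegral_indicator measurableSet_Ioi, ← lintegral_indicator measurableSet_Ioi]
    refine lintegral_congr fun t => ?_
    by_cases ht : x < t
    · simp [ht, hx.trans_lt ht]
    · simp [ht]
  have h3 : ∀ y, ENNReal.ofReal (φ y) * ∫⁻ t in Ioo 0 y, (Ioi x).indicator (1 : ℝ → ℝ≥0∞) t =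
      (Ioi x).indicator (fun y => ENNReal.ofReal (y - x) * ENNReal.ofReal (φ y)) y := fun y => by
    rw [lintegral_indicator_one measurableSet_Ioi, Measure.restrict_apply measurableSet_Ioi]
    have : Ioi x ∩ Ioo 0 y = Ioo x y := by
      ext t; simp only [mem_inter_iff, mem_Ioi, mem_Ioo]
      exact ⟨fun h => ⟨h.1, h.2.2⟩, fun h => ⟨h.1, hx.trans_lt h.1, h.2⟩⟩
    rw [this, Real.volume_Ioo]
    by_cases hy : x < y
    · simp [hy, mul_comm]
    · simp only [indicator, mem_Ioi, hy, if_false]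
      rw [ENNReal.ofReal_of_nonpos (p := y - x) (by linarith), mul_zero]
  rw [← h2, h1]
  simp_rw [h3]
  rw [lintegral_indicator measurableSet_Ioi, TT, ← lintegral_const_mul _ (by fun_prop),
    ← lintegral_add_left (by fun_prop), MM]
  refine setLIntegral_congr_fun measurableSet_Ioi fun y hy => ?_
  have hy' : x < y := hy
  rw [← add_mul, ← ENNReal.ofReal_add hx (by linarith), ← ENNReal.ofReal_mul (by linarith)]
  ring_nf

noncomputable def Dd (T : ℝ → ℝ) (x : ℝ) : ℝ≥0∞ :=
  (Ioi (0:ℝ)).indicator (fun x => ENNReal.ofReal (x * T x) + TT T x) x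

lemma Dd_meas {T : ℝ → ℝ} (hT : PosF T) : Measurable (Dd T) := by
  have := hT.meas
  have := TT_meas (φ := T)
  exact Measurable.indicator (by fun_prop) measurableSet_Ioi

lemma Dd_int {T : ℝ → ℝ} (hT : PosF T) : ∫⁻ x, Dd T x ≤ 2 * mom 1 T := by
  have := hT.meas
  unfold Dd
  rw [lintegral_indicator measurableSet_Ioi, lintegral_add_left (by fun_prop), lint_TT_one hT,
    two_mul]
  gcongr
  refine (setLIntegral_le_lintegral _ _).trans (le_of_eq ?_)
  simp [mom]

section
variable {α ε θ : ℝ} {W : ℝ → ℝ → ℝ} {φ₁ φ₂ : ℝ → ℝ} {C : ℝ≥0}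

lemma Pair.TT_tau (h : Pair α ε W φ₁ φ₂ C θ) {x : ℝ} (hx : 0 < x) :
    TT φ₁ x ≤ TT φ₂ x + ENNReal.ofReal (Ta φ₁ φ₂ x) := by
  have f1 := h.p1.TT_ne_top h.hW h.hε.le x
  have f2 := h.p2.TT_ne_top h.hW h.hε.le x
  rw [← ENNReal.ofReal_toReal f1, ← ENNReal.ofReal_toReal f2,
    ← ENNReal.ofReal_add ENNReal.toReal_nonneg (h.tpos.nonneg x)]
  apply ENNReal.ofReal_le_ofReal
  have := le_abs_self (tt φ₁ φ₂ x)
  unfold Ta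
  rw [if_pos hx]
  unfold tt NN at *
  linarith

lemma Pair.MM_tau (h : Pair α ε W φ₁ φ₂ C θ) (x : ℝ) :
    MM φ₁ x ≤ MM φ₂ x + Dd (Ta φ₁ φ₂) x := by
  rcases le_or_gt x 0 with hx | hx
  · rw [MM_neg h.p1.pos hx, MM_neg h.p2.pos hx, h.p1.mass, h.p2.mass]; exact le_self_add
  · rw [MM_eq h.p1.pos hx.le, MM_eq h.p2.pos hx.le, Dd, indicator_of_mem (show x ∈ Ioi 0 from hx)]
    have h1 : ∫⁻ t in Ioi x, TT φ₁ t ≤ (∫⁻ t in Ioi x, TT φ₂ t) + TT (Ta φ₁ φ₂) x := by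
      have e : TT (Ta φ₁ φ₂) x = ∫⁻ t in Ioi x, ENNReal.ofReal (Ta φ₁ φ₂ t) := rfl
      rw [e, ← lintegral_add_left TT_meas]
      refine setLIntegral_mono' measurableSet_Ioi fun t ht => ?_
      exact h.TT_tau (hx.trans ht)
    calc _ ≤ ENNReal.ofReal x * (TT φ₂ x + ENNReal.ofReal (Ta φ₁ φ₂ x)) +
          ((∫⁻ t in Ioi x, TT φ₂ t) + TT (Ta φ₁ φ₂) x) := by
          gcongr
          exact h.TT_tau hx
      _ = _ := by rw [ENNReal.ofReal_mul hx.le]; ring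

/-- inner y-integral -/
lemma MM_split {φ : ℝ → ℝ} (hφ : Measurable φ) {x z : ℝ} (hz : 0 < z) :
    (∫⁻ y, ENNReal.ofReal (y * φ y) * (Ioo y (y + z)).indicator 1 x) + MM φ x = MM φ (x - z) := by
  have e : ∀ y, ENNReal.ofReal (y * φ y) * (Ioo y (y + z)).indicator 1 x =
      (Ioo (x - z) x).indicator (fun y => ENNReal.ofReal (y * φ y)) y := fun y => by
    have : x ∈ Ioo y (y + z) ↔ y ∈ Ioo (x - z) x := by
      simp only [mem_Ioo]; constructor <;> rintro ⟨h1, h2⟩ <;> constructor <;> linarith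
    by_cases hy : y ∈ Ioo (x - z) x
    · rw [indicator_of_mem hy, indicator_of_mem (this.2 hy)]; simp
    · rw [indicator_of_notMem hy, indicator_of_notMem (this.not.2 hy)]; simp
  simp_rw [e]
  rw [lintegral_indicator measurableSet_Ioo, MM, MM, setLIntegral_congr Ioo_ae_eq_Ioc,
    ← lintegral_union measurableSet_Ioi, Ioc_union_Ioi_eq_Ioi (by linarith)]
  exact disjoint_left.2 fun t h1 h2 => by simp only [mem_Ioc, mem_Ioi] at h1 h2; linarith

lemma Pair.y_part (h : Pair α ε W φ₁ φ₂ C θ) {x z : ℝ} (hz : 0 < z) :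
    ∫⁻ y, ENNReal.ofReal (y * φ₁ y) * (Ioo y (y + z)).indicator 1 x ≤
    (∫⁻ y, ENNReal.ofReal (y * φ₂ y) * (Ioo y (y + z)).indicator 1 x) +
      (Dd (Ta φ₁ φ₂) x + Dd (Ta φ₁ φ₂) (x - z)) := by
  have e1 := MM_split h.p1.pos.meas (x := x) hz
  have e2 := MM_split h.p2.pos.meas (x := x) hz
  have hf : MM φ₁ x ≠ ∞ := ((MM_le h.p1.pos x).trans_lt (by rw [h.p1.mass]; simp)).ne
  refine (ENNReal.add_le_add_iff_right hf).1 ?_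
  rw [e1]
  refine (h.MM_tau (x - z)).trans ?_
  rw [← e2]
  have := h.symm.MM_tau x
  rw [Ta_symm] at this
  calc _ ≤ (∫⁻ y, ENNReal.ofReal (y * φ₂ y) * (Ioo y (y + z)).indicator 1 x) +
        (MM φ₁ x + Dd (Ta φ₁ φ₂) x) + Dd (Ta φ₁ φ₂) (x - z) := by gcongr
    _ = _ := by ring
end

end part13

section part14

noncomputable def JJ (φ χ : ℝ → ℝ) (x : ℝ) : ℝ≥0∞ :=
  ∫⁻ y, ∫⁻ z, ENNReal.ofReal (y * φ y) * ENNReal.ofReal (χ z) * (Ioo y (y + z)).indicator 1 x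

noncomputable def PW (W : ℝ → ℝ → ℝ) (φ χ : ℝ → ℝ) (x : ℝ) : ℝ≥0∞ :=
  ∫⁻ y, ∫⁻ z, ENNReal.ofReal (y * W y z * (φ y * χ z)) * (Ioo y (y + z)).indicator 1 x

lemma ioo_meas2 (x : ℝ) : Measurable (fun p : ℝ × ℝ =>
    (Ioo p.1 (p.1 + p.2)).indicator (1 : ℝ → ℝ≥0∞) x) :=
  ioo_ind_meas.comp (f := fun p : ℝ × ℝ => (x, p.1, p.2)) (by fun_prop)

lemma JJ_meas2 {φ χ : ℝ → ℝ} (hφ : Measurable φ) (hχ : Measurable χ) (x : ℝ) :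
    Measurable (fun p : ℝ × ℝ => ENNReal.ofReal (p.1 * φ p.1) * ENNReal.ofReal (χ p.2) *
      (Ioo p.1 (p.1 + p.2)).indicator (1 : ℝ → ℝ≥0∞) x) := by
  have := ioo_meas2 x
  fun_prop

lemma JJ_swap {φ χ : ℝ → ℝ} (hφ : Measurable φ) (hχ : Measurable χ) (x : ℝ) :
    JJ φ χ x = ∫⁻ z, ENNReal.ofReal (χ z) *
      ∫⁻ y, ENNReal.ofReal (y * φ y) * (Ioo y (y + z)).indicator 1 x := by
  unfold JJ
  rw [dbl_swap (JJ_meas2 hφ hχ x)]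
  refine lintegral_congr fun z => ?_
  rw [← lintegral_const_mul' _ _ ENNReal.ofReal_ne_top]
  refine lintegral_congr fun y => ?_
  ring

section
variable {α ε θ : ℝ} {W : ℝ → ℝ → ℝ} {φ₁ φ₂ : ℝ → ℝ} {C : ℝ≥0}

lemma Pair.J_step1 (h : Pair α ε W φ₁ φ₂ C θ) {χ : ℝ → ℝ} (hχ : PosF χ) (x : ℝ) :
    JJ φ₁ χ x ≤ JJ φ₂ χ x + (mom 0 χ * Dd (Ta φ₁ φ₂) x +
      ∫⁻ z, ENNReal.ofReal (χ z) * Dd (Ta φ₁ φ₂) (x - z)) := by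
  have m := Dd_meas h.tpos
  have mχ := hχ.meas
  have m' : Measurable (fun z => Dd (Ta φ₁ φ₂) (x - z)) := m.comp (by fun_prop)
  rw [JJ_swap h.p1.pos.meas mχ, JJ_swap h.p2.pos.meas mχ, mom_zero,
    ← lintegral_mul_const _ (by fun_prop), ← lintegral_add_left (by fun_prop),
    ← lintegral_add_right _ (by fun_prop)]
  refine lintegral_mono fun z => ?_
  rcases le_or_gt z 0 with hz | hz
  · simp [hχ.zero z hz]
  · rw [← mul_add, ← mul_add]
    exact mul_le_mul' le_rfl (h.y_part hz)

lemma Pair.J_step2 (h : Pair α ε W φ₁ φ₂ C θ) {χ : ℝ → ℝ} (hχ : PosF χ) (x : ℝ) :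
    JJ χ φ₁ x ≤ JJ χ φ₂ x + ∫⁻ y, ENNReal.ofReal (y * χ y) * ENNReal.ofReal (Ta φ₁ φ₂ (x - y)) := by
  have mT := h.tpos.meas
  have mχ := hχ.meas
  have e : ∀ φ : ℝ → ℝ, JJ χ φ x = ∫⁻ y, ENNReal.ofReal (y * χ y) *
      (Iio x).indicator (fun y => TT φ (x - y)) y := fun φ => by
    refine lintegral_congr fun y => ?_
    simp_rw [mul_assoc]
    rw [lintegral_const_mul' _ _ ENNReal.ofReal_ne_top]
    congr 1
    by_cases hy : y < x
    · rw [indicator_of_mem (show y ∈ Iio x from hy), TT, ← lintegral_indicator measurableSet_Ioi]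
      refine lintegral_congr fun z => ?_
      by_cases hz : x - y < z
      · have : x < y + z := by linarith
        simp [hy, hz, this]
      · have : ¬ x < y + z := by linarith
        simp [hz, this]
    · rw [indicator_of_notMem (show y ∉ Iio x from hy)]
      simp [hy]
  rw [e, e, ← lintegral_add_right _ (by fun_prop)]
  refine lintegral_mono fun y => ?_
  dsimp only
  rw [← mul_add]
  refine mul_le_mul' le_rfl ?_
  by_cases hy : y < x
  · rw [indicator_of_mem (show y ∈ Iio x from hy), indicator_of_mem (show y ∈ Iio x from hy)]
    exact h.TT_tau (by linarith)
  · rw [indicator_of_notMem (show y ∉ Iio x from hy)]; exact zero_le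

lemma flux_split (hW : GW α W) (hε : 0 ≤ ε) {φ : ℝ → ℝ} (hφ : PosF φ) (x : ℝ) :
    ∫⁻ y, ∫⁻ z, ENNReal.ofReal (y * Kern ε W y z * (φ y * φ z)) * (Ioo y (y + z)).indicator 1 x =
      2 * JJ φ φ x + ENNReal.ofReal ε * PW W φ φ x := by
  have i := ioo_meas2 x
  have hm := hφ.meas
  have hWm := hW.meas' measurable_fst measurable_snd
  unfold JJ PW
  rw [← dbl_const_mul _ (JJ_meas2 hm hm x), ← dbl_const_mul _ (by fun_prop), ← dbl_add (by
    have := JJ_meas2 hm hm x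
    fun_prop)]
  refine lintegral_congr fun y => lintegral_congr fun z => ?_
  rcases le_or_gt y 0 with hy | hy
  · simp [hφ.zero y hy]
  have w := hW.nonneg y z
  have a := hφ.nonneg y
  have b := hφ.nonneg z
  have : y * Kern ε W y z * (φ y * φ z) = 2 * ((y * φ y) * φ z) + ε * (y * W y z * (φ y * φ z)) := by
    unfold Kern; ring
  rw [this, ENNReal.ofReal_add (by positivity) (by positivity), ENNReal.ofReal_mul (p := 2) (by norm_num),
    ENNReal.ofReal_mul (p := ε) hε, ENNReal.ofReal_mul (p := y * φ y) (by positivity)]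
  simp only [ENNReal.ofReal_ofNat]
  ring

lemma Pair.PW_diff (h : Pair α ε W φ₁ φ₂ C θ) (x : ℝ) :
    PW W φ₁ φ₁ x ≤ PW W φ₂ φ₂ x + (PW W (gg φ₁ φ₂) (ff φ₁ φ₂) x + PW W (ff φ₁ φ₂) (gg φ₁ φ₂) x) := by
  have hWm := h.hW.meas' measurable_fst measurable_snd
  have i := ioo_meas2 x
  have mk : ∀ u v : ℝ → ℝ, Measurable u → Measurable v → Measurable (fun p : ℝ × ℝ =>
      ENNReal.ofReal (p.1 * W p.1 p.2 * (u p.1 * v p.2)) *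
        (Ioo p.1 (p.1 + p.2)).indicator (1 : ℝ → ℝ≥0∞) x) :=
    fun u v hu hv => by fun_prop
  have g1 := h.gpos.meas
  have f1 := h.fpos.meas
  have q2 := h.p2.pos.meas
  unfold PW
  rw [← dbl_add (mk _ _ g1 f1), ← dbl_add (mk _ _ q2 q2)]
  refine lintegral_mono fun y => lintegral_mono fun z => ?_
  dsimp only
  rw [← add_mul, ← add_mul]
  refine mul_le_mul' ?_ le_rfl
  rcases le_or_gt y 0 with hy | hy
  · simp [h.p1.pos.zero y hy]
  have w := h.hW.nonneg y z
  have b1 := h.p2.pos.nonneg y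
  have b2 := h.p2.pos.nonneg z
  have c1 := h.gpos.nonneg y
  have c2 := h.gpos.nonneg z
  have d1 := h.fpos.nonneg y
  have d2 := h.fpos.nonneg z
  rw [← ENNReal.ofReal_add (by positivity) (by positivity),
    ← ENNReal.ofReal_add (by positivity) (by positivity)]
  apply ENNReal.ofReal_le_ofReal
  have := mul_le_mul_of_nonneg_left (prod_le_gg h y z) (by positivity : 0 ≤ y * W y z)
  linarith

lemma PW_int (hW : GW α W) {φ χ : ℝ → ℝ} (hφ : PosF φ) (hχ : PosF χ) :
    ∫⁻ x, PW W φ χ x ≤ mom (1 + α) φ * mom (1 - α) χ + mom (1 - α) φ * mom (1 + α) χ := by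
  have hWm := hW.meas' measurable_fst measurable_snd
  have h1 := hφ.meas
  have h2 := hχ.meas
  have t := tonelli_flux (k := fun y z => ENNReal.ofReal (y * W y z * (φ y * χ z))) (by fun_prop)
    (q := 1) measurable_one
  simp only [Pi.one_apply, one_mul] at t
  unfold PW
  rw [t]
  have b := dbl_bound hφ hχ (fun y z => y * W y z * z) 1 (1 + α) (1 - α) 1 (1 - α) (1 + α)
    zero_le_one zero_le_one (fun y z hy hz => by
      have := hW.ub y z hy hz
      rw [sub_eq_add_neg, rpow_add hy, rpow_add hy, rpow_add hz, rpow_add hz, rpow_one, rpow_one]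
      calc y * W y z * z ≤ y * (y ^ α * z ^ (-α) + y ^ (-α) * z ^ α) * z := by gcongr
        _ = _ := by ring)
  simp only [ENNReal.ofReal_one, one_mul] at b
  refine le_trans (lintegral_mono fun y => lintegral_mono fun z => ?_) b
  dsimp only
  rcases le_or_gt y 0 with hy | hy
  · simp [hφ.zero y hy]
  rcases le_or_gt z 0 with hz | hz
  · simp [hχ.zero z hz]
  have i1 := hW.nonneg y z
  have i2 := hφ.nonneg y
  have i3 := hχ.nonneg z
  rw [setLIntegral_one, Real.volume_Ioo, ← ENNReal.ofReal_mul (by positivity)]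
  apply ENNReal.ofReal_le_ofReal
  apply le_of_eq; ring

lemma PW_meas (hW : GW α W) {φ χ : ℝ → ℝ} (h1 : Measurable φ) (h2 : Measurable χ) :
    Measurable (PW W φ χ) := by
  have hWm : Measurable (fun p : (ℝ × ℝ) × ℝ => W p.1.2 p.2) :=
      hW.meas.comp (f := fun p : (ℝ × ℝ) × ℝ => (p.1.2, p.2)) (by fun_prop)
  have i : Measurable (fun p : (ℝ × ℝ) × ℝ =>
      (Ioo p.1.2 (p.1.2 + p.2)).indicator (1 : ℝ → ℝ≥0∞) p.1.1) :=
    ioo_ind_meas.comp (f := fun p : (ℝ × ℝ) × ℝ => (p.1.1, p.1.2, p.2)) (by fun_prop)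
  have hk : Measurable (fun p : (ℝ × ℝ) × ℝ =>
      ENNReal.ofReal (p.1.2 * W p.1.2 p.2 * (φ p.1.2 * χ p.2))) :=
    (((measurable_snd.comp measurable_fst).mul hWm).mul ((h1.comp (measurable_snd.comp measurable_fst)).mul
      (h2.comp measurable_snd))).ennreal_ofReal
  exact ((hk.mul i).lintegral_prod_right').lintegral_prod_right'

/-- Tonelli for whole-line convolution -/
lemma lconv' {a b : ℝ → ℝ≥0∞} (ha : Measurable a) (hb : Measurable b) :
    ∫⁻ x, ∫⁻ s, a s * b (x - s) = (∫⁻ x, a x) * ∫⁻ x, b x := by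
  rw [lintegral_lintegral_swap ((ha.comp measurable_snd).mul (hb.comp (f := fun p : ℝ × ℝ => p.1 - p.2)
    (by fun_prop))).aemeasurable]
  have e3 : ∀ s, ∫⁻ x, a s * b (x - s) = a s * ∫⁻ x, b x := fun s => by
    have h3 : Measurable (fun x => b (x - s)) := hb.comp (by fun_prop)
    rw [lintegral_const_mul _ h3, lintegral_sub_right_eq_self (fun x => b x) s]
  simp_rw [e3]
  rw [lintegral_mul_const _ ha]

noncomputable def RR (ε : ℝ) (W : ℝ → ℝ → ℝ) (φ₁ φ₂ : ℝ → ℝ) (x : ℝ) : ℝ≥0∞ :=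
  2 * (Dd (Ta φ₁ φ₂) x + (∫⁻ z, ENNReal.ofReal (ff φ₁ φ₂ z) * Dd (Ta φ₁ φ₂) (x - z)) +
    ∫⁻ y, ENNReal.ofReal (y * ff φ₁ φ₂ y) * ENNReal.ofReal (Ta φ₁ φ₂ (x - y))) +
  ENNReal.ofReal ε * (PW W (gg φ₁ φ₂) (ff φ₁ φ₂) x + PW W (ff φ₁ φ₂) (gg φ₁ φ₂) x)

lemma RR_symm : RR ε W φ₁ φ₂ = RR ε W φ₂ φ₁ := by
  unfold RR
  rw [gg_symm, ff_symm, Ta_symm]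

lemma Pair.flux_le (h : Pair α ε W φ₁ φ₂ C θ) (x : ℝ) :
    2 * JJ φ₁ φ₁ x + ENNReal.ofReal ε * PW W φ₁ φ₁ x ≤
      (2 * JJ φ₂ φ₂ x + ENNReal.ofReal ε * PW W φ₂ φ₂ x) + RR ε W φ₁ φ₂ x := by
  have a1 := h.J_step1 h.p1.pos x
  have a2 := h.J_step2 h.p2.pos x
  have a3 := h.PW_diff x
  have b1 : (∫⁻ z, ENNReal.ofReal (φ₁ z) * Dd (Ta φ₁ φ₂) (x - z)) ≤
      ∫⁻ z, ENNReal.ofReal (ff φ₁ φ₂ z) * Dd (Ta φ₁ φ₂) (x - z) := by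
    refine lintegral_mono fun z => mul_le_mul' (ENNReal.ofReal_le_ofReal ?_) le_rfl
    have := h.p2.pos.nonneg z
    unfold ff; linarith
  have b2 : (∫⁻ y, ENNReal.ofReal (y * φ₂ y) * ENNReal.ofReal (Ta φ₁ φ₂ (x - y))) ≤
      ∫⁻ y, ENNReal.ofReal (y * ff φ₁ φ₂ y) * ENNReal.ofReal (Ta φ₁ φ₂ (x - y)) := by
    refine lintegral_mono fun y => mul_le_mul' (ENNReal.ofReal_le_ofReal ?_) le_rfl
    rcases le_or_gt y 0 with hy | hy
    · simp [ff, h.p1.pos.zero y hy, h.p2.pos.zero y hy]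
    have := h.p1.pos.nonneg y
    unfold ff; nlinarith
  have b3 : mom 0 φ₁ * Dd (Ta φ₁ φ₂) x ≤ Dd (Ta φ₁ φ₂) x := by
    calc _ ≤ 1 * Dd (Ta φ₁ φ₂) x := by gcongr; exact h.p1.mom0 h.hW h.hε.le
      _ = _ := one_mul _
  unfold RR
  calc _ ≤ 2 * ((JJ φ₂ φ₂ x + ∫⁻ y, ENNReal.ofReal (y * ff φ₁ φ₂ y) * ENNReal.ofReal (Ta φ₁ φ₂ (x - y)))
        + (Dd (Ta φ₁ φ₂) x + ∫⁻ z, ENNReal.ofReal (ff φ₁ φ₂ z) * Dd (Ta φ₁ φ₂) (x - z))) +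
        ENNReal.ofReal ε * (PW W φ₂ φ₂ x + (PW W (gg φ₁ φ₂) (ff φ₁ φ₂) x + PW W (ff φ₁ φ₂) (gg φ₁ φ₂) x)) := by
        refine add_le_add (mul_le_mul' le_rfl ?_) (mul_le_mul' le_rfl a3)
        exact a1.trans (add_le_add (a2.trans (add_le_add le_rfl b2)) (add_le_add b3 b1))
    _ = _ := by ring

lemma Pair.g_pt (h : Pair α ε W φ₁ φ₂ C θ) :
    ∀ᵐ x, ENNReal.ofReal (x ^ (2:ℝ) * gg φ₁ φ₂ x) ≤ RR ε W φ₁ φ₂ x := by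
  filter_upwards [h.p1.eq, h.p2.eq] with x h1 h2
  rw [flux_split h.hW h.hε.le h.p1.pos] at h1
  rw [flux_split h.hW h.hε.le h.p2.pos] at h2
  have e1 := h.flux_le x
  have e2 := h.symm.flux_le x
  rw [RR_symm] at e2
  rw [← h1, ← h2] at e1 e2
  have := abs_ofReal (by have := h.p1.pos.nonneg x; positivity)
    (by have := h.p2.pos.nonneg x; positivity) e1 e2
  rw [rpow_two]
  rwa [← mul_sub, abs_mul, abs_of_nonneg (sq_nonneg x)] at this

lemma Pair.T_le (h : Pair α ε W φ₁ φ₂ C θ) :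
    mom 0 (Ta φ₁ φ₂) + mom 1 (Ta φ₁ φ₂) ≤ ENNReal.ofReal (2100 * C * θ) * nrm α φ₁ φ₂ := by
  refine le_trans (le_of_eq ?_) h.tau
  unfold mom
  rw [← lintegral_add_left (h.tpos.meas_mom 0), ← lintegral_indicator measurableSet_Ioi]
  refine lintegral_congr fun x => ?_
  unfold Ta
  by_cases hx : 0 < x
  · have := abs_nonneg (tt φ₁ φ₂ x)
    simp only [rpow_zero, rpow_one, hx, if_true, indicator, mem_Ioi]
    rw [← ENNReal.ofReal_add (by positivity) (by positivity)]
    ring_nf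
  · simp [hx]

lemma Pair.B_est (h : Pair α ε W φ₁ φ₂ C θ) :
    mom 2 (gg φ₁ φ₂) ≤ ENNReal.ofReal (30000 * C * θ) * nrm α φ₁ φ₂ := by
  have a := h.hα.1
  have a1 := h.hα.2
  have hθ := h.hθ
  have mf := h.fpos.meas
  have mT := h.tpos.meas
  have mD := Dd_meas h.tpos
  have mP := PW_meas h.hW h.gpos.meas h.fpos.meas
  have mP' := PW_meas h.hW h.fpos.meas h.gpos.meas
  have f0 : ∫⁻ z, ENNReal.ofReal (ff φ₁ φ₂ z) ≤ 2 := by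
    rw [← mom_zero]
    have := mom_add h.p1.pos h.p2.pos 0
    change mom 0 (ff φ₁ φ₂) = _ at this
    rw [this, show (2:ℝ≥0∞) = 1 + 1 by norm_num]
    exact add_le_add (h.p1.mom0 h.hW h.hε.le) (h.p2.mom0 h.hW h.hε.le)
  have f1 : ∫⁻ z, ENNReal.ofReal (z * ff φ₁ φ₂ z) = 2 := by
    have := mom_add h.p1.pos h.p2.pos 1
    change mom 1 (ff φ₁ φ₂) = _ at this
    rw [h.p1.mass, h.p2.mass, mom] at this
    simp only [rpow_one] at this
    rw [this]; norm_num
  have c1 := lconv' (a := fun z => ENNReal.ofReal (ff φ₁ φ₂ z)) (by fun_prop) mD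
  have c2 := lconv' (a := fun z => ENNReal.ofReal (z * ff φ₁ φ₂ z)) (by fun_prop)
    (b := fun z => ENNReal.ofReal (Ta φ₁ φ₂ z)) (by fun_prop)
  have m1 : Measurable (fun x => ∫⁻ z, ENNReal.ofReal (ff φ₁ φ₂ z) * Dd (Ta φ₁ φ₂) (x - z)) := by
    have : Measurable (fun p : ℝ × ℝ => ENNReal.ofReal (ff φ₁ φ₂ p.2) * Dd (Ta φ₁ φ₂) (p.1 - p.2)) :=
      (mf.comp measurable_snd).ennreal_ofReal.mul (mD.comp (f := fun p : ℝ × ℝ => p.1 - p.2) (by fun_prop))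
    exact this.lintegral_prod_right'
  calc mom 2 (gg φ₁ φ₂) ≤ ∫⁻ x, RR ε W φ₁ φ₂ x := lintegral_mono_ae h.g_pt
    _ = 2 * ((∫⁻ x, Dd (Ta φ₁ φ₂) x) + (∫⁻ z, ENNReal.ofReal (ff φ₁ φ₂ z)) * (∫⁻ x, Dd (Ta φ₁ φ₂) x) +
        2 * mom 0 (Ta φ₁ φ₂)) + ENNReal.ofReal ε * ((∫⁻ x, PW W (gg φ₁ φ₂) (ff φ₁ φ₂) x) +
          ∫⁻ x, PW W (ff φ₁ φ₂) (gg φ₁ φ₂) x) := by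
        unfold RR
        rw [lintegral_add_right _ (by fun_prop), lintegral_const_mul' _ _ (by simp),
          lintegral_add_left (by fun_prop), lintegral_add_left (by fun_prop), c1, c2, f1,
          lintegral_const_mul' _ _ (by simp), lintegral_add_left (by fun_prop), mom_zero]
    _ ≤ 2 * ((2 * mom 1 (Ta φ₁ φ₂)) + 2 * (2 * mom 1 (Ta φ₁ φ₂)) +
        2 * mom 0 (Ta φ₁ φ₂)) + ENNReal.ofReal θ * ((nrm α φ₁ φ₂ * (2 * C) + nrm α φ₁ φ₂ * (2 * C)) +
          ((2 * C) * nrm α φ₁ φ₂ + (2 * C) * nrm α φ₁ φ₂)) := by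
        gcongr
        · exact Dd_int h.tpos
        · exact Dd_int h.tpos
        · exact h.hεθ
        · refine (PW_int h.hW h.gpos h.fpos).trans ?_
          gcongr <;> first
            | exact h.g_mom (by linarith) (by linarith)
            | exact h.f_mom (by linarith) (by linarith)
        · refine (PW_int h.hW h.fpos h.gpos).trans ?_
          gcongr <;> first
            | exact h.g_mom (by linarith) (by linarith)
            | exact h.f_mom (by linarith) (by linarith)
    _ ≤ 12 * (mom 0 (Ta φ₁ φ₂) + mom 1 (Ta φ₁ φ₂)) + ENNReal.ofReal θ * (8 * C * nrm α φ₁ φ₂) := by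
        refine add_le_add ?_ (le_of_eq (by ring))
        calc _ = 4 * mom 0 (Ta φ₁ φ₂) + 12 * mom 1 (Ta φ₁ φ₂) := by ring
          _ ≤ 12 * mom 0 (Ta φ₁ φ₂) + 12 * mom 1 (Ta φ₁ φ₂) :=
            add_le_add (mul_le_mul' (by norm_num) le_rfl) le_rfl
          _ = _ := by ring
    _ ≤ 12 * (ENNReal.ofReal (2100 * C * θ) * nrm α φ₁ φ₂) + ENNReal.ofReal θ * (8 * C * nrm α φ₁ φ₂) := by
        gcongr
        exact h.T_le
    _ = ENNReal.ofReal (12 * (2100 * C * θ) + θ * (8 * C)) * nrm α φ₁ φ₂ := by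
        rw [ENNReal.ofReal_add (by positivity) (by positivity),
          ENNReal.ofReal_mul (p := 12) (by norm_num), ENNReal.ofReal_mul (p := θ) (by positivity),
          ENNReal.ofReal_mul (p := 8) (by norm_num)]
        simp only [ENNReal.ofReal_ofNat, ENNReal.ofReal_coe_nnreal]
        ring
    _ ≤ _ := by
        refine mul_le_mul' (ENNReal.ofReal_le_ofReal ?_) le_rfl
        have : 0 ≤ (C:ℝ) * θ := by positivity
        nlinarith
end

end part14

section part15

lemma ac_abs_comp {u : ℝ → ℝ} {a b : ℝ} (h : AbsolutelyContinuousOnInterval u a b) :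
    AbsolutelyContinuousOnInterval (fun x => |u x|) a b := by
  rw [absolutelyContinuousOnInterval_iff] at h ⊢
  intro ε hε
  obtain ⟨δ, hδ, H⟩ := h ε hε
  refine ⟨δ, hδ, fun E hE hs => lt_of_le_of_lt (Finset.sum_le_sum fun i _ => ?_) (H E hE hs)⟩
  rw [Real.dist_eq, Real.dist_eq]
  exact abs_abs_sub_abs_le _ _

lemma ac_ineq {j e : ℝ → ℝ} {X : ℝ} (hX : 0 ≤ X) (hj : IntervalIntegrable j volume 0 X)
    (he : IntervalIntegrable e volume 0 X)
    (h : ∀ᵐ t, 0 < t → ∃ a ≥ 0, j t - e t = a * ∫ v in (0:ℝ)..t, j v) :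
    ∫ t in (0:ℝ)..X, |j t - e t| ≤ |∫ v in (0:ℝ)..X, j v| + ∫ t in (0:ℝ)..X, |e t| := by
  have h0 : (0:ℝ) ∈ uIcc 0 X := left_mem_uIcc
  have ac := hj.absolutelyContinuousOnInterval_intervalIntegral h0
  have acU := ac_abs_comp ac
  have key := acU.integral_deriv_eq_sub
  simp only [intervalIntegral.integral_same, abs_zero, sub_zero] at key
  rw [← key, ← intervalIntegral.integral_add acU.intervalIntegrable_deriv he.abs]
  refine intervalIntegral.integral_mono_ae_restrict hX (hj.sub he).abs
    (acU.intervalIntegrable_deriv.add he.abs) ?_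
  have n0 : ∀ᵐ t : ℝ, t ≠ 0 := by simp [ae_iff, measure_singleton]
  refine (ae_restrict_iff' measurableSet_Icc).2 ?_
  filter_upwards [h, hj.ae_hasDerivAt_integral, acU.ae_differentiableAt, n0] with t h1 h2 h3 h4 ht
  have ht' : t ∈ uIcc 0 X := by rwa [uIcc_of_le hX]
  obtain ⟨a, ha, hb⟩ := h1 (lt_of_le_of_ne ht.1 (Ne.symm h4))
  have d1 := h2 ht' 0 h0
  have d2 := (h3 ht').hasDerivAt
  set U := ∫ v in (0:ℝ)..t, j v with hU
  rcases lt_trichotomy U 0 with u0 | u0 | u0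
  · have d3 := d1.neg.congr_of_eventuallyEq (f₁ := fun x => |∫ v in (0:ℝ)..x, j v|) (by
      filter_upwards [d1.continuousAt.eventually_lt_const u0] with s hs
      simp [abs_of_neg hs])
    rw [d3.deriv]
    have : j t - e t ≤ 0 := by rw [hb]; exact mul_nonpos_of_nonneg_of_nonpos ha u0.le
    rw [abs_of_nonpos this]
    have := neg_abs_le (e t)
    have := le_abs_self (e t)
    linarith
  · have : j t - e t = 0 := by rw [hb, u0, mul_zero]
    rw [this, abs_zero]
    have mn : IsLocalMin (fun x => |∫ v in (0:ℝ)..x, j v|) t :=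
      Filter.Eventually.of_forall fun s => by
        change |∫ v in (0:ℝ)..t, j v| ≤ _
        rw [← hU, u0, abs_zero]; exact abs_nonneg _
    rw [mn.deriv_eq_zero, zero_add]
    exact abs_nonneg _
  · have d3 := d1.congr_of_eventuallyEq (f₁ := fun x => |∫ v in (0:ℝ)..x, j v|) (by
      filter_upwards [d1.continuousAt.eventually_const_lt u0] with s hs
      simp [abs_of_pos hs])
    rw [d3.deriv]
    have : 0 ≤ j t - e t := by rw [hb]; exact mul_nonneg ha u0.le
    rw [abs_of_nonneg this]
    have := neg_abs_le (e t)
    linarith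

lemma lint_tail_pow {α : ℝ} (hα : 0 < α) {t : ℝ} (ht : 0 < t) :
    ∫⁻ x in Ici t, ENNReal.ofReal ((1 + α) * x ^ (-α - 2)) = ENNReal.ofReal (t ^ (-α - 1)) := by
  rw [setLIntegral_congr Ioi_ae_eq_Ici.symm, ← ofReal_integral_eq_lintegral_ofReal]
  · rw [integral_const_mul, integral_Ioi_rpow_of_lt (by linarith) ht]
    congr 1
    rw [show -α - 2 + 1 = -α - 1 by ring]
    have : -α - 1 ≠ 0 := by linarith
    field_simp
    ring
  · exact (integrableOn_Ioi_rpow_of_lt (by linarith) ht).const_mul _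
  · refine (ae_restrict_iff' measurableSet_Ioi).2 (Eventually.of_forall fun x hx => ?_)
    have : 0 < x := ht.trans hx
    positivity

lemma weight_tonelli {α : ℝ} (hα : 0 < α) {p : ℝ → ℝ≥0∞} (hp : Measurable p) :
    ∫⁻ x in Ioi 0, ENNReal.ofReal ((1 + α) * x ^ (-α - 2)) * ∫⁻ t in Ioc 0 x, p t =
      ∫⁻ t in Ioi 0, ENNReal.ofReal (t ^ (-α - 1)) * p t := by
  have hs : MeasurableSet {q : ℝ × ℝ | q.2 ≤ q.1} :=
    measurableSet_le (f := fun q : ℝ × ℝ => q.2) (g := fun q => q.1) (by fun_prop) (by fun_prop)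
  have e1 : ∀ x, ∫⁻ t in Ioc 0 x, p t =
      ∫⁻ t in Ioi 0, {q : ℝ × ℝ | q.2 ≤ q.1}.indicator (fun q => p q.2) (x, t) := fun x => by
    rw [← lintegral_indicator measurableSet_Ioi, ← lintegral_indicator measurableSet_Ioc]
    refine lintegral_congr fun t => ?_
    by_cases h1 : 0 < t <;> by_cases h2 : t ≤ x <;> simp [h1, h2, indicator]
  have mI : Measurable ({q : ℝ × ℝ | q.2 ≤ q.1}.indicator (fun q => p q.2)) :=
    (hp.comp measurable_snd).indicator hs
  simp_rw [e1]
  have e2 : ∀ x, ENNReal.ofReal ((1 + α) * x ^ (-α - 2)) *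
      ∫⁻ t in Ioi 0, {q : ℝ × ℝ | q.2 ≤ q.1}.indicator (fun q => p q.2) (x, t) =
      ∫⁻ t in Ioi 0, ENNReal.ofReal ((1 + α) * x ^ (-α - 2)) *
        {q : ℝ × ℝ | q.2 ≤ q.1}.indicator (fun q => p q.2) (x, t) := fun x =>
    (lintegral_const_mul' _ _ ENNReal.ofReal_ne_top).symm
  simp_rw [e2]
  rw [lintegral_lintegral_swap]
  · refine setLIntegral_congr_fun measurableSet_Ioi fun t ht => ?_
    have ht : 0 < t := ht
    have e3 : ∀ x, (Ioi (0:ℝ)).indicator (fun x => ENNReal.ofReal ((1 + α) * x ^ (-α - 2)) *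
        {q : ℝ × ℝ | q.2 ≤ q.1}.indicator (fun q => p q.2) (x, t)) x =
        (Ici t).indicator (fun x => ENNReal.ofReal ((1 + α) * x ^ (-α - 2)) * p t) x := fun x => by
      by_cases h2 : t ≤ x
      · have : 0 < x := ht.trans_le h2
        simp [this, h2, indicator]
      · simp [h2, indicator]
    rw [← lintegral_indicator measurableSet_Ioi]
    simp_rw [e3]
    rw [lintegral_indicator measurableSet_Ici, lintegral_mul_const _ (by fun_prop), lint_tail_pow hα ht]
  · exact ((Measurable.ennreal_ofReal (by fun_prop)).mul mI).aemeasurable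

lemma weight_ineq {α : ℝ} (hα : 0 < α) {p q E : ℝ → ℝ≥0∞} (hp : Measurable p)
    (hE : Measurable E) (hq : Measurable q) {c : ℝ≥0∞} (hc : c ≠ ∞)
    (h : ∀ᵐ x, 0 < x → c * ∫⁻ t in Ioc 0 x, p t ≤ q x + ∫⁻ t in Ioc 0 x, E t) :
    c * ∫⁻ t in Ioi 0, ENNReal.ofReal (t ^ (-α - 1)) * p t ≤
      (∫⁻ x in Ioi 0, ENNReal.ofReal ((1 + α) * x ^ (-α - 2)) * q x) +
      ∫⁻ t in Ioi 0, ENNReal.ofReal (t ^ (-α - 1)) * E t := by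
  rw [← weight_tonelli hα hp, ← weight_tonelli hα hE, ← lintegral_const_mul' _ _ hc,
    ← lintegral_add_left (by fun_prop)]
  refine lintegral_mono_ae ((ae_restrict_iff' measurableSet_Ioi).2 ?_)
  filter_upwards [h] with x hx h0
  rw [mul_left_comm, ← mul_add]
  exact mul_le_mul' le_rfl (hx h0)

end part15

section part16

noncomputable def LL (ε : ℝ) (W : ℝ → ℝ → ℝ) (ψ χ : ℝ → ℝ) (t : ℝ) : ℝ≥0∞ :=
  ∫⁻ z, ENNReal.ofReal (t * Kern ε W t z * (ψ t * χ z))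

noncomputable def GG (ε : ℝ) (W : ℝ → ℝ → ℝ) (ψ χ : ℝ → ℝ) (t : ℝ) : ℝ≥0∞ :=
  ∫⁻ y, ENNReal.ofReal (y * Kern ε W y (t - y) * (ψ y * χ (t - y)))

section
variable {α ε θ : ℝ} {W : ℝ → ℝ → ℝ} {ψ χ : ℝ → ℝ} {C : ℝ≥0}

lemma LL_meas (hW : GW α W) (hψ : Measurable ψ) (hχ : Measurable χ) : Measurable (LL ε W ψ χ) :=
  (flux_meas hW hψ hχ).lintegral_prod_right'

lemma GG_meas2 (hW : GW α W) (hψ : Measurable ψ) (hχ : Measurable χ) :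
    Measurable (fun p : ℝ × ℝ =>
      ENNReal.ofReal (p.2 * Kern ε W p.2 (p.1 - p.2) * (ψ p.2 * χ (p.1 - p.2)))) :=
  (flux_meas (ε := ε) hW hψ hχ).comp (f := fun p : ℝ × ℝ => (p.2, p.1 - p.2)) (by fun_prop)

lemma GG_meas (hW : GW α W) (hψ : Measurable ψ) (hχ : Measurable χ) : Measurable (GG ε W ψ χ) :=
  (GG_meas2 hW hψ hχ).lintegral_prod_right'

lemma LL_int (hW : GW α W) (hψ : Measurable ψ) (hχ : Measurable χ) {q : ℝ → ℝ≥0∞} :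
    ∫⁻ t, q t * LL ε W ψ χ t =
      ∫⁻ y, ∫⁻ z, ENNReal.ofReal (y * Kern ε W y z * (ψ y * χ z)) * q y := by
  refine lintegral_congr fun t => ?_
  rw [mul_comm, LL, lintegral_mul_const]
  exact (flux_meas (ε := ε) hW hψ hχ).comp (f := fun z : ℝ => (t, z)) (by fun_prop)

lemma GG_int (hW : GW α W) (hψ : Measurable ψ) (hχ : Measurable χ) {q : ℝ → ℝ≥0∞}
    (hq : Measurable q) :
    ∫⁻ t, q t * GG ε W ψ χ t =
      ∫⁻ y, ∫⁻ z, ENNReal.ofReal (y * Kern ε W y z * (ψ y * χ z)) * q (y + z) := by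
  have m := GG_meas2 (ε := ε) hW hψ hχ
  have e : ∀ t, q t * GG ε W ψ χ t =
      ∫⁻ y, ENNReal.ofReal (y * Kern ε W y (t - y) * (ψ y * χ (t - y))) * q t := fun t => by
    rw [mul_comm, GG, lintegral_mul_const]
    exact m.comp (f := fun y : ℝ => (t, y)) (by fun_prop)
  simp_rw [e]
  rw [lintegral_lintegral_swap (m.mul (hq.comp measurable_fst)).aemeasurable]
  refine lintegral_congr fun y => ?_
  have := lintegral_sub_right_eq_self (μ := (volume : Measure ℝ))
    (fun z => ENNReal.ofReal (y * Kern ε W y z * (ψ y * χ z)) * q (y + z)) y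
  rw [← this]
  refine lintegral_congr fun t => ?_
  rw [show y + (t - y) = t by ring]

lemma flux_id (hW : GW α W) (hψ : PosF ψ) (hχ : PosF χ) (x : ℝ) :
    (∫⁻ y, ∫⁻ z, ENNReal.ofReal (y * Kern ε W y z * (ψ y * χ z)) * (Ioo y (y + z)).indicator 1 x) +
      ∫⁻ t in Iic x, GG ε W ψ χ t = ∫⁻ t in Iic x, LL ε W ψ χ t := by
  have h1 : ∫⁻ t in Iic x, GG ε W ψ χ t = ∫⁻ t, (Iic x).indicator 1 t * GG ε W ψ χ t := by
    rw [← lintegral_indicator measurableSet_Iic]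
    refine lintegral_congr fun t => ?_
    by_cases ht : t ≤ x <;> simp [indicator, ht]
  have h2 : ∫⁻ t in Iic x, LL ε W ψ χ t = ∫⁻ t, (Iio x).indicator 1 t * LL ε W ψ χ t := by
    rw [setLIntegral_congr Iio_ae_eq_Iic.symm, ← lintegral_indicator measurableSet_Iio]
    refine lintegral_congr fun t => ?_
    by_cases ht : t < x <;> simp [indicator, ht]
  have i := ioo_meas2 x
  have m := flux_meas (ε := ε) hW hψ.meas hχ.meas
  rw [h1, h2, LL_int hW hψ.meas hχ.meas, GG_int hW hψ.meas hχ.meas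
    (measurable_one.indicator measurableSet_Iic), ← dbl_add (m.mul i)]
  refine lintegral_congr fun y => lintegral_congr fun z => ?_
  rcases le_or_gt z 0 with hz | hz
  · simp [hχ.zero z hz]
  rw [← mul_add]
  congr 1
  by_cases a : y < x
  · by_cases b : x < y + z
    · have : ¬ y + z ≤ x := by linarith
      simp [indicator, a, b, this]
    · have : y + z ≤ x := by linarith
      simp [indicator, a, this]
  · have : ¬ y + z ≤ x := by linarith
    simp [indicator, a, this]

lemma GG_neg (hψ : PosF ψ) (hχ : PosF χ) {t : ℝ} (ht : t ≤ 0) : GG ε W ψ χ t = 0 := by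
  unfold GG
  rw [← lintegral_zero]
  refine lintegral_congr fun y => ?_
  rcases le_or_gt y 0 with hy | hy
  · simp [hψ.zero y hy]
  · simp [hχ.zero (t - y) (by linarith)]

lemma LL_neg (hψ : PosF ψ) {t : ℝ} (ht : t ≤ 0) : LL ε W ψ χ t = 0 := by
  unfold LL
  rw [← lintegral_zero]
  refine lintegral_congr fun y => ?_
  simp [hψ.zero t ht]

lemma kern_pos (hW : GW α W) (hε : 0 ≤ ε) (y z : ℝ) : 2 ≤ Kern ε W y z := by
  have := hW.nonneg y z
  unfold Kern
  have : 0 ≤ ε * W y z := by positivity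
  linarith

lemma flux_fin (hα : α ∈ Ioo 0 1) (hW : GW α W) (hε : 0 ≤ ε) (hε1 : ε ≤ 1)
    (hψ : PosF ψ) (hχ : PosF χ)
    (m1 : ∀ s, -α ≤ s → s ≤ 2 → mom s ψ ≤ C) (m2 : ∀ s, -α ≤ s → s ≤ 2 → mom s χ ≤ C) :
    ∫⁻ y, ∫⁻ z, ENNReal.ofReal (y * Kern ε W y z * (ψ y * χ z)) < ∞ := by
  have a := hα.1
  have a1 := hα.2
  refine (dbl_bound hψ hχ (fun y z => y * Kern ε W y z) 2 (1 + α) (-α) 2 (1 - α) α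
    (by norm_num) (by norm_num) (fun y z hy hz => ?_)).trans_lt ?_
  · have := kern_le hW hε hε1 hy hz
    rw [sub_eq_add_neg, rpow_add hy, rpow_add hy, rpow_one]
    calc y * Kern ε W y z ≤ y * (2 * (y ^ α * z ^ (-α) + y ^ (-α) * z ^ α)) := by gcongr
      _ = _ := by ring
  · have k1 : ∀ s, -α ≤ s → s ≤ 2 → mom s ψ < ∞ := fun s u v => (m1 s u v).trans_lt ENNReal.coe_lt_top
    have k2 : ∀ s, -α ≤ s → s ≤ 2 → mom s χ < ∞ := fun s u v => (m2 s u v).trans_lt ENNReal.coe_lt_top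
    exact ENNReal.add_lt_top.2 ⟨ENNReal.mul_lt_top ENNReal.ofReal_lt_top
      (ENNReal.mul_lt_top (k1 _ (by linarith) (by linarith)) (k2 _ (by linarith) (by linarith))),
      ENNReal.mul_lt_top ENNReal.ofReal_lt_top
      (ENNReal.mul_lt_top (k1 _ (by linarith) (by linarith)) (k2 _ (by linarith) (by linarith)))⟩

lemma GG_total (hW : GW α W) (hψ : PosF ψ) (hχ : PosF χ) :
    ∫⁻ t, GG ε W ψ χ t = ∫⁻ t, LL ε W ψ χ t := by
  have h1 := GG_int (ε := ε) hW hψ.meas hχ.meas (q := 1) measurable_one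
  have h2 := LL_int (ε := ε) hW hψ.meas hχ.meas (q := 1)
  simp only [Pi.one_apply, one_mul, mul_one] at h1 h2
  rw [h1, h2]

noncomputable def Lam (ε : ℝ) (W : ℝ → ℝ → ℝ) (χ : ℝ → ℝ) (t : ℝ) : ℝ≥0∞ :=
  ∫⁻ z, ENNReal.ofReal (Kern ε W t z * χ z)

lemma LL_eq (hψ : PosF ψ) {t : ℝ} (ht : 0 ≤ t) :
    LL ε W ψ χ t = ENNReal.ofReal (t * ψ t) * Lam ε W χ t := by
  unfold LL Lam
  rw [← lintegral_const_mul' _ _ ENNReal.ofReal_ne_top]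
  refine lintegral_congr fun z => ?_
  rw [← ENNReal.ofReal_mul (mul_nonneg ht (hψ.nonneg t))]
  ring_nf

lemma Lam_ge (hW : GW α W) (hε : 0 ≤ ε) (hχ : PosF χ) (t : ℝ) : 2 * mom 0 χ ≤ Lam ε W χ t := by
  rw [mom_zero, Lam, ← lintegral_const_mul' _ _ (by simp)]
  refine lintegral_mono fun z => ?_
  dsimp only
  rw [show (2:ℝ≥0∞) = ENNReal.ofReal 2 by simp, ← ENNReal.ofReal_mul (by norm_num)]
  exact ENNReal.ofReal_le_ofReal (mul_le_mul_of_nonneg_right (kern_pos hW hε t z) (hχ.nonneg z))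

lemma Lam_lt (hα : α ∈ Ioo 0 1) (hW : GW α W) (hε : 0 ≤ ε) (hε1 : ε ≤ 1) (hχ : PosF χ)
    (m2 : ∀ s, -α ≤ s → s ≤ 2 → mom s χ ≤ C) {t : ℝ} (ht : 0 < t) : Lam ε W χ t < ∞ := by
  have a := hα.1
  have a1 := hα.2
  have k2 : ∀ s, -α ≤ s → s ≤ 2 → mom s χ < ∞ := fun s u v => (m2 s u v).trans_lt ENNReal.coe_lt_top
  have hb : Lam ε W χ t ≤ ENNReal.ofReal (2 * t ^ α) * mom (-α) χ +
      ENNReal.ofReal (2 * t ^ (-α)) * mom α χ := by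
    unfold mom
    rw [← lintegral_const_mul' _ _ ENNReal.ofReal_ne_top, ← lintegral_const_mul' _ _ ENNReal.ofReal_ne_top,
      ← lintegral_add_left ((hχ.meas_mom _).const_mul _), Lam]
    refine lintegral_mono fun z => ?_
    dsimp only
    rcases le_or_gt z 0 with hz | hz
    · simp [hχ.zero z hz]
    have := hχ.nonneg z
    rw [← ENNReal.ofReal_mul (by positivity), ← ENNReal.ofReal_mul (by positivity),
      ← ENNReal.ofReal_add (by positivity) (by positivity)]
    apply ENNReal.ofReal_le_ofReal
    have := mul_le_mul_of_nonneg_right (kern_le hW hε hε1 ht hz) this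
    linarith
  exact hb.trans_lt (ENNReal.add_lt_top.2 ⟨ENNReal.mul_lt_top ENNReal.ofReal_lt_top
    (k2 _ (by linarith) (by linarith)), ENNReal.mul_lt_top ENNReal.ofReal_lt_top
    (k2 _ (by linarith) (by linarith))⟩)
end

end part16

section part17

noncomputable def jj (ε : ℝ) (W : ℝ → ℝ → ℝ) (φ : ℝ → ℝ) (t : ℝ) : ℝ :=
  (LL ε W φ φ t).toReal - (GG ε W φ φ t).toReal

section
variable {α ε θ : ℝ} {W : ℝ → ℝ → ℝ} {φ ψ χ φ₁ φ₂ : ℝ → ℝ} {C : ℝ≥0}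

lemma LL_tot_lt (hα : α ∈ Ioo 0 1) (hW : GW α W) (hε : 0 ≤ ε) (hε1 : ε ≤ 1)
    (hψ : PosF ψ) (hχ : PosF χ)
    (m1 : ∀ s, -α ≤ s → s ≤ 2 → mom s ψ ≤ C) (m2 : ∀ s, -α ≤ s → s ≤ 2 → mom s χ ≤ C) :
    ∫⁻ t, LL ε W ψ χ t < ∞ := flux_fin hα hW hε hε1 hψ hχ m1 m2

lemma GG_tot_lt (hα : α ∈ Ioo 0 1) (hW : GW α W) (hε : 0 ≤ ε) (hε1 : ε ≤ 1)
    (hψ : PosF ψ) (hχ : PosF χ)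
    (m1 : ∀ s, -α ≤ s → s ≤ 2 → mom s ψ ≤ C) (m2 : ∀ s, -α ≤ s → s ≤ 2 → mom s χ ≤ C) :
    ∫⁻ t, GG ε W ψ χ t < ∞ := by
  rw [GG_total hW hψ hχ]; exact LL_tot_lt hα hW hε hε1 hψ hχ m1 m2

lemma Prof.repr (hα : α ∈ Ioo 0 1) (hW : GW α W) (hε : 0 ≤ ε) (hε1 : ε ≤ 1)
    (h : Prof α ε W φ) (m1 : ∀ s, -α ≤ s → s ≤ 2 → mom s φ ≤ C) :
    Integrable (jj ε W φ) ∧ ∀ᵐ x, 0 ≤ x → x ^ 2 * φ x = ∫ v in (0:ℝ)..x, jj ε W φ v := by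
  have hφ := h.pos
  have fL := (LL_tot_lt hα hW hε hε1 hφ hφ m1 m1).ne
  have fG := (GG_tot_lt hα hW hε hε1 hφ hφ m1 m1).ne
  have mL := LL_meas (ε := ε) hW hφ.meas hφ.meas
  have mG := GG_meas (ε := ε) hW hφ.meas hφ.meas
  have iL := integrable_toReal_of_lintegral_ne_top mL.aemeasurable fL
  have iG := integrable_toReal_of_lintegral_ne_top mG.aemeasurable fG
  have ij : Integrable (jj ε W φ) := iL.sub iG
  refine ⟨ij, ?_⟩
  filter_upwards [h.eq] with x hx h0
  have fL' : ∫⁻ t in Iic x, LL ε W φ φ t ≠ ∞ := ne_top_of_le_ne_top fL (setLIntegral_le_lintegral _ _)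
  have fG' : ∫⁻ t in Iic x, GG ε W φ φ t ≠ ∞ := ne_top_of_le_ne_top fG (setLIntegral_le_lintegral _ _)
  have z0 : ∫ v in Iic 0, jj ε W φ v = 0 := by
    rw [setIntegral_congr_fun (g := fun _ => (0:ℝ)) measurableSet_Iic (fun t ht => ?_)]
    · simp
    · simp only [jj]
      rw [GG_neg hφ hφ ht, LL_neg hφ ht]; simp
  have e1 : ∫ v in (0:ℝ)..x, jj ε W φ v = ∫ v in Iic x, jj ε W φ v := by
    rw [← intervalIntegral.integral_Iic_sub_Iic ij.integrableOn ij.integrableOn, z0, sub_zero]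
  rw [e1]
  unfold jj
  rw [integral_sub iL.integrableOn iG.integrableOn,
    integral_toReal mL.aemeasurable (ae_lt_top mL fL'),
    integral_toReal mG.aemeasurable (ae_lt_top mG fG')]
  have id := flux_id (ε := ε) hW hφ hφ x
  rw [← hx] at id
  rw [← id, ENNReal.toReal_add ENNReal.ofReal_ne_top fG', ENNReal.toReal_ofReal]
  · ring
  · have := hφ.nonneg x
    positivity

noncomputable def EE (ε : ℝ) (W : ℝ → ℝ → ℝ) (φ₁ φ₂ : ℝ → ℝ) (t : ℝ) : ℝ≥0∞ :=
  LL ε W φ₂ (gg φ₁ φ₂) t + (GG ε W (gg φ₁ φ₂) φ₁ t + GG ε W φ₂ (gg φ₁ φ₂) t)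

lemma Pair.L_diff (h : Pair α ε W φ₁ φ₂ C θ) {t : ℝ} (ht : 0 ≤ t) :
    LL ε W φ₂ φ₁ t ≤ LL ε W φ₂ φ₂ t + LL ε W φ₂ (gg φ₁ φ₂) t ∧
    LL ε W φ₂ φ₂ t ≤ LL ε W φ₂ φ₁ t + LL ε W φ₂ (gg φ₁ φ₂) t := by
  have mk : ∀ χ : ℝ → ℝ, Measurable χ → Measurable (fun z =>
      ENNReal.ofReal (t * Kern ε W t z * (φ₂ t * χ z))) := fun χ hχ =>
    (flux_meas (ε := ε) h.hW h.p2.pos.meas hχ).comp (f := fun z : ℝ => (t, z)) (by fun_prop)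
  unfold LL
  rw [← lintegral_add_left (mk _ h.p2.pos.meas), ← lintegral_add_left (mk _ h.p1.pos.meas)]
  refine ⟨lintegral_mono fun z => ?_, lintegral_mono fun z => ?_⟩ <;> dsimp only
  all_goals
    have k := kern_pos h.hW h.hε.le t z
    have a1 := h.p1.pos.nonneg z
    have a2 := h.p2.pos.nonneg z
    have a3 := h.gpos.nonneg z
    have a4 := h.p2.pos.nonneg t
    have k0 : 0 ≤ Kern ε W t z := by linarith
    rw [← ENNReal.ofReal_add (by positivity) (by positivity), ← mul_add, ← mul_add]
    apply ENNReal.ofReal_le_ofReal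
    refine mul_le_mul_of_nonneg_left (mul_le_mul_of_nonneg_left ?_ a4) (by positivity)
    unfold gg
    have b1 := le_abs_self (φ₁ z - φ₂ z)
    have b2 := neg_abs_le (φ₁ z - φ₂ z)
    linarith

lemma Pair.G_diff (h : Pair α ε W φ₁ φ₂ C θ) (t : ℝ) :
    GG ε W φ₁ φ₁ t ≤ GG ε W φ₂ φ₂ t + (GG ε W (gg φ₁ φ₂) φ₁ t + GG ε W φ₂ (gg φ₁ φ₂) t) ∧
    GG ε W φ₂ φ₂ t ≤ GG ε W φ₁ φ₁ t + (GG ε W (gg φ₁ φ₂) φ₁ t + GG ε W φ₂ (gg φ₁ φ₂) t) := by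
  have mk : ∀ ψ χ : ℝ → ℝ, Measurable ψ → Measurable χ → Measurable (fun y =>
      ENNReal.ofReal (y * Kern ε W y (t - y) * (ψ y * χ (t - y)))) := fun ψ χ hψ hχ =>
    (GG_meas2 (ε := ε) h.hW hψ hχ).comp (f := fun y : ℝ => (t, y)) (by fun_prop)
  have q1 := h.p1.pos.meas
  have q2 := h.p2.pos.meas
  unfold GG
  rw [← lintegral_add_left (mk _ _ h.gpos.meas q1), ← lintegral_add_left (mk _ _ q2 q2),
    ← lintegral_add_left (mk _ _ q1 q1)]
  refine ⟨lintegral_mono fun y => ?_, lintegral_mono fun y => ?_⟩ <;> dsimp only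
  all_goals
    rcases le_or_gt y 0 with hy | hy
    · simp [h.p1.pos.zero y hy, h.p2.pos.zero y hy]
    have k := kern_pos h.hW h.hε.le y (t - y)
    have a1 := h.p1.pos.nonneg y
    have a2 := h.p2.pos.nonneg y
    have a3 := h.gpos.nonneg y
    have c1 := h.p1.pos.nonneg (t - y)
    have c2 := h.p2.pos.nonneg (t - y)
    have c3 := h.gpos.nonneg (t - y)
    have k0 : 0 ≤ Kern ε W y (t - y) := by linarith
    rw [← ENNReal.ofReal_add (by positivity) (by positivity),
      ← ENNReal.ofReal_add (by positivity) (by positivity), ← mul_add, ← mul_add]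
    apply ENNReal.ofReal_le_ofReal
    refine mul_le_mul_of_nonneg_left ?_ (by positivity)
    unfold gg
    have b1 := le_abs_self (φ₁ y - φ₂ y)
    have b2 := neg_abs_le (φ₁ y - φ₂ y)
    have d1 := le_abs_self (φ₁ (t - y) - φ₂ (t - y))
    have d2 := neg_abs_le (φ₁ (t - y) - φ₂ (t - y))
    nlinarith [mul_le_mul_of_nonneg_right b1 c1, mul_le_mul_of_nonneg_right b2 c1,
      mul_le_mul_of_nonneg_left d1 a2, mul_le_mul_of_nonneg_left d2 a2]

lemma Pair.A_pre (h : Pair α ε W φ₁ φ₂ C θ) :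
    ∀ᵐ x, 0 < x → ENNReal.ofReal (2 * (1 - θ)) * ∫⁻ t in Ioc 0 x, ENNReal.ofReal (t * gg φ₁ φ₂ t) ≤
      ENNReal.ofReal (x ^ 2 * gg φ₁ φ₂ x) + ∫⁻ t in Ioc 0 x, EE ε W φ₁ φ₂ t := by
  obtain ⟨i1, r1⟩ := h.p1.repr h.hα h.hW h.hε.le h.hε1 h.m1
  obtain ⟨i2, r2⟩ := h.p2.repr h.hα h.hW h.hε.le h.hε1 h.m2
  have q1 := h.p1.pos
  have q2 := h.p2.pos
  have fL11 := (LL_tot_lt h.hα h.hW h.hε.le h.hε1 q1 q1 h.m1 h.m1).ne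
  have fL21 := (LL_tot_lt h.hα h.hW h.hε.le h.hε1 q2 q1 h.m2 h.m1).ne
  have fL22 := (LL_tot_lt h.hα h.hW h.hε.le h.hε1 q2 q2 h.m2 h.m2).ne
  have fG11 := (GG_tot_lt h.hα h.hW h.hε.le h.hε1 q1 q1 h.m1 h.m1).ne
  have fG22 := (GG_tot_lt h.hα h.hW h.hε.le h.hε1 q2 q2 h.m2 h.m2).ne
  have mL11 := LL_meas (ε := ε) h.hW q1.meas q1.meas
  have mL21 := LL_meas (ε := ε) h.hW q2.meas q1.meas
  have mL22 := LL_meas (ε := ε) h.hW q2.meas q2.meas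
  have mG11 := GG_meas (ε := ε) h.hW q1.meas q1.meas
  have mG22 := GG_meas (ε := ε) h.hW q2.meas q2.meas
  set j : ℝ → ℝ := fun t => jj ε W φ₁ t - jj ε W φ₂ t with hj
  set e : ℝ → ℝ := fun t => ((LL ε W φ₂ φ₁ t).toReal - (LL ε W φ₂ φ₂ t).toReal) -
    ((GG ε W φ₁ φ₁ t).toReal - (GG ε W φ₂ φ₂ t).toReal) with he
  have ij : Integrable j := i1.sub i2
  have ie : Integrable e :=
    ((integrable_toReal_of_lintegral_ne_top mL21.aemeasurable fL21).sub
      (integrable_toReal_of_lintegral_ne_top mL22.aemeasurable fL22)).sub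
    ((integrable_toReal_of_lintegral_ne_top mG11.aemeasurable fG11).sub
      (integrable_toReal_of_lintegral_ne_top mG22.aemeasurable fG22))
  have hu : ∀ᵐ x, 0 ≤ x → ∫ v in (0:ℝ)..x, j v = x ^ 2 * (φ₁ x - φ₂ x) := by
    filter_upwards [r1, r2] with x a1 a2 hx
    rw [intervalIntegral.integral_sub i1.intervalIntegrable i2.intervalIntegrable,
      ← a1 hx, ← a2 hx]
    ring
  have hje : ∀ t, 0 < t → j t - e t = t * (φ₁ t - φ₂ t) * (Lam ε W φ₁ t).toReal := fun t ht => by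
    have n1 := q1.nonneg t
    have n2 := q2.nonneg t
    have : j t - e t = (LL ε W φ₁ φ₁ t).toReal - (LL ε W φ₂ φ₁ t).toReal := by
      simp only [hj, he, jj]; ring
    rw [this, LL_eq q1 ht.le, LL_eq q2 ht.le, ENNReal.toReal_mul, ENNReal.toReal_mul,
      ENNReal.toReal_ofReal (by positivity), ENNReal.toReal_ofReal (by positivity)]
    ring
  have hmain : ∀ᵐ t, 0 < t → ∃ a ≥ 0, j t - e t = a * ∫ v in (0:ℝ)..t, j v := by
    filter_upwards [hu] with t a1 ht
    refine ⟨(Lam ε W φ₁ t).toReal / t, by positivity, ?_⟩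
    rw [a1 ht.le, hje t ht]
    field_simp
  have hE : ∀ᵐ t, 0 < t → ENNReal.ofReal |e t| ≤ EE ε W φ₁ φ₂ t := by
    filter_upwards [ae_lt_top mL21 fL21, ae_lt_top mL22 fL22, ae_lt_top mG11 fG11,
      ae_lt_top mG22 fG22] with t l1 l2 g1 g2 ht
    obtain ⟨d1, d2⟩ := h.L_diff ht.le
    obtain ⟨d3, d4⟩ := h.G_diff t
    rw [← ENNReal.ofReal_toReal l1.ne, ← ENNReal.ofReal_toReal l2.ne] at d1 d2
    rw [← ENNReal.ofReal_toReal g1.ne, ← ENNReal.ofReal_toReal g2.ne] at d3 d4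
    have b1 := abs_ofReal ENNReal.toReal_nonneg ENNReal.toReal_nonneg d1 d2
    have b2 := abs_ofReal ENNReal.toReal_nonneg ENNReal.toReal_nonneg d3 d4
    refine le_trans ?_ (add_le_add b1 b2)
    rw [← ENNReal.ofReal_add (abs_nonneg _) (abs_nonneg _)]
    exact ENNReal.ofReal_le_ofReal (abs_sub _ _)
  filter_upwards [hu] with x hx h0
  have A := ac_ineq h0.le ij.intervalIntegrable ie.intervalIntegrable hmain
  rw [hx h0.le, abs_mul, abs_of_nonneg (sq_nonneg x), intervalIntegral.integral_of_le h0.le,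
    intervalIntegral.integral_of_le h0.le] at A
  have A' := ENNReal.ofReal_le_ofReal A
  have ija : Integrable (fun t => |j t - e t|) := (ij.sub ie).abs
  rw [ENNReal.ofReal_add (by positivity) (integral_nonneg fun _ => abs_nonneg _),
    ofReal_integral_eq_lintegral_ofReal ija.integrableOn
      (Eventually.of_forall fun _ => abs_nonneg _),
    ofReal_integral_eq_lintegral_ofReal ie.abs.integrableOn
      (Eventually.of_forall fun _ => abs_nonneg _)] at A'
  refine le_trans ?_ (A'.trans (add_le_add le_rfl ?_))
  · rw [← lintegral_const_mul' _ _ ENNReal.ofReal_ne_top]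
    refine setLIntegral_mono' measurableSet_Ioc fun t ht => ?_
    have ht0 := ht.1
    have hθ1 := h.hθ1
    rw [← ENNReal.ofReal_mul (by linarith)]
    apply ENNReal.ofReal_le_ofReal
    have hl : 2 * (1 - θ) ≤ (Lam ε W φ₁ t).toReal := by
      have fin := (Lam_lt h.hα h.hW h.hε.le h.hε1 q1 h.m1 ht0).ne
      rw [← ENNReal.ofReal_le_iff_le_toReal fin]
      refine le_trans ?_ (Lam_ge h.hW h.hε.le q1 t)
      rw [ENNReal.ofReal_mul (by norm_num)]
      exact mul_le_mul' (by simp) h.l1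
    change _ ≤ |j t - e t|
    rw [hje t ht0, abs_mul, abs_mul, abs_of_pos ht0, abs_of_nonneg ENNReal.toReal_nonneg, mul_comm]
    exact mul_le_mul_of_nonneg_left hl (by have := h.gpos.nonneg t; positivity)
  · refine lintegral_mono_ae ((ae_restrict_iff' measurableSet_Ioc).2 ?_)
    filter_upwards [hE] with t a1 ht
    exact a1 ht.1
end

end part17

section part18

section
variable {α ε θ : ℝ} {W : ℝ → ℝ → ℝ} {φ ψ χ φ₁ φ₂ : ℝ → ℝ} {C : ℝ≥0}

lemma core_bound (hW : GW α W) (hε : 0 ≤ ε) (hψ : PosF ψ) (hχ : PosF χ) :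
    ∫⁻ y, ∫⁻ z, ENNReal.ofReal (y ^ (-α) * Kern ε W y z * (ψ y * χ z)) ≤
      2 * (mom (-α) ψ * mom 0 χ) + (ENNReal.ofReal ε * (mom 0 ψ * mom (-α) χ) +
        ENNReal.ofReal ε * (mom (-(2 * α)) ψ * mom α χ)) := by
  have b := dbl_bound hψ hχ (fun y z => ε * (y ^ (-α) * W y z)) ε 0 (-α) ε (-(2 * α)) α hε hε
    (fun y z hy hz => by
      have := hW.ub y z hy hz
      rw [← mul_add]
      refine mul_le_mul_of_nonneg_left ?_ hε
      calc y ^ (-α) * W y z ≤ y ^ (-α) * (y ^ α * z ^ (-α) + y ^ (-α) * z ^ α) := by gcongr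
        _ = (y ^ (-α) * y ^ α) * z ^ (-α) + (y ^ (-α) * y ^ (-α)) * z ^ α := by ring
        _ = _ := by
          rw [← rpow_add hy, ← rpow_add hy]
          ring_nf)
  have p := dbl_prod hψ hχ (-α) 0
  have m1 := hψ.meas_mom (-α)
  have m2 := hχ.meas_mom 0
  have mm : Measurable (fun p : ℝ × ℝ => ENNReal.ofReal (p.1 ^ (-α) * ψ p.1) *
      ENNReal.ofReal (p.2 ^ (0:ℝ) * χ p.2)) :=
    (m1.comp measurable_fst).mul (m2.comp measurable_snd)
  refine le_trans (le_of_eq ?_) (add_le_add (mul_le_mul' (le_refl 2) p.le) b)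
  rw [← dbl_const_mul _ mm, ← dbl_add (mm.const_mul _)]
  refine lintegral_congr fun y => lintegral_congr fun z => ?_
  rcases le_or_gt y 0 with hy | hy
  · simp [hψ.zero y hy]
  have i1 := hW.nonneg y z
  have i2 := hψ.nonneg y
  have i3 := hχ.nonneg z
  rw [show (2:ℝ≥0∞) = ENNReal.ofReal 2 by simp, rpow_zero, one_mul,
    ← ENNReal.ofReal_mul (by positivity), ← ENNReal.ofReal_mul (by positivity),
    ← ENNReal.ofReal_add (by positivity) (by positivity)]
  unfold Kern
  ring_nf

noncomputable def qw (α : ℝ) : ℝ → ℝ≥0∞ :=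
  (Ioi (0:ℝ)).indicator fun t => ENNReal.ofReal (t ^ (-α - 1))

lemma qw_meas : Measurable (qw α) :=
  Measurable.indicator (by fun_prop) measurableSet_Ioi

lemma y_pow {y : ℝ} (hy : 0 < y) : y * y ^ (-α - 1) = y ^ (-α) := by
  rw [mul_comm, ← rpow_add_one hy.ne']; ring_nf

lemma LL_w (hW : GW α W) (hε : 0 ≤ ε) (hψ : PosF ψ) (hχ : PosF χ) :
    ∫⁻ t, qw α t * LL ε W ψ χ t ≤
      ∫⁻ y, ∫⁻ z, ENNReal.ofReal (y ^ (-α) * Kern ε W y z * (ψ y * χ z)) := by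
  rw [LL_int hW hψ.meas hχ.meas]
  refine lintegral_mono fun y => lintegral_mono fun z => ?_
  dsimp only
  rcases le_or_gt y 0 with hy | hy
  · simp [hψ.zero y hy]
  have k := kern_pos hW hε y z
  have i2 := hψ.nonneg y
  have i3 := hχ.nonneg z
  have k0 : 0 ≤ Kern ε W y z := by linarith
  rw [qw, indicator_of_mem (show y ∈ Ioi 0 from hy), ← ENNReal.ofReal_mul (by positivity), ← y_pow hy]
  apply ENNReal.ofReal_le_ofReal
  apply le_of_eq; ring

lemma GG_w1 (hα : 0 < α) (hW : GW α W) (hε : 0 ≤ ε) (hψ : PosF ψ) (hχ : PosF χ) :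
    ∫⁻ t, qw α t * GG ε W ψ χ t ≤
      ∫⁻ y, ∫⁻ z, ENNReal.ofReal (y ^ (-α) * Kern ε W y z * (ψ y * χ z)) := by
  rw [GG_int hW hψ.meas hχ.meas qw_meas]
  refine lintegral_mono fun y => lintegral_mono fun z => ?_
  dsimp only
  rcases le_or_gt y 0 with hy | hy
  · simp [hψ.zero y hy]
  rcases le_or_gt z 0 with hz | hz
  · simp [hχ.zero z hz]
  have k := kern_pos hW hε y z
  have i2 := hψ.nonneg y
  have i3 := hχ.nonneg z
  have k0 : 0 ≤ Kern ε W y z := by linarith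
  rw [qw, indicator_of_mem (show y + z ∈ Ioi 0 from add_pos hy hz), ← ENNReal.ofReal_mul (by positivity),
    ← y_pow hy]
  apply ENNReal.ofReal_le_ofReal
  have : (y + z) ^ (-α - 1) ≤ y ^ (-α - 1) :=
    rpow_le_rpow_of_nonpos hy (by linarith) (by linarith)
  calc _ ≤ y * Kern ε W y z * (ψ y * χ z) * y ^ (-α - 1) := by gcongr
    _ = _ := by ring

lemma GG_w2 (hα : 0 < α) (hW : GW α W) (hε : 0 ≤ ε) (hψ : PosF ψ) (hχ : PosF χ) :
    ∫⁻ t, qw α t * GG ε W χ ψ t ≤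
      ∫⁻ y, ∫⁻ z, ENNReal.ofReal (y ^ (-α) * Kern ε W y z * (ψ y * χ z)) := by
  have mk := kern_meas (ε := ε) hW
  have a := hψ.meas
  have b := hχ.meas
  rw [GG_int hW hχ.meas hψ.meas qw_meas,
    dbl_swap (F := fun y z => ENNReal.ofReal (y ^ (-α) * Kern ε W y z * (ψ y * χ z))) (by fun_prop)]
  refine lintegral_mono fun y => lintegral_mono fun z => ?_
  dsimp only
  rcases le_or_gt y 0 with hy | hy
  · simp [hχ.zero y hy]
  rcases le_or_gt z 0 with hz | hz
  · simp [hψ.zero z hz]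
  have ks : Kern ε W z y = Kern ε W y z := by unfold Kern; rw [hW.symm]
  have k := kern_pos hW hε y z
  have i2 := hχ.nonneg y
  have i3 := hψ.nonneg z
  have k0 : 0 ≤ Kern ε W y z := by linarith
  have yz : 0 < y + z := add_pos hy hz
  rw [qw, indicator_of_mem (show y + z ∈ Ioi 0 from yz), ← ENNReal.ofReal_mul (by positivity), ks]
  apply ENNReal.ofReal_le_ofReal
  have h1 : (y + z) ^ (-α) ≤ z ^ (-α) :=
    rpow_le_rpow_of_nonpos hz (by linarith) (by linarith)
  have h2 : y * (y + z) ^ (-α - 1) ≤ (y + z) ^ (-α) := by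
    rw [← y_pow yz]
    gcongr
    linarith
  calc _ = (y * (y + z) ^ (-α - 1)) * (Kern ε W y z * (χ y * ψ z)) := by ring
    _ ≤ z ^ (-α) * (Kern ε W y z * (χ y * ψ z)) := by gcongr; exact h2.trans h1
    _ = _ := by ring

lemma Pair.A_est (h : Pair α ε W φ₁ φ₂ C θ) :
    ENNReal.ofReal (2 * (1 - θ)) * mom (-α) (gg φ₁ φ₂) ≤
      ENNReal.ofReal (1 + α) * mom (-α) (gg φ₁ φ₂) +
      (6 * C * mom 0 (gg φ₁ φ₂) + 6 * ENNReal.ofReal θ * nrm α φ₁ φ₂) := by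
  have a := h.hα.1
  have a1 := h.hα.2
  have g := h.gpos
  have gm := g.meas
  have q1 := h.p1.pos
  have q2 := h.p2.pos
  have mE1 := LL_meas (ε := ε) h.hW q2.meas gm
  have mE2 := GG_meas (ε := ε) h.hW gm q1.meas
  have mE3 := GG_meas (ε := ε) h.hW q2.meas gm
  have mE : Measurable (EE ε W φ₁ φ₂) := mE1.add (mE2.add mE3)
  have w := weight_ineq a (p := fun t => ENNReal.ofReal (t * gg φ₁ φ₂ t)) (by fun_prop) mE
    (q := fun x => ENNReal.ofReal (x ^ 2 * gg φ₁ φ₂ x)) (by fun_prop) ENNReal.ofReal_ne_top h.A_pre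
  have e1 : ∫⁻ t in Ioi 0, ENNReal.ofReal (t ^ (-α - 1)) * ENNReal.ofReal (t * gg φ₁ φ₂ t) =
      mom (-α) (gg φ₁ φ₂) := by
    rw [mom, ← lintegral_indicator measurableSet_Ioi]
    refine lintegral_congr fun t => ?_
    rcases le_or_gt t 0 with ht | ht
    · rw [indicator_of_notMem (by simpa using ht), g.zero t ht]; simp
    · rw [indicator_of_mem (show t ∈ Ioi 0 from ht), ← ENNReal.ofReal_mul (by positivity), ← y_pow ht]
      ring_nf
  have e2 : ∫⁻ x in Ioi 0, ENNReal.ofReal ((1 + α) * x ^ (-α - 2)) * ENNReal.ofReal (x ^ 2 * gg φ₁ φ₂ x) =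
      ENNReal.ofReal (1 + α) * mom (-α) (gg φ₁ φ₂) := by
    rw [mom, ← lintegral_const_mul' _ _ ENNReal.ofReal_ne_top, ← lintegral_indicator measurableSet_Ioi]
    refine lintegral_congr fun t => ?_
    rcases le_or_gt t 0 with ht | ht
    · rw [indicator_of_notMem (by simpa using ht), g.zero t ht]; simp
    · rw [indicator_of_mem (show t ∈ Ioi 0 from ht), ← ENNReal.ofReal_mul (by positivity),
        ← ENNReal.ofReal_mul (by positivity)]
      have : t ^ (-α) = t ^ (-α - 2) * t ^ 2 := by
        rw [← rpow_two, ← rpow_add ht]; ring_nf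
      rw [this]
      ring_nf
  have e3 : ∫⁻ t in Ioi 0, ENNReal.ofReal (t ^ (-α - 1)) * EE ε W φ₁ φ₂ t =
      (∫⁻ t, qw α t * LL ε W φ₂ (gg φ₁ φ₂) t) + ((∫⁻ t, qw α t * GG ε W (gg φ₁ φ₂) φ₁ t) +
        ∫⁻ t, qw α t * GG ε W φ₂ (gg φ₁ φ₂) t) := by
    have mq := qw_meas (α := α)
    rw [← lintegral_add_left (by fun_prop), ← lintegral_add_left (by fun_prop),
      ← lintegral_indicator measurableSet_Ioi]
    refine lintegral_congr fun t => ?_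
    rw [← mul_add, ← mul_add]
    unfold qw EE
    by_cases ht : t ∈ Ioi (0:ℝ)
    · rw [indicator_of_mem ht, indicator_of_mem ht]
    · rw [indicator_of_notMem ht, indicator_of_notMem ht, zero_mul]
  rw [e1, e2, e3] at w
  refine w.trans (add_le_add le_rfl ?_)
  have cb : ∀ φ : ℝ → ℝ, Prof α ε W φ → mom (-α) φ ≤ C →
      ENNReal.ofReal ε * mom (-(2 * α)) φ ≤ ENNReal.ofReal θ →
      ∫⁻ y, ∫⁻ z, ENNReal.ofReal (y ^ (-α) * Kern ε W y z * (φ y * gg φ₁ φ₂ z)) ≤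
        2 * C * mom 0 (gg φ₁ φ₂) + 2 * ENNReal.ofReal θ * nrm α φ₁ φ₂ := fun φ p mC s => by
    refine (core_bound h.hW h.hε.le p.pos g).trans ?_
    rw [mul_assoc 2, mul_assoc 2, two_mul (ENNReal.ofReal θ * _)]
    refine add_le_add (mul_le_mul' le_rfl (mul_le_mul' mC le_rfl)) (add_le_add ?_ ?_)
    · refine mul_le_mul' (ENNReal.ofReal_le_ofReal h.hεθ) ?_
      calc _ ≤ 1 * nrm α φ₁ φ₂ := mul_le_mul' (p.mom0 h.hW h.hε.le) (h.g_mom le_rfl (by linarith))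
        _ = _ := one_mul _
    · rw [← mul_assoc]
      exact mul_le_mul' s (h.g_mom (by linarith) (by linarith))
  have c1 := cb φ₁ h.p1 (h.m1 _ le_rfl (by linarith)) h.s1
  have c2 := cb φ₂ h.p2 (h.m2 _ le_rfl (by linarith)) h.s2
  refine (add_le_add ((LL_w h.hW h.hε.le q2 g).trans c2) (add_le_add
    ((GG_w2 a h.hW h.hε.le q1 g).trans c1) ((GG_w1 a h.hW h.hε.le q2 g).trans c2))).trans (le_of_eq ?_)
  ring

lemma Pair.g0 (h : Pair α ε W φ₁ φ₂ C θ) {s : ℝ} (hs : 0 < s) :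
    mom 0 (gg φ₁ φ₂) ≤ ENNReal.ofReal (s ^ α) * mom (-α) (gg φ₁ φ₂) +
      ENNReal.ofReal (s ^ (-2:ℝ)) * mom 2 (gg φ₁ φ₂) := by
  have a := h.hα.1
  have g := h.gpos
  unfold mom
  rw [← lintegral_const_mul' _ _ ENNReal.ofReal_ne_top, ← lintegral_const_mul' _ _ ENNReal.ofReal_ne_top,
    ← lintegral_add_left ((g.meas_mom _).const_mul _)]
  refine lintegral_mono fun x => ?_
  dsimp only
  rcases le_or_gt x 0 with hx | hx
  · simp [g.zero x hx]
  have g1 := g.nonneg x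
  rw [← ENNReal.ofReal_mul (by positivity), ← ENNReal.ofReal_mul (by positivity),
    ← ENNReal.ofReal_add (by positivity) (by positivity)]
  apply ENNReal.ofReal_le_ofReal
  rw [← mul_assoc, ← mul_assoc, ← add_mul]
  refine mul_le_mul_of_nonneg_right ?_ g1
  rw [rpow_zero, rpow_neg hx.le, rpow_neg hs.le, ← div_eq_mul_inv, inv_mul_eq_div,
    ← div_rpow hs.le hx.le, ← div_rpow hx.le hs.le]
  rcases le_total s x with hsx | hsx
  · have : 1 ≤ (x / s) ^ (2:ℝ) := one_le_rpow ((one_le_div hs).2 hsx) (by norm_num)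
    have : 0 ≤ (s / x) ^ α := by positivity
    linarith
  · have : 1 ≤ (s / x) ^ α := one_le_rpow ((one_le_div hx).2 hsx) a.le
    have : 0 ≤ (x / s) ^ (2:ℝ) := by positivity
    linarith
end

end part18

section part19

lemma contraction {α : ℝ} (hα : α ∈ Ioo (0:ℝ) 1) {C : ℝ≥0} (hC : 1 ≤ C) :
    ∃ θ > (0:ℝ), θ ≤ 1 / 32 ∧ ∀ (ε : ℝ) (W : ℝ → ℝ → ℝ) (φ₁ φ₂ : ℝ → ℝ),
      Pair α ε W φ₁ φ₂ C θ → mom 2 (gg φ₁ φ₂) = 0 := by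
  obtain ⟨ha, ha1⟩ := hα
  have hC' : (1:ℝ) ≤ C := by exact_mod_cast hC
  set κ := 1 - α with hκ
  have hκ0 : 0 < κ := by linarith
  have hκ1 : κ ≤ 1 := by linarith
  set s : ℝ := (κ / (24 * C)) ^ (1 / α) with hs
  have hs0 : 0 < s := by positivity
  have hsα : s ^ α = κ / (24 * C) := by
    rw [hs, ← rpow_mul (by positivity), one_div_mul_cancel ha.ne', rpow_one]
  set T : ℝ := s ^ (-2:ℝ) with hT
  have hT0 : 0 < T := by positivity
  set M := 2 * (6 * C * T + 6) / κ with hM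
  have hM0 : 0 < M := by positivity
  set θ := min (κ / 32) (1 / (60000 * C * (M + 1))) with hθd
  have hθ : 0 < θ := lt_min (by positivity) (by positivity)
  have hθ1 : θ ≤ κ / 32 := min_le_left _ _
  have hθ2 : θ ≤ 1 / (60000 * C * (M + 1)) := min_le_right _ _
  refine ⟨θ, hθ, by linarith, fun ε W φ₁ φ₂ h => ?_⟩
  have hn := h.nrm_lt.ne
  have fin : ∀ s, -α ≤ s → s ≤ 2 → mom s (gg φ₁ φ₂) ≠ ∞ := fun s u v =>
    ne_top_of_le_ne_top hn (h.g_mom u v)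
  have fA := fin (-α) le_rfl (by linarith)
  have fB := fin 2 (by linarith) le_rfl
  have f0 := fin 0 (by linarith) (by linarith)
  have I1 := h.A_est
  have I2 := h.g0 hs0
  have I3 := h.B_est
  unfold nrm at I1 I3
  set A := mom (-α) (gg φ₁ φ₂)
  set B := mom 2 (gg φ₁ φ₂)
  set m := mom 0 (gg φ₁ φ₂)
  lift A to ℝ≥0 using fA with a
  lift B to ℝ≥0 using fB with b
  lift m to ℝ≥0 using f0 with m'
  have cv : ∀ r : ℝ≥0, (r : ℝ≥0∞) = ENNReal.ofReal (r : ℝ) := fun r => by simp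
  have six : (6:ℝ≥0∞) = ENNReal.ofReal 6 := by simp
  have h2θ : 0 ≤ 2 * (1 - θ) := by linarith
  rw [six] at I1
  simp only [cv] at I1 I2 I3
  rw [← ENNReal.ofReal_add (by positivity) (by positivity), ← ENNReal.ofReal_mul h2θ,
    ← ENNReal.ofReal_mul (by positivity), ← ENNReal.ofReal_mul (by positivity),
    ← ENNReal.ofReal_mul (by positivity), ← ENNReal.ofReal_mul (by positivity),
    ← ENNReal.ofReal_mul (by positivity), ← ENNReal.ofReal_add (by positivity) (by positivity),
    ← ENNReal.ofReal_add (by positivity) (by positivity),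
    ENNReal.ofReal_le_ofReal_iff (by positivity)] at I1
  rw [← ENNReal.ofReal_mul (by positivity), ← ENNReal.ofReal_mul (by positivity),
    ← ENNReal.ofReal_add (by positivity) (by positivity),
    ENNReal.ofReal_le_ofReal_iff (by positivity)] at I2
  rw [← ENNReal.ofReal_add (by positivity) (by positivity), ← ENNReal.ofReal_mul (by positivity),
    ENNReal.ofReal_le_ofReal_iff (by positivity)] at I3
  have a0 : (0:ℝ) ≤ a := a.2
  have b0 : (0:ℝ) ≤ b := b.2
  rw [hsα, ← hT] at I2
  have J2 : 6 * (C:ℝ) * m' ≤ κ / 4 * a + 6 * C * T * b := by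
    calc 6 * (C:ℝ) * m' ≤ 6 * C * (κ / (24 * C) * a + T * b) := by gcongr
      _ = _ := by field_simp; ring
  have t1 : θ * a ≤ κ / 32 * a := by gcongr
  have t2 : θ * b ≤ 1 * b := by gcongr; linarith
  have J : (a:ℝ) ≤ M * b := by
    rw [hM, div_mul_eq_mul_div, le_div_iff₀ hκ0]
    have : α = 1 - κ := by rw [hκ]; ring
    rw [this] at I1
    nlinarith
  have K : (b:ℝ) ≤ 1 / 2 * b := by
    calc (b:ℝ) ≤ 30000 * C * θ * (a + b) := I3
      _ ≤ 30000 * C * (1 / (60000 * C * (M + 1))) * (M * b + b) := by gcongr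
      _ = _ := by field_simp; ring
  have : (b:ℝ) = 0 := by linarith
  exact_mod_cast this

theorem uniq {α : ℝ} (hα : α ∈ Ioo (0:ℝ) 1) {W : ℝ → ℝ → ℝ} (hW : GW α W)
    (hlow : 1 / 2 ≤ α → ∃ cs > (0:ℝ), ∀ x y : ℝ, 0 < x → 0 < y → cs * (x ^ (-α) * y ^ α) ≤ W x y) :
    ∃ ε₀ > (0:ℝ), ∀ ε φ₁ φ₂, 0 < ε → ε < ε₀ → Prof α ε W φ₁ → Prof α ε W φ₂ →
      ∀ᵐ x, φ₁ x = φ₂ x := by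
  obtain ⟨C₁, hC1, H1⟩ := mom_bound hα
  obtain ⟨C₂, ε₂, e2, e2', H2⟩ := neg_bound hα hα
  set C := C₁ + C₂ with hC
  have hC1' : 1 ≤ C := hC1.trans (by rw [hC]; exact le_self_add)
  obtain ⟨θ, hθ, hθ1, H⟩ := contraction hα hC1'
  obtain ⟨ε₃, e3, e3', H3⟩ := Prof.close hα (η := θ ^ 2) (by positivity) (θ / 2) (by positivity)
  obtain ⟨ε₄, e4, e4', H4⟩ := neg_small hα hW hlow hθ
  refine ⟨min (min ε₂ ε₃) (min ε₄ θ), lt_min (lt_min e2 e3) (lt_min e4 hθ),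
    fun ε φ₁ φ₂ he he' p1 p2 => ?_⟩
  simp only [lt_min_iff] at he'
  obtain ⟨⟨k2, k3⟩, k4, k5⟩ := he'
  have hε1 : ε ≤ 1 := by linarith
  have mm : ∀ φ, Prof α ε W φ → ∀ s, -α ≤ s → s ≤ 2 → mom s φ ≤ C := fun φ p s h1 h2 => by
    have a1 := H1 W φ ε hW he.le hε1 p
    have a2 := H2 ε W φ he.le k2 hW p
    rcases le_or_gt 0 s with hs | hs
    · refine (a1 s hs h2).trans ?_
      rw [hC]; push_cast; exact le_self_add
    · refine (mom_interp p.pos h1 hs.le).trans ?_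
      rw [hC, add_comm]; push_cast
      exact add_le_add (a1 0 le_rfl (by norm_num)) a2
  have ll : ∀ φ, Prof α ε W φ → ENNReal.ofReal (1 - θ) ≤ mom 0 φ := fun φ p => by
    have a1 := (H3 ε W φ he.le k3 hW p).2
    refine le_trans ?_ (TT_le_mom0 (θ / 2))
    rw [ENNReal.ofReal_le_iff_le_toReal (p.TT_ne_top hW he.le _)]
    have := add_one_le_exp (-(θ / 2))
    unfold NN at a1
    nlinarith
  have P : Pair α ε W φ₁ φ₂ C θ :=
    ⟨hα, hW, he, hε1, p1, p2, hC1', mm _ p1, mm _ p2, hθ, by linarith,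
      (H3 ε W φ₁ he.le k3 hW p1).1, (H3 ε W φ₂ he.le k3 hW p2).1, k5.le,
      H4 ε φ₁ he k4 p1, H4 ε φ₂ he k4 p2, ll _ p1, ll _ p2⟩
  have z := H ε W φ₁ φ₂ P
  unfold mom at z
  rw [lintegral_eq_zero_iff (P.gpos.meas_mom 2)] at z
  filter_upwards [z] with x hx
  rcases le_or_gt x 0 with h0 | h0
  · rw [p1.pos.zero x h0, p2.pos.zero x h0]
  · simp only [Pi.zero_apply, ENNReal.ofReal_eq_zero] at hx
    have g0 := P.gpos.nonneg x
    have : 0 < x ^ (2:ℝ) := by positivity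
    have : gg φ₁ φ₂ x = 0 := by nlinarith
    unfold gg at this
    linarith [abs_eq_zero.1 this]

end part19

section part20

section reduction
variable {α ε : ℝ} {W : ℝ → ℝ → ℝ} {φ : ℝ → ℝ}

noncomputable def FluxG (ε : ℝ) (W : ℝ → ℝ → ℝ) (φ : ℝ → ℝ) (y z : ℝ) : ℝ≥0∞ :=
  ENNReal.ofReal (y * Kern ε W y z * (φ y * φ z))

noncomputable def FluxI (ε : ℝ) (W : ℝ → ℝ → ℝ) (φ : ℝ → ℝ) (x : ℝ) : ℝ≥0∞ :=
  ∫⁻ y, ∫⁻ z, FluxG ε W φ y z * (Ioo y (y + z)).indicator 1 x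

lemma FluxG_zero1 (hφ : PosF φ) {y : ℝ} (hy : y ≤ 0) (z : ℝ) : FluxG ε W φ y z = 0 := by
  simp [FluxG, hφ.zero y hy]

lemma FluxG_zero2 (hφ : PosF φ) {z : ℝ} (hz : z ≤ 0) (y : ℝ) : FluxG ε W φ y z = 0 := by
  simp [FluxG, hφ.zero z hz]

lemma FluxG_meas (hW : GW α W) (hφ : PosF φ) : Measurable (fun p : ℝ × ℝ => FluxG ε W φ p.1 p.2) :=
  flux_meas hW hφ.meas hφ.meas

lemma FluxG_bound (hα : α ∈ Ioo (0:ℝ) 1) (hW : GW α W) (hε : 0 ≤ ε) (hφ : PosF φ) {a b c : ℝ}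
    (ha : 0 < a) (hc : 0 < c) : ∃ C : ℝ, 0 ≤ C ∧ ∀ y z, a ≤ y → y ≤ b → c ≤ z →
      FluxG ε W φ y z ≤ ENNReal.ofReal (C * (y ^ (1:ℝ) * φ y)) * ENNReal.ofReal (z ^ (1:ℝ) * φ z) := by
  obtain ⟨h0, h1⟩ := hα
  rcases lt_or_ge b a with hb | hb
  · exact ⟨0, le_rfl, fun y z u v => by linarith⟩
  have hb0 : 0 < b := by linarith
  refine ⟨2 / c + ε * (b ^ α * (c ^ (-α) / c) + a ^ (-α) * (c ^ (α - 1))), by positivity, ?_⟩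
  intro y z hy hyb hz
  have hy0 : 0 < y := by linarith
  have hz0 : 0 < z := by linarith
  have k1 : 2 ≤ 2 / c * z := by
    rw [div_mul_eq_mul_div, le_div_iff₀ hc]; linarith
  have k2 : y ^ α * z ^ (-α) ≤ b ^ α * (c ^ (-α) / c) * z := by
    have u1 : y ^ α ≤ b ^ α := rpow_le_rpow hy0.le hyb h0.le
    have u2 : z ^ (-α) ≤ c ^ (-α) := rpow_le_rpow_of_nonpos hc hz (by linarith)
    have u3 : c ^ (-α) ≤ c ^ (-α) / c * z := by
      rw [div_mul_eq_mul_div, le_div_iff₀ hc]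
      exact mul_le_mul_of_nonneg_left hz (by positivity)
    rw [mul_assoc]
    exact mul_le_mul u1 (u2.trans u3) (by positivity) (by positivity)
  have k3 : y ^ (-α) * z ^ α ≤ a ^ (-α) * c ^ (α - 1) * z := by
    have u1 : y ^ (-α) ≤ a ^ (-α) := rpow_le_rpow_of_nonpos ha hy (by linarith)
    have u2 : z ^ (α - 1) ≤ c ^ (α - 1) := rpow_le_rpow_of_nonpos hc hz (by linarith)
    have u3 : z ^ α = z ^ (α - 1) * z := by
      rw [← rpow_add_one hz0.ne']; ring_nf
    rw [u3, mul_assoc]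
    exact mul_le_mul u1 (mul_le_mul_of_nonneg_right u2 hz0.le) (by positivity) (by positivity)
  have k4 := hW.ub y z hy0 hz0
  have k5 : Kern ε W y z ≤ (2 / c + ε * (b ^ α * (c ^ (-α) / c) + a ^ (-α) * (c ^ (α - 1)))) * z := by
    unfold Kern
    have := mul_le_mul_of_nonneg_left (k4.trans (add_le_add k2 k3)) hε
    linarith
  have p1 := hφ.nonneg y
  have p2 := hφ.nonneg z
  rw [← ENNReal.ofReal_mul (by positivity)]
  apply ENNReal.ofReal_le_ofReal
  rw [rpow_one, rpow_one]
  have := mul_le_mul_of_nonneg_right k5 (show 0 ≤ y * (φ y * φ z) by positivity)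
  linarith

lemma FluxG_inner (hα : α ∈ Ioo (0:ℝ) 1) (hW : GW α W) (hε : 0 ≤ ε) (hφ : PosF φ)
    (hm : mom 1 φ = 1) {y c : ℝ} (hy : 0 < y) (hc : 0 < c) :
    ∫⁻ z in Ici c, FluxG ε W φ y z < ∞ := by
  obtain ⟨C, hC, h⟩ := FluxG_bound (b := y) hα hW hε hφ hy hc
  calc ∫⁻ z in Ici c, FluxG ε W φ y z ≤ ∫⁻ z in Ici c,
        ENNReal.ofReal (C * (y ^ (1:ℝ) * φ y)) * ENNReal.ofReal (z ^ (1:ℝ) * φ z) :=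
        setLIntegral_mono' measurableSet_Ici fun z hz => h y z le_rfl le_rfl hz
    _ ≤ ∫⁻ z, ENNReal.ofReal (C * (y ^ (1:ℝ) * φ y)) * ENNReal.ofReal (z ^ (1:ℝ) * φ z) :=
        setLIntegral_le_lintegral _ _
    _ = ENNReal.ofReal (C * (y ^ (1:ℝ) * φ y)) * mom 1 φ :=
        lintegral_const_mul _ (hφ.meas_mom 1)
    _ < ∞ := by rw [hm, mul_one]; exact ENNReal.ofReal_lt_top

lemma FluxG_outer (hα : α ∈ Ioo (0:ℝ) 1) (hW : GW α W) (hε : 0 ≤ ε) (hφ : PosF φ)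
    (hm : mom 1 φ = 1) {a b c : ℝ} (ha : 0 < a) (hc : 0 < c) :
    ∫⁻ y in Icc a b, ∫⁻ z in Ici c, FluxG ε W φ y z < ∞ := by
  obtain ⟨C, hC, h⟩ := FluxG_bound (b := b) hα hW hε hφ ha hc
  calc ∫⁻ y in Icc a b, ∫⁻ z in Ici c, FluxG ε W φ y z ≤ ∫⁻ y in Icc a b,
        ENNReal.ofReal C * ENNReal.ofReal (y ^ (1:ℝ) * φ y) := by
        refine setLIntegral_mono' measurableSet_Icc fun y hy => ?_
        calc ∫⁻ z in Ici c, FluxG ε W φ y z ≤ ∫⁻ z in Ici c,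
            ENNReal.ofReal (C * (y ^ (1:ℝ) * φ y)) * ENNReal.ofReal (z ^ (1:ℝ) * φ z) :=
            setLIntegral_mono' measurableSet_Ici fun z hz => h y z hy.1 hy.2 hz
          _ ≤ ∫⁻ z, ENNReal.ofReal (C * (y ^ (1:ℝ) * φ y)) * ENNReal.ofReal (z ^ (1:ℝ) * φ z) :=
            setLIntegral_le_lintegral _ _
          _ = ENNReal.ofReal (C * (y ^ (1:ℝ) * φ y)) * mom 1 φ :=
            lintegral_const_mul _ (hφ.meas_mom 1)
          _ = _ := by rw [hm, mul_one, ENNReal.ofReal_mul hC]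
    _ ≤ ∫⁻ y, ENNReal.ofReal C * ENNReal.ofReal (y ^ (1:ℝ) * φ y) :=
        setLIntegral_le_lintegral _ _
    _ = ENNReal.ofReal C * mom 1 φ := lintegral_const_mul _ (hφ.meas_mom 1)
    _ < ∞ := by rw [hm, mul_one]; exact ENNReal.ofReal_lt_top

lemma DD_fin (hα : α ∈ Ioo (0:ℝ) 1) (hW : GW α W) (hε : 0 ≤ ε) (hφ : PosF φ)
    (hm : mom 1 φ = 1) (heq : ∀ᵐ x, 0 < x → x ^ 2 * φ x = (FluxI ε W φ x).toReal) {x : ℝ}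
    (hx : 0 < x) : ∫⁻ y in Iio x, ∫⁻ z in Ici x, FluxG ε W φ y z < ∞ := by
  by_contra hD
  rw [not_lt, top_le_iff] at hD
  have step : ∀ t, 0 < t → t < x → FluxI ε W φ t = ∞ := by
    intro t ht htx
    have e1 : ∫⁻ y in Iio x, ∫⁻ z in Ici x, FluxG ε W φ y z ≤
        (∫⁻ y in Iio t, ∫⁻ z in Ici x, FluxG ε W φ y z) +
          ∫⁻ y in Icc t x, ∫⁻ z in Ici x, FluxG ε W φ y z := by
      refine (lintegral_mono_set ?_).trans (lintegral_union_le _ _ _)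
      intro y hy
      rcases lt_or_ge y t with h | h
      · exact Or.inl h
      · exact Or.inr ⟨h, le_of_lt hy⟩
    have e2 := (FluxG_outer (b := x) hα hW hε hφ hm ht hx).ne
    have e3 : ∫⁻ y in Iio t, ∫⁻ z in Ici x, FluxG ε W φ y z = ∞ := by
      rw [hD, top_le_iff, ENNReal.add_eq_top] at e1
      exact e1.resolve_right e2
    rw [eq_top_iff, ← e3, FluxI, ← lintegral_indicator measurableSet_Iio]
    refine lintegral_mono fun y => ?_
    by_cases hy : y ∈ Iio t
    · rw [indicator_of_mem hy, ← lintegral_indicator measurableSet_Ici]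
      refine lintegral_mono fun z => ?_
      by_cases hz : z ∈ Ici x
      · rw [indicator_of_mem hz]
        rcases le_or_gt y 0 with h0 | h0
        · rw [FluxG_zero1 hφ h0]; exact bot_le
        · have : t ∈ Ioo y (y + z) := ⟨hy, by have : x ≤ z := hz; linarith⟩
          simp [this]
      · rw [indicator_of_notMem hz]; exact bot_le
    · rw [indicator_of_notMem hy]; exact bot_le
  have hz : ∀ᵐ y ∂(volume.restrict (Iio x)), ∫⁻ z in Ici x, FluxG ε W φ y z = 0 := by
    rw [ae_restrict_iff' measurableSet_Iio]
    filter_upwards [heq] with y hy hyx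
    rcases le_or_gt y 0 with h0 | h0
    · simp [FluxG_zero1 hφ h0]
    · have h1 := hy h0
      rw [step y h0 hyx, ENNReal.toReal_top] at h1
      have : φ y = 0 := by
        rcases mul_eq_zero.1 h1 with h | h
        · nlinarith [pow_pos h0 2]
        · exact h
      simp [FluxG, this]
  rw [lintegral_congr_ae hz] at hD
  simp at hD

lemma FluxI_fin_loc (hα : α ∈ Ioo (0:ℝ) 1) (hW : GW α W) (hε : 0 ≤ ε) (hφ : PosF φ)
    (hm : mom 1 φ = 1) (heq : ∀ᵐ x, 0 < x → x ^ 2 * φ x = (FluxI ε W φ x).toReal) {a b : ℝ}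
    (ha : 0 < a) (hab : a < b) : ∫⁻ x, (Ioo a b).indicator 1 x * FluxI ε W φ x < ∞ := by
  have hc : 0 < a / 2 := by linarith
  set c := a / 2 with hcd
  have hq : Measurable ((Ioo a b).indicator (1 : ℝ → ℝ≥0∞)) :=
    measurable_one.indicator measurableSet_Ioo
  have hG := FluxG_meas (ε := ε) hW hφ
  unfold FluxI
  rw [tonelli_flux hG hq]
  have d1 := DD_fin hα hW hε hφ hm heq hc
  have d2 := FluxG_outer (b := b) hα hW hε hφ hm hc hc
  set A : ℝ → ℝ → ℝ≥0∞ := fun y z => (Iio c).indicator 1 y * (Ici c).indicator 1 z * FluxG ε W φ y z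
    with hA
  set B : ℝ → ℝ → ℝ≥0∞ := fun y z => (Icc c b).indicator 1 y * (Ici c).indicator 1 z * FluxG ε W φ y z
    with hB
  have iA : Measurable (fun p : ℝ × ℝ => A p.1 p.2) :=
    ((measurable_one.indicator measurableSet_Iio).comp measurable_fst).mul
      ((measurable_one.indicator measurableSet_Ici).comp measurable_snd) |>.mul hG
  have iB : Measurable (fun p : ℝ × ℝ => B p.1 p.2) :=
    ((measurable_one.indicator measurableSet_Icc).comp measurable_fst).mul
      ((measurable_one.indicator measurableSet_Ici).comp measurable_snd) |>.mul hG
  have eA : ∫⁻ y, ∫⁻ z, A y z = ∫⁻ y in Iio c, ∫⁻ z in Ici c, FluxG ε W φ y z := by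
    rw [← lintegral_indicator measurableSet_Iio]
    refine lintegral_congr fun y => ?_
    by_cases hy : y ∈ Iio c
    · rw [indicator_of_mem hy, ← lintegral_indicator measurableSet_Ici]
      refine lintegral_congr fun z => ?_
      by_cases hz : z ∈ Ici c <;> simp only [hA, indicator_of_mem hy, hz, indicator_of_mem,
        indicator_of_notMem, not_false_eq_true, Pi.one_apply, one_mul, mul_zero, zero_mul]
    · simp [hA, hy]
  have eB : ∫⁻ y, ∫⁻ z, B y z = ∫⁻ y in Icc c b, ∫⁻ z in Ici c, FluxG ε W φ y z := by
    rw [← lintegral_indicator measurableSet_Icc]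
    refine lintegral_congr fun y => ?_
    by_cases hy : y ∈ Icc c b
    · rw [indicator_of_mem hy, ← lintegral_indicator measurableSet_Ici]
      refine lintegral_congr fun z => ?_
      by_cases hz : z ∈ Ici c <;> simp only [hB, indicator_of_mem hy, hz, indicator_of_mem,
        indicator_of_notMem, not_false_eq_true, Pi.one_apply, one_mul, mul_zero, zero_mul]
    · simp only [hB, hy, indicator_of_notMem, not_false_eq_true, zero_mul, lintegral_zero]
  have hb0 : 0 < b := by linarith
  have pt : ∀ y z, FluxG ε W φ y z * ∫⁻ x in Ioo y (y + z), (Ioo a b).indicator 1 x ≤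
      ENNReal.ofReal b * A y z + ENNReal.ofReal b * B y z + ENNReal.ofReal b * A z y := by
    intro y z
    rcases le_or_gt y 0 with hy | hy
    · rw [FluxG_zero1 hφ hy, zero_mul]; exact bot_le
    rcases le_or_gt z 0 with hz | hz
    · rw [FluxG_zero2 hφ hz, zero_mul]; exact bot_le
    have v0 : ∫⁻ x in Ioo y (y + z), (Ioo a b).indicator 1 x =
        volume (Ioo a b ∩ Ioo y (y + z)) := by
      rw [lintegral_indicator_one measurableSet_Ioo, Measure.restrict_apply measurableSet_Ioo]
    rw [v0]
    have v1 : volume (Ioo a b ∩ Ioo y (y + z)) ≤ ENNReal.ofReal b := by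
      refine (measure_mono inter_subset_left).trans ?_
      rw [Real.volume_Ioo]; exact ENNReal.ofReal_le_ofReal (by linarith)
    have v2 : volume (Ioo a b ∩ Ioo y (y + z)) ≤ ENNReal.ofReal z := by
      refine (measure_mono inter_subset_right).trans ?_
      rw [Real.volume_Ioo]; exact ENNReal.ofReal_le_ofReal (by linarith)
    rcases (Ioo a b ∩ Ioo y (y + z)).eq_empty_or_nonempty with he | ⟨t, ht1, ht2⟩
    · rw [he]; simp
    have hyb : y < b := ht2.1.trans ht1.2
    have hyz : a < y + z := ht1.1.trans ht2.2
    rcases lt_or_ge y c with hyc | hyc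
    · have hzc : c ≤ z := by linarith
      have : A y z = FluxG ε W φ y z := by
        simp only [hA, indicator_of_mem (show y ∈ Iio c from hyc),
          indicator_of_mem (show z ∈ Ici c from hzc), Pi.one_apply, one_mul]
      rw [this, mul_comm]
      exact (mul_le_mul_left v1 _).trans (le_self_add.trans le_self_add)
    rcases lt_or_ge z c with hzc | hzc
    · have : A z y = FluxG ε W φ z y := by
        simp only [hA, indicator_of_mem (show z ∈ Iio c from hzc),
          indicator_of_mem (show y ∈ Ici c from hyc), Pi.one_apply, one_mul]
      rw [this]
      refine le_trans ?_ le_add_self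
      refine (mul_le_mul_right v2 _).trans ?_
      have p1 := hφ.nonneg y
      have p2 := hφ.nonneg z
      have p3 := kern_pos hW hε y z
      have p4 : Kern ε W z y = Kern ε W y z := by unfold Kern; rw [hW.symm z y]
      unfold FluxG
      rw [p4, ← ENNReal.ofReal_mul (by positivity), ← ENNReal.ofReal_mul hb0.le]
      apply ENNReal.ofReal_le_ofReal
      have := mul_le_mul_of_nonneg_right hyb.le
        (show 0 ≤ z * Kern ε W y z * (φ y * φ z) by positivity)
      linarith
    · have : B y z = FluxG ε W φ y z := by
        simp only [hB, indicator_of_mem (show y ∈ Icc c b from ⟨hyc, hyb.le⟩),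
          indicator_of_mem (show z ∈ Ici c from hzc), Pi.one_apply, one_mul]
      rw [this, mul_comm]
      exact (mul_le_mul_left v1 _).trans (le_add_self.trans le_self_add)
  have iA' : Measurable (fun p : ℝ × ℝ => A p.2 p.1) := iA.comp measurable_swap
  have s1 : ∀ F : ℝ → ℝ → ℝ≥0∞, Measurable (fun p : ℝ × ℝ => F p.1 p.2) →
      ∫⁻ y, ∫⁻ z, ENNReal.ofReal b * F y z = ENNReal.ofReal b * ∫⁻ y, ∫⁻ z, F y z := by
    intro F hF
    rw [← lintegral_const_mul' _ _ ENNReal.ofReal_ne_top]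
    exact lintegral_congr fun y => lintegral_const_mul' _ _ ENNReal.ofReal_ne_top
  have s2 : ∫⁻ y, ∫⁻ z, A z y = ∫⁻ y, ∫⁻ z, A y z :=
    lintegral_lintegral_swap iA'.aemeasurable
  have s3 : ∀ F G : ℝ → ℝ → ℝ≥0∞, Measurable (fun p : ℝ × ℝ => F p.1 p.2) →
      ∫⁻ y, ∫⁻ z, (F y z + G y z) = (∫⁻ y, ∫⁻ z, F y z) + ∫⁻ y, ∫⁻ z, G y z := by
    intro F G hF
    rw [← lintegral_add_left hF.lintegral_prod_right']
    exact lintegral_congr fun y => lintegral_add_left (hF.comp measurable_prodMk_left) _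
  refine lt_of_le_of_lt (lintegral_mono fun y => lintegral_mono fun z => pt y z) ?_
  rw [s3 (fun y z => ENNReal.ofReal b * A y z + ENNReal.ofReal b * B y z) _
      ((iA.const_mul _).add (iB.const_mul _)), s3 _ _ (iA.const_mul _), s1 A iA, s1 B iB,
    s1 (fun y z => A z y) iA', s2, eA, eB]
  have hb : ENNReal.ofReal b < ∞ := ENNReal.ofReal_lt_top
  exact ENNReal.add_lt_top.2 ⟨ENNReal.add_lt_top.2 ⟨ENNReal.mul_lt_top hb d1,
    ENNReal.mul_lt_top hb d2⟩, ENNReal.mul_lt_top hb d1⟩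

lemma FluxI_meas (hW : GW α W) (hφ : PosF φ) : Measurable (FluxI ε W φ) := by
  have hm : Measurable (fun p : ℝ × ℝ × ℝ => FluxG ε W φ p.2.1 p.2.2 *
      (Ioo p.2.1 (p.2.1 + p.2.2)).indicator (1 : ℝ → ℝ≥0∞) p.1) :=
    ((FluxG_meas hW hφ).comp (f := fun p : ℝ × ℝ × ℝ => (p.2.1, p.2.2)) (by fun_prop)).mul ioo_ind_meas
  exact ((hm.comp (f := fun p : (ℝ × ℝ) × ℝ => (p.1.1, p.1.2, p.2))
          (by fun_prop)).lintegral_prod_right').lintegral_prod_right'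

lemma FluxI_fin (hα : α ∈ Ioo (0:ℝ) 1) (hW : GW α W) (hε : 0 ≤ ε) (hφ : PosF φ)
    (hm : mom 1 φ = 1) (heq : ∀ᵐ x, 0 < x → x ^ 2 * φ x = (FluxI ε W φ x).toReal) :
    ∀ᵐ x, 0 < x → FluxI ε W φ x < ∞ := by
  have h : ∀ n : ℕ, ∀ᵐ x, (Ioo (1 / ((n:ℝ) + 2)) ((n:ℝ) + 2)).indicator 1 x * FluxI ε W φ x < ∞ := by
    intro n
    refine ae_lt_top ?_ (FluxI_fin_loc hα hW hε hφ hm heq (by positivity) ?_).ne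
    · exact (measurable_one.indicator measurableSet_Ioo).mul (FluxI_meas hW hφ)
    · rw [div_lt_iff₀ (by positivity)]
      have : (0:ℝ) ≤ n := by positivity
      nlinarith
  filter_upwards [ae_all_iff.2 h] with x hx h0
  obtain ⟨n, hn⟩ := exists_nat_gt (max x (1 / x))
  have hn1 := (le_max_left _ _).trans_lt hn
  have hn2 := (le_max_right _ _).trans_lt hn
  have := hx n
  rw [indicator_of_mem, Pi.one_apply, one_mul] at this
  · exact this
  · refine ⟨?_, by linarith⟩
    rw [div_lt_iff₀ h0] at hn2
    rw [div_lt_iff₀ (by positivity)]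
    nlinarith

lemma Prof_of_toReal (hα : α ∈ Ioo (0:ℝ) 1) (hW : GW α W) (hε : 0 ≤ ε) (hφ : PosF φ)
    (hm : mom 1 φ = 1) (heq : ∀ᵐ x, 0 < x → x ^ 2 * φ x = (FluxI ε W φ x).toReal) :
    Prof α ε W φ := by
  refine ⟨hφ, hm, ?_⟩
  filter_upwards [heq, FluxI_fin hα hW hε hφ hm heq] with x h1 h2
  rcases le_or_gt x 0 with h0 | h0
  · rw [hφ.zero x h0, mul_zero, ENNReal.ofReal_zero]
    symm
    rw [← lintegral_zero (μ := (volume : Measure ℝ))]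
    refine lintegral_congr fun y => ?_
    rw [← lintegral_zero (μ := (volume : Measure ℝ))]
    refine lintegral_congr fun z => ?_
    rcases le_or_gt y 0 with hy | hy
    · simp [hφ.zero y hy]
    · have : x ∉ Ioo y (y + z) := fun h => by linarith [h.1]
      simp [this]
  · rw [h1 h0, ENNReal.ofReal_toReal (h2 h0).ne]
    rfl

end reduction

end part20

section part21

noncomputable def Wext (W : ℝ → ℝ → ℝ) (x y : ℝ) : ℝ :=
  if 0 < x ∧ 0 < y then W x y else 0

lemma Wext_GW {α : ℝ} {W : ℝ → ℝ → ℝ} (hW : GoodW α W) : GW α (Wext W) := by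
  obtain ⟨h1, h2, -, h4⟩ := hW
  refine ⟨?_, ?_, ?_, ?_⟩
  · have hs : MeasurableSet (Ioi (0:ℝ) ×ˢ Ioi (0:ℝ)) := measurableSet_Ioi.prod measurableSet_Ioi
    have := h1.measurable_piecewise (g := fun _ : ℝ × ℝ => (0:ℝ)) continuousOn_const hs
    convert this using 1
    ext ⟨x, y⟩
    by_cases h : 0 < x ∧ 0 < y
    · have h' : (x, y) ∈ Ioi (0:ℝ) ×ˢ Ioi (0:ℝ) := h
      rw [Set.piecewise_eq_of_mem _ _ _ h']
      simp [Function.uncurry, Wext, h]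
    · have h' : (x, y) ∉ Ioi (0:ℝ) ×ˢ Ioi (0:ℝ) := h
      rw [Set.piecewise_eq_of_notMem _ _ _ h']
      simp only [Function.uncurry, Wext, if_neg h]
  · intro x y
    unfold Wext
    split_ifs with h
    · exact (h4 x y h.1 h.2).1
    · exact le_rfl
  · intro x y
    unfold Wext
    by_cases h : 0 < x ∧ 0 < y
    · rw [if_pos h, if_pos h.symm, h2 x y h.1 h.2]
    · rw [if_neg h, if_neg (fun k => h k.symm)]
  · intro x y hx hy
    unfold Wext
    rw [if_pos ⟨hx, hy⟩]
    refine (h4 x y hx hy).2.trans (le_of_eq ?_)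
    rw [div_rpow hx.le hy.le, div_rpow hy.le hx.le, rpow_neg hx.le, rpow_neg hy.le]
    ring

lemma toProf {α ε : ℝ} {W : ℝ → ℝ → ℝ} {φ : ℝ → ℝ} (hα : α ∈ Ioo (0:ℝ) 1) (hW : GoodW α W)
    (hε : 0 < ε) (hp : IsProfile (Kern ε W) φ) (hn : IsNormalised φ) :
    ∃ ψ, Prof α ε (Wext W) ψ ∧ ∀ᵐ x ∂(volume.restrict (Ioi (0:ℝ))), φ x = ψ x := by
  obtain ⟨p1, p2, p3, p4⟩ := hp
  have hm : AEStronglyMeasurable φ (volume.restrict (Ioi (0:ℝ))) := p1.aestronglyMeasurable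
  set ψ : ℝ → ℝ := (Ioi (0:ℝ)).indicator (fun x => max (hm.mk φ x) 0) with hψ
  have hpos : PosF ψ := by
    refine ⟨?_, ?_, ?_⟩
    · exact (hm.stronglyMeasurable_mk.measurable.max measurable_const).indicator measurableSet_Ioi
    · intro x
      exact indicator_nonneg (fun _ _ => le_max_right _ _) x
    · intro x hx
      exact indicator_of_notMem (not_lt.2 hx) _
  have hae : ∀ᵐ x ∂(volume.restrict (Ioi (0:ℝ))), φ x = ψ x := by
    filter_upwards [hm.ae_eq_mk, p2, ae_restrict_mem measurableSet_Ioi] with x h1 h2 h3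
    rw [hψ, indicator_of_mem h3, ← h1, max_eq_left h2]
  have hG := Wext_GW hW
  have hmass : mom 1 ψ = 1 := by
    have e1 : mom 1 ψ = ∫⁻ x in Ioi (0:ℝ), ENNReal.ofReal (x * φ x) := by
      unfold mom
      rw [← lintegral_add_compl _ (measurableSet_Ioi (a := (0:ℝ)))]
      have : ∫⁻ x in (Ioi (0:ℝ))ᶜ, ENNReal.ofReal (x ^ (1:ℝ) * ψ x) = 0 := by
        rw [setLIntegral_congr_fun (g := fun _ => 0) measurableSet_Ioi.compl]
        · simp
        · intro x hx
          simp [hpos.zero x (not_lt.1 hx)]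
      rw [this, add_zero]
      refine lintegral_congr_ae ?_
      filter_upwards [hae] with x hx
      rw [hx, rpow_one]
    rw [e1, ← ofReal_integral_eq_lintegral_ofReal p3]
    · rw [show ∫ x in Ioi (0:ℝ), x * φ x = 1 from hn, ENNReal.ofReal_one]
    · filter_upwards [p2, ae_restrict_mem measurableSet_Ioi] with x h2 h3
      exact mul_nonneg (le_of_lt h3) h2
  refine ⟨ψ, Prof_of_toReal hα hG hε.le hpos hmass ?_, hae⟩
  rw [ae_restrict_iff' measurableSet_Ioi] at p4
  have hae' := (ae_restrict_iff' measurableSet_Ioi).1 hae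
  filter_upwards [p4, hae'] with x hx hx' h0
  rw [← hx' h0, hx h0]
  have hGm := FluxG_meas (ε := ε) hG hpos
  -- the inner integral
  have inner : ∀ᵐ y ∂(volume.restrict (Ioo 0 x)),
      ∫ z in Ioi (x - y), y * Kern ε W y z * φ y * φ z =
        (∫⁻ z in Ioi (x - y), FluxG ε (Wext W) ψ y z).toReal := by
    rw [ae_restrict_iff' measurableSet_Ioo]
    filter_upwards [hae'] with y hy hyx
    have hy0 : 0 < y := hyx.1
    have hsub : Ioi (x - y) ⊆ Ioi 0 := Ioi_subset_Ioi (by linarith [hyx.2])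
    have e : ∀ᵐ z ∂(volume.restrict (Ioi (x - y))), y * Kern ε W y z * φ y * φ z =
        y * Kern ε (Wext W) y z * (ψ y * ψ z) := by
      rw [ae_restrict_iff' measurableSet_Ioi]
      filter_upwards [hae'] with z hz hzx
      have hz0 : 0 < z := hsub hzx
      rw [hy hy0, hz hz0]
      simp only [Kern, Wext, hy0, hz0, and_self, if_true]
      ring
    rw [integral_congr_ae e, integral_eq_lintegral_of_nonneg_ae]
    · rfl
    · refine Eventually.of_forall fun z => ?_
      have k := kern_pos hG hε.le y z
      have a1 := hpos.nonneg y
      have a2 := hpos.nonneg z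
      have : 0 ≤ Kern ε (Wext W) y z := by linarith
      exact mul_nonneg (mul_nonneg hy0.le this) (mul_nonneg a1 a2)
    · have k1 : Measurable (fun z => Kern ε (Wext W) y z) :=
        (kern_meas hG).comp (measurable_prodMk_left (x := y))
      have k2 := hpos.meas
      exact ((k1.const_mul y).mul (k2.const_mul _)).aestronglyMeasurable
  rw [integral_congr_ae inner]
  have hJ : ∀ y, 0 < y → ∫⁻ z in Ioi (x - y), FluxG ε (Wext W) ψ y z =
      ∫⁻ z, FluxG ε (Wext W) ψ y z * (Ioi x).indicator 1 (y + z) := by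
    intro y hy
    rw [← lintegral_indicator measurableSet_Ioi]
    refine lintegral_congr fun z => ?_
    by_cases h : x - y < z
    · have h' : y + z ∈ Ioi x := by show x < y + z; linarith
      rw [indicator_of_mem (show z ∈ Ioi (x - y) from h), indicator_of_mem h']; simp
    · have h' : y + z ∉ Ioi x := by show ¬ (x < y + z); linarith
      rw [indicator_of_notMem (show z ∉ Ioi (x - y) from h), indicator_of_notMem h']; simp
  have hJm : Measurable (fun y => ∫⁻ z, FluxG ε (Wext W) ψ y z * (Ioi x).indicator 1 (y + z)) := by
    refine Measurable.lintegral_prod_right' (f := fun p : ℝ × ℝ =>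
      FluxG ε (Wext W) ψ p.1 p.2 * (Ioi x).indicator 1 (p.1 + p.2)) (hGm.mul ?_)
    exact (measurable_one.indicator measurableSet_Ioi).comp (measurable_fst.add measurable_snd)
  rw [integral_toReal]
  · congr 1
    unfold FluxI
    rw [← lintegral_indicator measurableSet_Ioo]
    refine lintegral_congr fun y => ?_
    by_cases hy : y ∈ Ioo 0 x
    · rw [indicator_of_mem hy, hJ y hy.1]
      refine lintegral_congr fun z => ?_
      congr 1
      by_cases h : x < y + z
      · rw [indicator_of_mem (show y + z ∈ Ioi x from h),
          indicator_of_mem (show x ∈ Ioo y (y + z) from ⟨hy.2, h⟩)]; simp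
      · rw [indicator_of_notMem (show y + z ∉ Ioi x from h),
          indicator_of_notMem (show x ∉ Ioo y (y + z) from fun k => h k.2)]
    · rw [indicator_of_notMem hy]
      symm
      rw [← lintegral_zero (μ := (volume : Measure ℝ))]
      refine lintegral_congr fun z => ?_
      rcases le_or_gt y 0 with h | h
      · rw [FluxG_zero1 hpos h, zero_mul]
      · rw [indicator_of_notMem (fun k => hy ⟨h, k.1⟩), mul_zero]
  · refine hJm.aemeasurable.congr ?_
    filter_upwards [ae_restrict_mem measurableSet_Ioo] with y hy
    exact (hJ y hy.1).symm
  · filter_upwards [ae_restrict_mem measurableSet_Ioo] with y hy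
    exact (lintegral_mono_set Ioi_subset_Ici_self).trans_lt
      (FluxG_inner hα hG hε.le hpos hmass hy.1 (by linarith [hy.2]))

end part21

end helpers

theorem stmt1 (α : ℝ) (hα : α ∈ Ioo (0:ℝ) 1) (W : ℝ → ℝ → ℝ) (hW : GoodW α W)
    (hlow : 1/2 ≤ α → ∃ cstar > (0:ℝ), ∀ x y : ℝ, 0 < x → 0 < y →
      cstar * ((x / y) ^ α + (y / x) ^ α) ≤ W x y) :
    ∃ εstar > (0:ℝ), ∀ ε : ℝ, 0 < ε → ε < εstar →
      ∀ φ₁ φ₂ : ℝ → ℝ, IsProfile (Kern ε W) φ₁ → IsNormalised φ₁ →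
        IsProfile (Kern ε W) φ₂ → IsNormalised φ₂ →
        ∀ᵐ x ∂(volume.restrict (Ioi (0:ℝ))), φ₁ x = φ₂ x := by
  have hl : 1/2 ≤ α → ∃ cs > (0:ℝ), ∀ x y : ℝ, 0 < x → 0 < y →
      cs * (x ^ (-α) * y ^ α) ≤ Wext W x y := by
    intro h
    obtain ⟨c, hc, H⟩ := hlow h
    refine ⟨c, hc, fun x y hx hy => ?_⟩
    unfold Wext
    rw [if_pos ⟨hx, hy⟩]
    refine le_trans (mul_le_mul_of_nonneg_left ?_ hc.le) (H x y hx hy)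
    have e : (y / x) ^ α = x ^ (-α) * y ^ α := by
      rw [div_rpow hy.le hx.le, rpow_neg hx.le]; ring
    have : 0 ≤ (x / y) ^ α := by positivity
    linarith
  obtain ⟨ε₀, h0, H⟩ := uniq hα (Wext_GW hW) hl
  refine ⟨ε₀, h0, fun ε he he0 φ₁ φ₂ p1 n1 p2 n2 => ?_⟩
  obtain ⟨ψ₁, q1, e1⟩ := toProf hα hW he p1 n1
  obtain ⟨ψ₂, q2, e2⟩ := toProf hα hW he p2 n2
  filter_upwards [e1, e2, ae_restrict_of_ae (H ε ψ₁ ψ₂ he he0 q1 q2)] with x h1 h2 h3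
  rw [h1, h2, h3]
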